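/- Let (λ_i)_{i∈F} be a finite nonempty family of polynomial functions ℝⁿ → ℝ and (d_i)_{i∈F} natural numbers such that λ_i(δ_t(x)) = t^{Q−d_i} λ_i(x) for all t > 0 and x ∈ ℝⁿ, and such that for some index i₀ the function λ_{i₀} is a nonzero constant (so that necessarily d_{i₀} = Q). Define Λ(x,r) = Σ_{i∈F} |λ_i(x)| r^{d_i} for x ∈ ℝⁿ and r > 0. Call an index j ∈ {1,…,n} degenerate if Λ is not independent of the j-th coordinate (i.e., there exist r > 0 and points x, x′ ∈ ℝⁿ differing only in the j-th coordinate with Λ(x,r) ≠ Λ(x′,r)), and let v be the number of degenerate indices. Then for every bounded open set Ω ⊆ ℝⁿ containing the origin there exist a rational number Q₀ and an integer d₀ with 0 ≤ d₀ ≤ v such that ∫_Ω Λ(x,r)⁻¹ dx ≈ r^{−Q₀} (ln(1/r))^{d₀} as r → 0⁺. -/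

import Mathlib

open MeasureTheory
open scoped Classical

namespace Semialg

open Polynomial

/-- Evaluation at a point, as a ring homomorphism on an algebra of functions. -/
def ev {X : Type} (A : Subalgebra ℝ (X → ℝ)) (x : X) : A →+* ℝ :=
  (Pi.evalRingHom (fun _ : X => ℝ) x).comp A.val.toRingHom

@[simp] lemma ev_apply {X : Type} (A : Subalgebra ℝ (X → ℝ)) (x : X) (a : A) :
    ev A x a = (a : X → ℝ) x := rfl

/-- Specialization at a point of a polynomial whose coefficients are functions. -/
noncomputable def spec {X : Type} {A : Subalgebra ℝ (X → ℝ)} (p : A[X]) (x : X) : ℝ[X] :=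
  p.map (ev A x)

section spec
variable {X : Type} {A : Subalgebra ℝ (X → ℝ)}

@[simp] lemma spec_add (p q : A[X]) (x : X) : spec (p + q) x = spec p x + spec q x :=
  Polynomial.map_add _

@[simp] lemma spec_mul (p q : A[X]) (x : X) : spec (p * q) x = spec p x * spec q x :=
  Polynomial.map_mul _

@[simp] lemma spec_sub (p q : A[X]) (x : X) : spec (p - q) x = spec p x - spec q x :=
  Polynomial.map_sub _

@[simp] lemma spec_pow (p : A[X]) (n : ℕ) (x : X) : spec (p ^ n) x = spec p x ^ n :=
  Polynomial.map_pow _ n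

@[simp] lemma spec_C (a : A) (x : X) : spec (C a) x = C ((a : X → ℝ) x) :=
  Polynomial.map_C _

@[simp] lemma spec_X (x : X) : spec (Polynomial.X : A[X]) x = Polynomial.X :=
  Polynomial.map_X _

@[simp] lemma spec_derivative (p : A[X]) (x : X) : spec (derivative p) x = derivative (spec p x) :=
  (Polynomial.derivative_map _ _).symm

@[simp] lemma spec_iterate_derivative (p : A[X]) (k : ℕ) (x : X) :
    spec (derivative^[k] p) x = derivative^[k] (spec p x) :=
  (Polynomial.iterate_derivative_map _ _ _).symm

@[simp] lemma spec_coeff (p : A[X]) (k : ℕ) (x : X) :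
    (spec p x).coeff k = (p.coeff k : X → ℝ) x :=
  Polynomial.coeff_map _ _

lemma natDegree_spec_le (p : A[X]) (x : X) : (spec p x).natDegree ≤ p.natDegree :=
  Polynomial.natDegree_map_le

lemma eval_mem {Y : Type} {D : Subalgebra ℝ (Y → ℝ)} (π : Y → X) (hAD : ∀ a ∈ A, a ∘ π ∈ D)
    {k : Y → ℝ} (hk : k ∈ D) (p : A[X]) : (fun y => (spec p (π y)).eval (k y)) ∈ D := by
  induction p using Polynomial.induction_on' with
  | add p q hp hq =>
    simp only [spec_add, eval_add]
    exact D.add_mem hp hq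
  | monomial n a =>
    have : (fun y => (spec (monomial n a) (π y)).eval (k y)) = ((a : X → ℝ) ∘ π) * k ^ n := by
      funext y
      simp [spec]
    rw [this]
    exact D.mul_mem (hAD _ a.2) (D.pow_mem hk n)

end spec

/-- The algebra of functions generated by the pull-back of `A` and one more function `f`. -/
def evalAlg {X Y : Type} (π : Y → X) (A : Subalgebra ℝ (X → ℝ)) (f : Y → ℝ) :
    Subalgebra ℝ (Y → ℝ) where
  carrier := {h | ∃ p : A[X], h = fun y => (spec p (π y)).eval (f y)}
  mul_mem' := by
    rintro _ _ ⟨p, rfl⟩ ⟨q, rfl⟩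
    exact ⟨p * q, by funext y; simp⟩
  add_mem' := by
    rintro _ _ ⟨p, rfl⟩ ⟨q, rfl⟩
    exact ⟨p + q, by funext y; simp⟩
  algebraMap_mem' c := ⟨C (algebraMap ℝ A c), by funext y; simp⟩

lemma evalAlg_self {X Y : Type} (π : Y → X) (A : Subalgebra ℝ (X → ℝ)) (f : Y → ℝ) :
    f ∈ evalAlg π A f := ⟨Polynomial.X, by funext y; simp⟩

lemma evalAlg_base {X Y : Type} (π : Y → X) (A : Subalgebra ℝ (X → ℝ)) (f : Y → ℝ) {a : X → ℝ}
    (ha : a ∈ A) : a ∘ π ∈ evalAlg π A f := ⟨C ⟨a, ha⟩, by funext y; simp⟩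

/-- The semialgebraic sets relative to an algebra of functions: the Boolean algebra generated by
the sets where a function of the algebra is positive. -/
inductive SA {X : Type} (A : Subalgebra ℝ (X → ℝ)) : Set X → Prop
  | pos {f : X → ℝ} : f ∈ A → SA A {x | 0 < f x}
  | compl {S : Set X} : SA A S → SA A Sᶜ
  | inter {S T : Set X} : SA A S → SA A T → SA A (S ∩ T)

namespace SA
variable {X : Type} {A : Subalgebra ℝ (X → ℝ)}

lemma congr {S T : Set X} (h : SA A S) (e : ∀ x, x ∈ T ↔ x ∈ S) : SA A T := by
  rwa [Set.ext e]

lemma not {P : X → Prop} (h : SA A {x | P x}) : SA A {x | ¬ P x} := h.compl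

lemma and {P Q : X → Prop} (h : SA A {x | P x}) (h' : SA A {x | Q x}) :
    SA A {x | P x ∧ Q x} := h.inter h'

lemma or {P Q : X → Prop} (h : SA A {x | P x}) (h' : SA A {x | Q x}) :
    SA A {x | P x ∨ Q x} :=
  ((h.not.and h'.not).not).congr fun x => by simp only [Set.mem_ofPred_eq]; tauto

lemma imp {P Q : X → Prop} (h : SA A {x | P x}) (h' : SA A {x | Q x}) :
    SA A {x | P x → Q x} :=
  (h.not.or h').congr fun x => by simp only [Set.mem_ofPred_eq]; tauto

lemma true : SA A {_x | True} := (SA.pos A.one_mem).congr fun x => by simp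

lemma false : SA A {_x | False} := SA.true.not.congr fun x => by simp

lemma const (P : Prop) : SA A {_x | P} := by
  by_cases h : P
  · exact SA.true.congr fun x => by simp [h]
  · exact SA.false.congr fun x => by simp [h]

lemma lt {f g : X → ℝ} (hf : f ∈ A) (hg : g ∈ A) : SA A {x | f x < g x} :=
  (SA.pos (A.sub_mem hg hf)).congr fun x => by simp

lemma le {f g : X → ℝ} (hf : f ∈ A) (hg : g ∈ A) : SA A {x | f x ≤ g x} :=
  (lt hg hf).not.congr fun x => by simp

lemma eq {f g : X → ℝ} (hf : f ∈ A) (hg : g ∈ A) : SA A {x | f x = g x} :=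
  ((le hf hg).and (le hg hf)).congr fun x => by simp [le_antisymm_iff]

lemma forall_finset {ι : Type*} (L : Finset ι) {P : ι → X → Prop}
    (h : ∀ i ∈ L, SA A {x | P i x}) : SA A {x | ∀ i ∈ L, P i x} := by
  induction L using Finset.induction_on with
  | empty => exact SA.true.congr fun x => by simp
  | insert a s _ ih =>
    exact ((h a (by simp)).and (ih fun i hi => h i (by simp [hi]))).congr fun x => by simp

lemma exists_finset {ι : Type*} (L : Finset ι) {P : ι → X → Prop}
    (h : ∀ i ∈ L, SA A {x | P i x}) : SA A {x | ∃ i ∈ L, P i x} :=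
  (forall_finset L fun i hi => (h i hi).not).not.congr fun x => by simp

lemma comap {Y : Type} {π : Y → X} {D : Subalgebra ℝ (Y → ℝ)} {S : Set X} (h : SA A S)
    (H : ∀ a ∈ A, SA D {y | 0 < a (π y)}) : SA D (π ⁻¹' S) := by
  induction h with
  | pos hf => exact H _ hf
  | compl _ ih => exact ih.compl
  | inter _ _ ih ih' => exact ih.inter ih'

lemma measurableSet [MeasurableSpace X] (hA : ∀ a ∈ A, Measurable a) {S : Set X} (h : SA A S) :
    MeasurableSet S := by
  induction h with
  | pos hf => exact measurableSet_lt measurable_const (hA _ hf)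
  | compl _ ih => exact ih.compl
  | inter _ _ ih ih' => exact ih.inter ih'

end SA

/-- A function is tame over `A` if, after any base change, adjoining it to an algebra of functions
containing `A` creates no new semialgebraic sets. -/
def Tame {X : Type} (A : Subalgebra ℝ (X → ℝ)) (f : X → ℝ) : Prop :=
  ∀ (Y : Type) (π : Y → X) (D : Subalgebra ℝ (Y → ℝ)), (∀ a ∈ A, a ∘ π ∈ D) →
    ∀ h ∈ evalAlg id D (f ∘ π), SA D {y | 0 < h y}

namespace Tame
variable {X : Type} {A : Subalgebra ℝ (X → ℝ)}

lemma pullback {f : X → ℝ} (hf : Tame A f) {Y : Type} (π : Y → X) {D : Subalgebra ℝ (Y → ℝ)}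
    (hD : ∀ a ∈ A, a ∘ π ∈ D) : Tame D (f ∘ π) := fun Z ρ E hE h hh =>
  hf Z (π ∘ ρ) E (fun a ha => hE _ (hD a ha)) h hh

lemma of_mem {f : X → ℝ} (hf : f ∈ A) : Tame A f := by
  rintro Y π D hD _ ⟨p, rfl⟩
  exact .pos (eval_mem id (fun a ha => ha) (hD f hf) p)

lemma of_pair {f g k : X → ℝ} (hf : Tame A f) (hg : Tame A g)
    (hk : ∀ (Y : Type) (π : Y → X) (D : Subalgebra ℝ (Y → ℝ)), f ∘ π ∈ D → g ∘ π ∈ D →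
      k ∘ π ∈ D) : Tame A k := by
  rintro Y π D hD _ ⟨p, rfl⟩
  have h1 : ∀ a ∈ D, a ∘ id ∈ evalAlg id D (f ∘ π) := fun a ha => evalAlg_base _ _ _ ha
  have h2 : SA (evalAlg id D (f ∘ π)) {y | 0 < (spec p (id y)).eval ((k ∘ π) y)} := by
    refine hg Y π _ (fun a ha => h1 _ (hD a ha)) _ ?_
    refine eval_mem id (fun a ha => ?_) ?_ p
    · exact evalAlg_base id _ _ (h1 a ha)
    · exact hk _ _ _ (evalAlg_base id _ _ (evalAlg_self _ _ _)) (evalAlg_self _ _ _)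
  exact SA.comap (π := id) h2 fun a ha => hf Y π D hD a ha

lemma of_cover {f : X → ℝ} {ι : Type*} (L : Finset ι) (S : ι → Set X) (ξ : ι → X → ℝ)
    (hS : ∀ i ∈ L, SA A (S i)) (hξ : ∀ i ∈ L, Tame A (ξ i))
    (hcov : ∀ x, ∃ i ∈ L, x ∈ S i) (heq : ∀ i ∈ L, ∀ x ∈ S i, f x = ξ i x) : Tame A f := by
  rintro Y π D hD _ ⟨p, rfl⟩
  refine (SA.exists_finset (A := D) L (P := fun i y => π y ∈ S i ∧
    0 < (spec p y).eval (ξ i (π y))) fun i hi => SA.and ?_ ?_).congr fun y => ?_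
  · exact (hS i hi).comap fun a ha => .pos (hD a ha)
  · exact hξ i hi Y π D hD _ ⟨p, rfl⟩
  · simp only [Set.mem_ofPred_eq, id, Function.comp]
    constructor
    · intro h
      obtain ⟨i, hi, hx⟩ := hcov (π y)
      exact ⟨i, hi, hx, by rwa [← heq i hi _ hx]⟩
    · rintro ⟨i, hi, hx, h⟩
      rwa [heq i hi _ hx]

end Tame

/-- The algebra of tame functions over `A`. -/
def tameClosure {X : Type} (A : Subalgebra ℝ (X → ℝ)) : Subalgebra ℝ (X → ℝ) where
  carrier := {f | Tame A f}
  mul_mem' ha hb := Tame.of_pair ha hb fun _ _ D h h' => D.mul_mem h h'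
  add_mem' ha hb := Tame.of_pair ha hb fun _ _ D h h' => D.add_mem h h'
  algebraMap_mem' c := Tame.of_mem (A.algebraMap_mem c)

section closure
variable {X : Type} {A : Subalgebra ℝ (X → ℝ)}

lemma le_tameClosure : A ≤ tameClosure A := fun _ h => Tame.of_mem h

lemma SA.of_tameClosure {S : Set X} (h : SA (tameClosure A) S) : SA A S :=
  h.comap (π := id) fun a ha => ha X id A (fun _ h => h) a (evalAlg_self _ _ _)

lemma SA.mono {B : Subalgebra ℝ (X → ℝ)} (hAB : A ≤ B) {S : Set X} (h : SA A S) : SA B S :=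
  h.comap (π := id) fun _ ha => .pos (hAB ha)

lemma Tame.of_tameClosure {f : X → ℝ} (hf : Tame (tameClosure A) f) : Tame A f := by
  rintro Y π D hD _ ⟨p, rfl⟩
  refine SA.of_tameClosure (hf Y π (tameClosure D) (fun a ha => ?_) _ ?_)
  · exact Tame.pullback ha π hD
  · exact eval_mem id (fun a ha => evalAlg_base id _ _ (le_tameClosure ha)) (evalAlg_self _ _ _) p

lemma Tame.inv {f : X → ℝ} (hf : Tame A f) : Tame A f⁻¹ := by
  rintro Y π D hD _ ⟨p, rfl⟩
  have hf' : Tame D (f ∘ π) := hf.pullback π hD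
  have m1 : f ∘ π ∈ tameClosure D := hf'
  have m2 := eval_mem id (fun a ha => le_tameClosure ha) m1 p.reverse
  have m3 := (tameClosure D).mul_mem m2 ((tameClosure D).pow_mem m1 p.natDegree)
  have m4 := eval_mem id (fun a ha => le_tameClosure ha) ((tameClosure D).zero_mem) p
  have z := (tameClosure D).zero_mem
  refine (((SA.eq m1 z).and (SA.lt z m4)).or
    ((SA.eq m1 z).not.and (SA.lt z m3))).of_tameClosure.congr fun y => ?_
  simp only [Set.mem_ofPred_eq, id, Function.comp, Pi.inv_apply, Pi.zero_apply, Pi.mul_apply,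
    Pi.pow_apply]
  by_cases h0 : f (π y) = 0
  · simp [h0]
  · have : Invertible (f (π y))⁻¹ := invertibleOfNonzero (inv_ne_zero h0)
    have key := eval₂_reverse_mul_pow (ev D y) (f (π y))⁻¹ p
    have hinv : ⅟ (f (π y))⁻¹ = f (π y) := by simp
    rw [hinv, ← eval_map, ← eval_map] at key
    simp only [h0, false_and, not_false_eq_true, true_and, false_or]
    change 0 < eval _ (p.map _) ↔ 0 < eval _ (p.reverse.map _) * _
    rw [← key, inv_pow]
    have hs : 0 < (f (π y) ^ p.natDegree) ^ 2 := by positivity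
    have hne : f (π y) ^ p.natDegree ≠ 0 := pow_ne_zero _ h0
    rw [← mul_pos_iff_of_pos_right hs]
    field_simp

end closure

end Semialg

namespace Semialg
open Polynomial

lemma eval_pos_of_same_side {q : ℝ[X]} {c τ : ℝ}
    (h : ∀ r, q.IsRoot r → (r < c ↔ r < τ) ∧ (c < r ↔ τ < r)) (hc : 0 < q.eval c) :
    0 < q.eval τ := by
  by_contra! hτ
  have hcont : ContinuousOn (fun y => q.eval y) (Set.uIcc τ c) := q.continuous.continuousOn
  obtain ⟨r, hr, hr0⟩ := intermediate_value_uIcc hcont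
    (show (0 : ℝ) ∈ Set.uIcc (q.eval τ) (q.eval c) from Set.mem_uIcc.2 (Or.inl ⟨hτ, hc.le⟩))
  obtain ⟨h1, h2⟩ := h r hr0
  have : r = c := by
    rcases Set.mem_uIcc.1 hr with ⟨h3, h4⟩ | ⟨h3, h4⟩
    · rcases h4.lt_or_eq with h5 | h5
      · exact absurd (h1.1 h5) (not_lt.2 h3)
      · exact h5
    · rcases h3.lt_or_eq with h5 | h5
      · exact absurd (h2.1 h5) (not_lt.2 h4)
      · exact h5.symm
  subst this
  simp at hr0
  exact hc.ne' hr0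

lemma sign_const_of_no_root {q : ℝ[X]} {u v : ℝ} (h : ∀ y ∈ Set.Ioo u v, q.eval y ≠ 0) :
    (∀ y ∈ Set.Ioo u v, 0 < q.eval y) ∨ (∀ y ∈ Set.Ioo u v, q.eval y < 0) := by
  by_contra! hc
  obtain ⟨⟨y, hy, hy0⟩, ⟨z, hz, hz0⟩⟩ := hc
  have hcont : ContinuousOn (fun y => q.eval y) (Set.uIcc y z) := q.continuous.continuousOn
  obtain ⟨r, hr, hr0⟩ := intermediate_value_uIcc hcont
    (show (0 : ℝ) ∈ Set.uIcc (q.eval y) (q.eval z) from Set.mem_uIcc.2 (Or.inl ⟨hy0, hz0⟩))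
  exact h r (Set.ordConnected_Ioo.uIcc_subset hy hz hr) hr0

lemma strictMonoOn_or_strictAntiOn {q : ℝ[X]} {u v : ℝ}
    (h : ∀ y ∈ Set.Ioo u v, (derivative q).eval y ≠ 0) :
    StrictMonoOn (fun y => q.eval y) (Set.Icc u v) ∨
      StrictAntiOn (fun y => q.eval y) (Set.Icc u v) := by
  refine (sign_const_of_no_root h).imp (fun h => ?_) (fun h => ?_)
  · exact strictMonoOn_of_deriv_pos (convex_Icc u v) q.continuous.continuousOn
      (by simpa using fun x hx hx' => h x ⟨hx, hx'⟩)
  · exact strictAntiOn_of_deriv_neg (convex_Icc u v) q.continuous.continuousOn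
      (by simpa using fun x hx hx' => h x ⟨hx, hx'⟩)

section cover
variable {X : Type} {A : Subalgebra ℝ (X → ℝ)}

/-- Finitely many functions take all the values of the roots of the specializations of `p`. -/
def Covers (p : A[X]) (L : Finset (X → ℝ)) : Prop :=
  ∀ x, spec p x ≠ 0 → ∀ y, (spec p x).IsRoot y → ∃ ξ ∈ L, ξ x = y

/-- Finitely many functions meeting every gap left by the functions of `L`. -/
noncomputable def testPoints (L : Finset (X → ℝ)) : Finset (X → ℝ) :=
  insert 0 (L.image (· + 1) ∪ L.image (· - 1) ∪
    (L ×ˢ L).image fun f => (algebraMap ℝ (X → ℝ) (1 / 2)) * (f.1 + f.2))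

lemma testPoints_mem {L : Finset (X → ℝ)} (hL : ∀ f ∈ L, f ∈ A) :
    ∀ f ∈ testPoints L, f ∈ A := by
  intro f hf
  simp only [testPoints, Finset.mem_insert, Finset.mem_union, Finset.mem_image,
    Finset.mem_product] at hf
  rcases hf with rfl | (⟨g, hg, rfl⟩ | ⟨g, hg, rfl⟩) | ⟨g, hg, rfl⟩
  · exact A.zero_mem
  · exact A.add_mem (hL g hg) A.one_mem
  · exact A.sub_mem (hL g hg) A.one_mem
  · exact A.mul_mem (A.algebraMap_mem _) (A.add_mem (hL _ hg.1) (hL _ hg.2))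

lemma exists_testPoint (L : Finset (X → ℝ)) (x : X) (c : ℝ) :
    ∃ τ ∈ testPoints L, ∀ η ∈ L, (η x < c ↔ η x < τ x) ∧ (c < η x ↔ τ x < η x) := by
  have hlo := fun h => (L.filter fun η => η x ≤ c).exists_max_image (fun η => η x) h
  have hup := fun h => (L.filter fun η => c ≤ η x).exists_min_image (fun η => η x) h
  simp only [Finset.mem_filter, and_imp] at hlo hup
  by_cases h1 : (L.filter fun η => η x ≤ c).Nonempty <;>
    by_cases h2 : (L.filter fun η => c ≤ η x).Nonempty
  · obtain ⟨u, ⟨hu, hu1⟩, hu2⟩ := hlo h1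
    obtain ⟨v, ⟨hv, hv1⟩, hv2⟩ := hup h2
    refine ⟨algebraMap ℝ (X → ℝ) (1 / 2) * (u + v), ?_, fun η hη => ?_⟩
    · simp only [testPoints, Finset.mem_insert, Finset.mem_union, Finset.mem_image,
        Finset.mem_product]
      exact Or.inr (Or.inr ⟨(u, v), ⟨hu, hv⟩, rfl⟩)
    · have e : (algebraMap ℝ (X → ℝ) (1 / 2) * (u + v)) x = (u x + v x) / 2 := by
        simp [Pi.algebraMap_apply]; ring
      rw [e]
      have a1 := hu2 η hη
      have a2 := hv2 η hη
      rcases le_total (η x) c with h | h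
      · have a3 := a1 h
        rcases h.lt_or_eq with h' | h'
        · constructor
          · exact ⟨fun _ => by
              rcases (hu1.trans hv1).lt_or_eq with h6 | h6
              · linarith
              · linarith, fun _ => h'⟩
          · constructor <;> intro h3 <;> linarith
        · have a4 := a2 h'.ge
          constructor <;> constructor <;> intro h3 <;> linarith
      · have a3 := a2 h
        rcases h.lt_or_eq with h' | h'
        · constructor
          · constructor <;> intro h3 <;> linarith
          · exact ⟨fun _ => by
              rcases (hu1.trans hv1).lt_or_eq with h6 | h6
              · linarith
              · linarith, fun _ => h'⟩
        · have a4 := a1 h'.ge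
          constructor <;> constructor <;> intro h3 <;> linarith
  · obtain ⟨u, ⟨hu, hu1⟩, hu2⟩ := hlo h1
    refine ⟨u + 1, ?_, fun η hη => ?_⟩
    · simp only [testPoints, Finset.mem_insert, Finset.mem_union, Finset.mem_image]
      exact Or.inr (Or.inl (Or.inl ⟨u, hu, rfl⟩))
    · have h : η x < c := by
        by_contra! h
        exact h2 ⟨η, by simp [hη, h]⟩
      have := hu2 η hη h.le
      simp only [Pi.add_apply, Pi.one_apply]
      constructor <;> constructor <;> intro <;> linarith
  · obtain ⟨u, ⟨hu, hu1⟩, hu2⟩ := hup h2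
    refine ⟨u - 1, ?_, fun η hη => ?_⟩
    · simp only [testPoints, Finset.mem_insert, Finset.mem_union, Finset.mem_image]
      exact Or.inr (Or.inl (Or.inr ⟨u, hu, rfl⟩))
    · have h : c < η x := by
        by_contra! h
        exact h1 ⟨η, by simp [hη, h]⟩
      have := hu2 η hη h.le
      simp only [Pi.sub_apply, Pi.one_apply]
      constructor <;> constructor <;> intro <;> linarith
  · refine ⟨0, by simp [testPoints], fun η hη => ?_⟩
    exfalso
    rcases le_total (η x) c with h | h
    · exact h1 ⟨η, by simp [hη, h]⟩
    · exact h2 ⟨η, by simp [hη, h]⟩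

lemma eval_tame {f : X → ℝ} (hf : f ∈ tameClosure A) (p : A[X]) :
    (fun x => (spec p x).eval (f x)) ∈ tameClosure A :=
  eval_mem id (fun _ ha => le_tameClosure ha) hf p

/-- The sign of a polynomial at the unique root of `p` in a given gap is semialgebraic. -/
lemma SA_root_sign {d : ℕ}
    (ih : ∀ p : A[X], p.natDegree ≤ d → ∃ L : Finset (X → ℝ), (∀ ξ ∈ L, Tame A ξ) ∧ Covers p L)
    {p : A[X]} (hp : p.natDegree ≤ d + 1) {u v ξ : X → ℝ} (hu : Tame A u) (hv : Tame A v)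
    {D : Set X} (hD : SA A D) (ha : ∀ x ∈ D, (p.coeff (d + 1) : X → ℝ) x ≠ 0)
    (hroot : ∀ x ∈ D, (spec p x).eval (ξ x) = 0)
    (huv : ∀ x ∈ D, u x < ξ x ∧ ξ x < v x)
    (huniq : ∀ x ∈ D, ∀ y, u x < y → y < v x → (spec p x).eval y = 0 → y = ξ x)
    (hmono : ∀ x ∈ D, ∀ y, u x < y → y < v x →
      (ξ x < y ↔ 0 < (spec p x).eval y * (spec p x).eval (v x))) :
    ∀ (m : ℕ) (q : A[X]), q.natDegree ≤ m → SA A {x | x ∈ D ∧ 0 < (spec q x).eval (ξ x)} := by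
  have hD' : SA (tameClosure A) {x | x ∈ D} := hD.mono le_tameClosure
  have key : ∀ η ∈ tameClosure A, SA (tameClosure A) {x | x ∈ D ∧ ξ x < η x} ∧
      SA (tameClosure A) {x | x ∈ D ∧ η x < ξ x} := by
    intro η hη
    have z := (tameClosure A).zero_mem
    have e1 := eval_tame hη p
    have e2 := (tameClosure A).mul_mem e1 (eval_tame hv p)
    have gt : SA (tameClosure A) {x | x ∈ D ∧ ξ x < η x} := by
      refine (hD'.and ((SA.le hv hη).or (((SA.lt hu hη).and (SA.lt hη hv)).and
        (SA.lt z e2)))).congr fun x => ?_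
      simp only [Set.mem_ofPred_eq, Pi.zero_apply, Pi.mul_apply]
      refine and_congr_right fun hx => ?_
      obtain ⟨h1, h2⟩ := huv x hx
      constructor
      · intro h
        rcases le_or_gt (v x) (η x) with h3 | h3
        · exact Or.inl h3
        · exact Or.inr ⟨⟨h1.trans h, h3⟩, (hmono x hx _ (h1.trans h) h3).1 h⟩
      · rintro (h | ⟨⟨h3, h4⟩, h5⟩)
        · exact h2.trans_le h
        · exact (hmono x hx _ h3 h4).2 h5
    have eq : SA (tameClosure A) {x | x ∈ D ∧ ξ x = η x} := by
      refine (hD'.and (((SA.lt hu hη).and (SA.lt hη hv)).and (SA.eq e1 z))).congr fun x => ?_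
      simp only [Set.mem_ofPred_eq, Pi.zero_apply]
      refine and_congr_right fun hx => ?_
      obtain ⟨h1, h2⟩ := huv x hx
      constructor
      · intro h
        rw [← h]
        exact ⟨⟨h1, h2⟩, hroot x hx⟩
      · rintro ⟨⟨h3, h4⟩, h5⟩
        exact (huniq x hx _ h3 h4 h5).symm
    exact ⟨gt, (hD'.and (gt.or eq).not).congr fun x => by
      simp only [Set.mem_ofPred_eq]
      constructor
      · rintro ⟨h, h'⟩
        exact ⟨h, by rintro (⟨_, h2⟩ | ⟨_, h2⟩) <;> linarith⟩
      · rintro ⟨h, h'⟩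
        refine ⟨h, ?_⟩
        by_contra! hc
        rcases hc.lt_or_eq with h2 | h2
        · exact h' (Or.inl ⟨h, h2⟩)
        · exact h' (Or.inr ⟨h, h2⟩)⟩
  have low : ∀ q : A[X], q.natDegree ≤ d →
      SA A {x | x ∈ D ∧ 0 < (spec q x).eval (ξ x)} := by
    intro q hq
    obtain ⟨L, hL, hcov⟩ := ih q hq
    have z := (tameClosure A).zero_mem
    have hT := testPoints_mem (A := tameClosure A) hL
    refine ((hD'.and (SA.exists_finset (testPoints L) (P := fun τ x =>
      (∀ η ∈ L, ((x ∈ D ∧ η x < ξ x ↔ η x < τ x) ∧ (x ∈ D ∧ ξ x < η x ↔ τ x < η x))) ∧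
        0 < (spec q x).eval (τ x)) fun τ hτ => ?_))).of_tameClosure.congr fun x => ?_
    · refine (SA.forall_finset L fun η hη => ?_).and (SA.lt z (eval_tame (hT τ hτ) q))
      have a1 := (key η (hL η hη)).1
      have a2 := (key η (hL η hη)).2
      have b1 := SA.lt (hL η hη) (hT τ hτ)
      have b2 := SA.lt (hT τ hτ) (hL η hη)
      exact (((a2.imp b1).and (b1.imp a2)).and ((a1.imp b2).and (b2.imp a1))).congr fun x => by
        simp only [Set.mem_ofPred_eq, iff_def]
    · simp only [Set.mem_ofPred_eq]
      refine and_congr_right fun hx => ?_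
      simp only [hx, true_and]
      constructor
      · intro h
        obtain ⟨τ, hτ, hτ'⟩ := exists_testPoint L x (ξ x)
        refine ⟨τ, hτ, hτ', eval_pos_of_same_side (fun r hr => ?_) h⟩
        obtain ⟨η, hη, rfl⟩ := hcov x (by rintro h0; simp [h0] at h) r hr
        exact hτ' η hη
      · rintro ⟨τ, hτ, hτ', h⟩
        refine eval_pos_of_same_side (fun r hr => ?_) h
        obtain ⟨η, hη, rfl⟩ := hcov x (by rintro h0; simp [h0] at h) r hr
        exact ⟨(hτ' η hη).1.symm, (hτ' η hη).2.symm⟩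
  intro m
  induction m with
  | zero => exact fun q hq => low q (hq.trans (Nat.zero_le d))
  | succ m ihm =>
    intro q hq
    rcases le_or_gt q.natDegree d with h | h
    · exact low q h
    rcases hq.lt_or_eq with h' | h'
    · exact ihm q (Nat.lt_succ_iff.1 h')
    set a := p.coeff (d + 1) with ha_def
    set b := q.coeff (m + 1) with hb_def
    have hdm : d ≤ m := by omega
    set q₁ : A[X] := C (a ^ 2) * q - C (a * b) * (Polynomial.X ^ (m - d) * p) with hq₁
    have hdeg : q₁.natDegree ≤ m := by
      rw [natDegree_le_iff_coeff_eq_zero]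
      intro N hN
      rw [hq₁, coeff_sub, coeff_C_mul, coeff_C_mul, coeff_X_pow_mul', if_pos (by omega)]
      rcases (Nat.succ_le_of_lt hN).lt_or_eq with h2 | h2
      · rw [coeff_eq_zero_of_natDegree_lt (by omega : q.natDegree < N),
          coeff_eq_zero_of_natDegree_lt (by omega : p.natDegree < N - (m - d))]
        simp
      · have e1 : N - (m - d) = d + 1 := by omega
        rw [e1, ← h2, ← hb_def, ← ha_def]
        ring
    refine (ihm q₁ hdeg).congr fun x => and_congr_right fun hx => ?_
    have e : (spec q₁ x).eval (ξ x) = (a : X → ℝ) x ^ 2 * (spec q x).eval (ξ x) := by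
      rw [hq₁]
      simp [hroot x hx]
    rw [e]
    have : 0 < (a : X → ℝ) x ^ 2 := by have := ha x hx; positivity
    exact (mul_pos_iff_of_pos_left this).symm
end cover

lemma tame_root {d : ℕ}
    (ih : ∀ (X : Type) (A : Subalgebra ℝ (X → ℝ)) (p : A[X]), p.natDegree ≤ d →
      ∃ L : Finset (X → ℝ), (∀ ξ ∈ L, Tame A ξ) ∧ Covers p L)
    {X : Type} {A : Subalgebra ℝ (X → ℝ)}
    {p : A[X]} (hp : p.natDegree ≤ d + 1) {u v ξ : X → ℝ} (hu : Tame A u) (hv : Tame A v)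
    {D : Set X} (hD : SA A D) (ha : ∀ x ∈ D, (p.coeff (d + 1) : X → ℝ) x ≠ 0)
    (hroot : ∀ x ∈ D, (spec p x).eval (ξ x) = 0)
    (huv : ∀ x ∈ D, u x < ξ x ∧ ξ x < v x)
    (hmono : ∀ x ∈ D, StrictMonoOn (fun y => (spec p x).eval y) (Set.Icc (u x) (v x)) ∨
      StrictAntiOn (fun y => (spec p x).eval y) (Set.Icc (u x) (v x)))
    (hoff : ∀ x ∉ D, ξ x = 0) : Tame A ξ := by
  rintro Y π E hE _ ⟨q, rfl⟩
  let φ : A →+* E :=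
    { toFun := fun a => ⟨(a : X → ℝ) ∘ π, hE _ a.2⟩
      map_one' := rfl
      map_mul' := fun _ _ => rfl
      map_zero' := rfl
      map_add' := fun _ _ => rfl }
  have hspec : ∀ y, spec (p.map φ) y = spec p (π y) := fun y => by
    rw [spec, spec, Polynomial.map_map]; rfl
  have hD' : SA E (π ⁻¹' D) := hD.comap fun a ha => .pos (hE a ha)
  have h1 := SA_root_sign (ih Y E) (p := p.map φ) (natDegree_map_le.trans hp)
    (hu.pullback π hE) (hv.pullback π hE) (ξ := ξ ∘ π) hD'
    (fun y hy => by rw [coeff_map]; exact ha _ hy)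
    (fun y hy => by rw [hspec]; exact hroot _ hy) (fun y hy => huv _ hy)
    (fun y hy t h1 h2 h3 => by
      rw [hspec] at h3
      have h4 := huv _ hy
      rw [← hroot _ hy] at h3
      rcases hmono _ hy with hm | hm
      · exact hm.injOn ⟨h1.le, h2.le⟩ ⟨h4.1.le, h4.2.le⟩ h3
      · exact hm.injOn ⟨h1.le, h2.le⟩ ⟨h4.1.le, h4.2.le⟩ h3)
    (fun y hy t h1 h2 => by
      rw [hspec]
      have h4 := huv _ hy
      have m1 : ξ (π y) ∈ Set.Icc (u (π y)) (v (π y)) := ⟨h4.1.le, h4.2.le⟩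
      have m2 : t ∈ Set.Icc (u (π y)) (v (π y)) := ⟨h1.le, h2.le⟩
      have m3 : v (π y) ∈ Set.Icc (u (π y)) (v (π y)) := ⟨(h1.trans h2).le, le_rfl⟩
      rcases hmono _ hy with hm | hm
      · have e1 := hm.lt_iff_lt m1 m2
        have e2 := hm m1 m3 h4.2
        simp only [hroot _ hy] at e1 e2
        change ξ (π y) < t ↔ 0 < eval t (spec p (π y)) * eval (v (π y)) (spec p (π y))
        rw [mul_pos_iff_of_pos_right e2, e1]
      · have e1 := hm.lt_iff_gt m2 m1
        have e2 := hm m1 m3 h4.2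
        simp only [hroot _ hy] at e1 e2
        change ξ (π y) < t ↔ 0 < eval t (spec p (π y)) * eval (v (π y)) (spec p (π y))
        rw [← e1, mul_pos_iff]
        exact ⟨fun h => Or.inr ⟨h, e2⟩, fun h => h.elim (fun h => absurd h.2 e2.not_gt)
          fun h => h.1⟩)
    q.natDegree q le_rfl
  have h2 := eval_mem id (fun _ ha => ha) E.zero_mem q
  refine (SA.or (P := fun y => π y ∈ D ∧ 0 < (spec q y).eval (ξ (π y))) h1
    (hD'.not.and (SA.lt E.zero_mem h2))).congr fun y => ?_
  simp only [Set.mem_ofPred_eq, id, Function.comp]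
  by_cases hy : π y ∈ D
  · simp [hy]
  · simp [hy, hoff _ hy]

theorem exists_root_cover (d : ℕ) : ∀ (X : Type) (A : Subalgebra ℝ (X → ℝ)) (p : A[X]),
    p.natDegree ≤ d → ∃ L : Finset (X → ℝ), (∀ ξ ∈ L, Tame A ξ) ∧ Covers p L := by
  induction d with
  | zero =>
    intro X A p hp
    refine ⟨∅, by simp, fun x hx y hy => ?_⟩
    have h1 : (spec p x).natDegree = 0 := Nat.le_zero.1 ((natDegree_spec_le p x).trans hp)
    rw [eq_C_of_natDegree_eq_zero h1] at hx hy
    simp at hx hy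
    exact absurd hy hx
  | succ d ih =>
    intro X A p hp
    rcases hp.lt_or_eq with hp' | hp'
    · exact ih X A p (Nat.lt_succ_iff.1 hp')
    obtain ⟨L₀, hL₀, hc₀⟩ := ih X A p.eraseLead (by have := p.eraseLead_natDegree_le; omega)
    obtain ⟨L₁, hL₁, hc₁⟩ := ih X A (derivative p) (by have := natDegree_derivative_le p; omega)
    set a := p.coeff (d + 1) with ha_def
    have ha : Tame A (a : X → ℝ) := .of_mem a.2
    set M : X → ℝ := 1 + ∑ i ∈ Finset.range (d + 1),
      (1 + ((p.coeff i : X → ℝ) * (a : X → ℝ)⁻¹) ^ 2) with hM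
    have hMt : M ∈ tameClosure A := by
      refine add_mem (one_mem _) (sum_mem fun i _ => add_mem (one_mem _) (pow_mem ?_ 2))
      exact mul_mem (le_tameClosure (p.coeff i).2) ha.inv
    have hbound : ∀ x, (a : X → ℝ) x ≠ 0 → ∀ y, (spec p x).IsRoot y → |y| < M x := by
      intro x hx y hy
      have hnd : (spec p x).natDegree = d + 1 :=
        natDegree_eq_of_le_of_coeff_ne_zero ((natDegree_spec_le p x).trans hp)
          (by simpa [← ha_def] using hx)
      have h0 : spec p x ≠ 0 := by rintro h; simp [h] at hnd
      have h1 : |y| < (cauchyBound (spec p x) : ℝ) := hy.norm_lt_cauchyBound h0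
      refine h1.trans_le ?_
      have hl : (spec p x).leadingCoeff = (a : X → ℝ) x := by
        rw [leadingCoeff, hnd, spec_coeff]
      have h2 : (((Finset.range (d + 1)).sup fun i => ‖(spec p x).coeff i‖₊ : NNReal) : ℝ) ≤
          |(a : X → ℝ) x| * ∑ i ∈ Finset.range (d + 1),
            (1 + (((p.coeff i : X → ℝ) * (a : X → ℝ)⁻¹) x) ^ 2) := by
        have hs : 0 ≤ |(a : X → ℝ) x| * ∑ i ∈ Finset.range (d + 1),
            (1 + (((p.coeff i : X → ℝ) * (a : X → ℝ)⁻¹) x) ^ 2) := by positivity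
        rw [← Real.coe_toNNReal _ hs, NNReal.coe_le_coe]
        refine Finset.sup_le fun i hi => ?_
        rw [← NNReal.coe_le_coe, Real.coe_toNNReal _ hs, coe_nnnorm, Real.norm_eq_abs, spec_coeff]
        refine le_trans ?_ (mul_le_mul_of_nonneg_left (Finset.single_le_sum
          (f := fun i => (1 + (((p.coeff i : X → ℝ) * (a : X → ℝ)⁻¹) x) ^ 2))
          (fun i _ => by positivity) hi) (abs_nonneg _))
        have e : |(p.coeff i : X → ℝ) x| =
            |(a : X → ℝ) x| * |(((p.coeff i : X → ℝ) * (a : X → ℝ)⁻¹) x)| := by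
          rw [← abs_mul]
          simp only [Pi.mul_apply, Pi.inv_apply]
          congr 1
          field_simp
        rw [e]
        refine mul_le_mul_of_nonneg_left ?_ (abs_nonneg _)
        rw [← sq_abs]
        nlinarith [sq_nonneg (|(((p.coeff i : X → ℝ) * (a : X → ℝ)⁻¹) x)| - 1),
          abs_nonneg ((((p.coeff i : X → ℝ) * (a : X → ℝ)⁻¹) x))]
      rw [cauchyBound, hnd, hl]
      push_cast
      rw [Real.norm_eq_abs]
      have h3 := (div_le_iff₀' (abs_pos.2 hx)).2 h2
      simp only [hM, Pi.add_apply, Pi.one_apply, Finset.sum_apply, Pi.pow_apply]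
      linarith
    set Z : Finset (X → ℝ) := insert M (insert (-M) L₁) with hZ
    have hZt : ∀ z ∈ Z, z ∈ tameClosure A := by
      intro z hz
      simp only [hZ, Finset.mem_insert] at hz
      rcases hz with rfl | rfl | hz
      · exact hMt
      · exact neg_mem hMt
      · exact hL₁ z hz
    let D : (X → ℝ) → (X → ℝ) → Set X := fun u v => {x | ((a : X → ℝ) x ≠ 0 ∧ u x < v x) ∧
      (∀ z ∈ Z, ¬ (u x < z x ∧ z x < v x)) ∧ (spec p x).eval (u x) * (spec p x).eval (v x) < 0}
    let ξ : (X → ℝ) → (X → ℝ) → X → ℝ := fun u v x =>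
      if h : x ∈ D u v ∧ ∃ y, (u x < y ∧ y < v x) ∧ (spec p x).eval y = 0 then h.2.choose else 0
    have hderiv : ∀ u v, ∀ x ∈ D u v, ∀ y ∈ Set.Ioo (u x) (v x),
        (derivative (spec p x)).eval y ≠ 0 := by
      rintro u v x ⟨⟨hx1, hx2⟩, hx3, hx4⟩ y hy h0
      obtain ⟨z, hz, rfl⟩ := hc₁ x (by
        intro h
        have := congrArg (fun q => q.coeff d) h
        simp [coeff_derivative] at this
        rcases this with h | h
        · exact hx1 h
        · linarith [(Nat.cast_nonneg d : (0 : ℝ) ≤ d)]) y (by simpa using h0)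
      exact hx3 z (by simp [hZ, hz]) hy
    have hex : ∀ u v, ∀ x ∈ D u v, ∃ y, (u x < y ∧ y < v x) ∧ (spec p x).eval y = 0 := by
      rintro u v x ⟨⟨hx1, hx2⟩, hx3, hx4⟩
      have hcont : ContinuousOn (fun y => (spec p x).eval y) (Set.Icc (u x) (v x)) :=
        (spec p x).continuous.continuousOn
      rcases mul_neg_iff.1 hx4 with ⟨h1, h2⟩ | ⟨h1, h2⟩
      · obtain ⟨y, hy, hy0⟩ := intermediate_value_Ioo' hx2.le hcont ⟨h2, h1⟩
        exact ⟨y, hy, hy0⟩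
      · obtain ⟨y, hy, hy0⟩ := intermediate_value_Ioo hx2.le hcont ⟨h1, h2⟩
        exact ⟨y, hy, hy0⟩
    have hξ : ∀ u v, ∀ x ∈ D u v, (u x < ξ u v x ∧ ξ u v x < v x) ∧
        (spec p x).eval (ξ u v x) = 0 := by
      intro u v x hx
      have h : x ∈ D u v ∧ ∃ y, (u x < y ∧ y < v x) ∧ (spec p x).eval y = 0 := ⟨hx, hex u v x hx⟩
      have e : ξ u v x = h.2.choose := dif_pos h
      rw [e]
      exact h.2.choose_spec
    have hξt : ∀ u ∈ Z, ∀ v ∈ Z, Tame A (ξ u v) := by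
      intro u hu v hv
      have z := (tameClosure A).zero_mem
      refine tame_root ih hp (hZt u hu) (hZt v hv) (D := D u v) ?_ (fun x hx => hx.1.1)
        (fun x hx => (hξ u v x hx).2) (fun x hx => (hξ u v x hx).1)
        (fun x hx => strictMonoOn_or_strictAntiOn (hderiv u v x hx))
        (fun x hx => dif_neg fun h => hx h.1)
      refine (((SA.eq ha z).not.and (SA.lt (hZt u hu) (hZt v hv))).and
        ((SA.forall_finset Z (P := fun z x => ¬ (u x < z x ∧ z x < v x)) fun w hw =>
          ((SA.lt (hZt u hu) (hZt w hw)).and (SA.lt (hZt w hw) (hZt v hv))).not).and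
          (SA.lt ((tameClosure A).mul_mem (eval_tame (hZt u hu) p) (eval_tame (hZt v hv) p))
            z))).of_tameClosure
    refine ⟨L₀ ∪ Z ∪ (Z ×ˢ Z).image fun f => ξ f.1 f.2, ?_, ?_⟩
    · intro f hf
      simp only [Finset.mem_union, Finset.mem_image, Finset.mem_product] at hf
      rcases hf with (hf | hf) | ⟨g, ⟨hg1, hg2⟩, rfl⟩
      · exact hL₀ f hf
      · exact hZt f hf
      · exact hξt _ hg1 _ hg2
    · intro x hx y hy
      simp only [Finset.mem_union, Finset.mem_image, Finset.mem_product]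
      by_cases hax : (a : X → ℝ) x = 0
      · have e : spec p x = spec p.eraseLead x := by
          have := congrArg (fun q : A[X] => spec q x) p.eraseLead_add_C_mul_X_pow
          simp only [spec_add, spec_mul, spec_C, leadingCoeff, hp', ← ha_def, hax] at this
          simpa using this.symm
        rw [e] at hx hy
        obtain ⟨f, hf, hfy⟩ := hc₀ x hx y hy
        exact ⟨f, Or.inl (Or.inl hf), hfy⟩
      by_cases hyZ : ∃ z ∈ Z, z x = y
      · obtain ⟨z, hz, hzy⟩ := hyZ
        exact ⟨z, Or.inl (Or.inr hz), hzy⟩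
      push Not at hyZ
      have hb := abs_lt.1 (hbound x hax y hy)
      obtain ⟨u, hu, hu'⟩ := (Z.filter fun z => z x < y).exists_max_image (fun z => z x)
        ⟨-M, by simp [hZ, hb.1]⟩
      obtain ⟨v, hv, hv'⟩ := (Z.filter fun z => y < z x).exists_min_image (fun z => z x)
        ⟨M, by simp [hZ, hb.2]⟩
      simp only [Finset.mem_filter, and_imp] at hu hu' hv hv'
      have hgap : ∀ z ∈ Z, ¬ (u x < z x ∧ z x < v x) := by
        rintro z hz ⟨h1, h2⟩
        rcases lt_or_gt_of_ne (hyZ z hz) with h | h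
        · linarith [hu' z hz h]
        · linarith [hv' z hz h]
      have hd0 : ∀ t ∈ Set.Ioo (u x) (v x), (derivative (spec p x)).eval t ≠ 0 := by
        intro t ht h0
        obtain ⟨z, hz, rfl⟩ := hc₁ x (by
          intro h
          have := congrArg (fun q => q.coeff d) h
          simp [coeff_derivative] at this
          rcases this with h | h
          · exact hax h
          · linarith [(Nat.cast_nonneg d : (0 : ℝ) ≤ d)]) t (by simpa using h0)
        exact hgap z (by simp [hZ, hz]) ht
      have m1 : u x ∈ Set.Icc (u x) (v x) := ⟨le_rfl, (hu.2.trans hv.2).le⟩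
      have m2 : y ∈ Set.Icc (u x) (v x) := ⟨hu.2.le, hv.2.le⟩
      have m3 : v x ∈ Set.Icc (u x) (v x) := ⟨(hu.2.trans hv.2).le, le_rfl⟩
      have hm := strictMonoOn_or_strictAntiOn hd0
      have hy0 : (spec p x).eval y = 0 := hy
      have hxD : x ∈ D u v := by
        refine ⟨⟨hax, hu.2.trans hv.2⟩, hgap, ?_⟩
        rcases hm with hm | hm
        · have e1 := hm m1 m2 hu.2
          have e2 := hm m2 m3 hv.2
          simp only [hy0] at e1 e2
          exact mul_neg_of_neg_of_pos e1 e2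
        · have e1 := hm m1 m2 hu.2
          have e2 := hm m2 m3 hv.2
          simp only [hy0] at e1 e2
          exact mul_neg_of_pos_of_neg e1 e2
      refine ⟨ξ u v, Or.inr ⟨(u, v), ⟨hu.1, hv.1⟩, rfl⟩, ?_⟩
      obtain ⟨⟨h1, h2⟩, h3⟩ := hξ u v x hxD
      rw [← hy0] at h3
      rcases hm with hm | hm
      · exact hm.injOn ⟨h1.le, h2.le⟩ m2 h3
      · exact hm.injOn ⟨h1.le, h2.le⟩ m2 h3

end Semialg

namespace Semialg
open Polynomial

/-- An algebra of functions containing all its tame functions. -/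
def IsTame {X : Type} (B : Subalgebra ℝ (X → ℝ)) : Prop := ∀ f, Tame B f → f ∈ B

lemma isTame_tameClosure {X : Type} (A : Subalgebra ℝ (X → ℝ)) : IsTame (tameClosure A) :=
  fun _ hf => hf.of_tameClosure

lemma exists_root_cover_finset {X : Type} {A : Subalgebra ℝ (X → ℝ)} (P : Finset A[X]) :
    ∃ L : Finset (X → ℝ), (∀ ξ ∈ L, Tame A ξ) ∧ ∀ p ∈ P, Covers p L := by
  choose L hL hc using fun p : A[X] => exists_root_cover p.natDegree X A p le_rfl
  refine ⟨P.biUnion L, ?_, fun p hp x hx y hy => ?_⟩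
  · intro ξ hξ
    obtain ⟨p, -, hp⟩ := Finset.mem_biUnion.1 hξ
    exact hL p ξ hp
  · obtain ⟨ξ, hξ, e⟩ := hc p x hx y hy
    exact ⟨ξ, Finset.mem_biUnion.2 ⟨p, hp, hξ⟩, e⟩

namespace IsTame
variable {X : Type} {B : Subalgebra ℝ (X → ℝ)}

lemma const_mem (c : ℝ) : (fun _ => c : X → ℝ) ∈ B := B.algebraMap_mem c

lemma ite_mem (hB : IsTame B) {P : X → Prop} (hP : SA B {x | P x}) {f g : X → ℝ}
    (hf : f ∈ B) (hg : g ∈ B) : (fun x => if P x then f x else g x) ∈ B := by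
  refine hB _ (Tame.of_cover (Finset.univ : Finset Bool) (fun i => {x | P x ↔ i = true})
    (fun i => if i then f else g) ?_ ?_ ?_ ?_)
  · rintro (_ | _) -
    · exact hP.not.congr fun x => by simp
    · exact hP.congr fun x => by simp
  · rintro (_ | _) -
    · simpa using Tame.of_mem hg
    · simpa using Tame.of_mem hf
  · intro x
    by_cases h : P x
    · exact ⟨true, by simp, by simp [h]⟩
    · exact ⟨false, by simp, by simp [h]⟩
  · rintro (_ | _) - x hx
    · simp only [Set.mem_ofPred_eq, Bool.false_eq_true, iff_false] at hx
      simp [hx]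
    · simp only [Set.mem_ofPred_eq, iff_true] at hx
      simp [hx]

lemma inv_mem (hB : IsTame B) {f : X → ℝ} (hf : f ∈ B) : f⁻¹ ∈ B := hB _ (Tame.of_mem hf).inv

lemma max_mem (hB : IsTame B) {f g : X → ℝ} (hf : f ∈ B) (hg : g ∈ B) :
    (fun x => max (f x) (g x)) ∈ B := by
  simpa only [max_def] using hB.ite_mem (SA.le hf hg) hg hf

lemma abs_mem (hB : IsTame B) {f : X → ℝ} (hf : f ∈ B) : (fun x => |f x|) ∈ B :=
  hB.max_mem hf (B.neg_mem hf)

lemma root_mem (hB : IsTame B) {f : X → ℝ} (hf : f ∈ B) (h0 : ∀ x, 0 ≤ f x) {N : ℕ}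
    (hN : N ≠ 0) : (fun x => f x ^ (1 / (N : ℝ))) ∈ B := by
  obtain ⟨L, hL, hc⟩ := exists_root_cover _ X B (Polynomial.X ^ N - C ⟨f, hf⟩) le_rfl
  have hr : ∀ x, (f x ^ (1 / (N : ℝ))) ^ N = f x := fun x => by
    rw [← Real.rpow_natCast, ← Real.rpow_mul (h0 x)]
    have : (N : ℝ) ≠ 0 := by exact_mod_cast hN
    rw [one_div_mul_cancel this, Real.rpow_one]
  refine hB _ (Tame.of_cover L (fun ξ => {x | 0 ≤ ξ x ∧ ξ x ^ N = f x}) id ?_ hL ?_ ?_)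
  · intro ξ hξ
    have := hB _ (hL ξ hξ)
    exact (SA.le B.zero_mem this).and (SA.eq (B.pow_mem this N) hf)
  · intro x
    have hne : spec (Polynomial.X ^ N - C ⟨f, hf⟩ : B[X]) x ≠ 0 := by
      simp only [spec_sub, spec_pow, spec_X, spec_C]
      exact X_pow_sub_C_ne_zero (Nat.pos_of_ne_zero hN) _
    obtain ⟨ξ, hξ, e⟩ := hc x hne (f x ^ (1 / (N : ℝ))) (by
      simp only [spec_sub, spec_pow, spec_X, spec_C, IsRoot, eval_sub, eval_pow, eval_X, eval_C, hr,
        sub_self])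
    refine ⟨ξ, hξ, ?_⟩
    simp only [Set.mem_ofPred_eq, e]
    exact ⟨Real.rpow_nonneg (h0 x) _, hr x⟩
  · rintro ξ - x ⟨h1, h2⟩
    exact (pow_left_inj₀ (Real.rpow_nonneg (h0 x) _) h1 hN).1 ((hr x).trans h2.symm)

lemma zpow_mem (hB : IsTame B) {f : X → ℝ} (hf : f ∈ B) (k : ℤ) : (fun x => f x ^ k) ∈ B := by
  cases k with
  | ofNat k =>
    simp only [Int.ofNat_eq_natCast, zpow_natCast]
    exact B.pow_mem hf k
  | negSucc k =>
    have e : (fun x => f x ^ Int.negSucc k) = (f ^ (k + 1))⁻¹ := by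
      funext x; simp [zpow_negSucc]
    rw [e]
    exact hB.inv_mem (B.pow_mem hf _)

lemma rpow_mem (hB : IsTame B) {f : X → ℝ} (hf : f ∈ B) (h0 : ∀ x, 0 ≤ f x) (q : ℚ) :
    (fun x => f x ^ (q : ℝ)) ∈ B := by
  have := hB.zpow_mem (hB.root_mem hf h0 q.den_nz) q.num
  refine (congrArg (· ∈ B) (funext fun x => ?_)).mp this
  rw [← Real.rpow_intCast, ← Real.rpow_mul (h0 x)]
  congr 1
  rw [one_div_mul_eq_div]
  exact_mod_cast q.num_div_den

lemma root_cover (hB : IsTame B) (P : Finset B[X]) :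
    ∃ L : Finset (X → ℝ), (∀ ξ ∈ L, ξ ∈ B) ∧ ∀ p ∈ P, Covers p L := by
  obtain ⟨L, h1, h2⟩ := exists_root_cover_finset P
  exact ⟨L, fun ξ hξ => hB _ (h1 ξ hξ), h2⟩

end IsTame

lemma Tame.measurable {X : Type} [MeasurableSpace X] {A : Subalgebra ℝ (X → ℝ)}
    (hA : ∀ a ∈ A, Measurable a) {f : X → ℝ} (hf : Tame A f) : Measurable f := by
  refine measurable_of_Ioi fun c => ?_
  have h := hf X id A (fun _ h => h) (f - algebraMap ℝ _ c)
    (sub_mem (evalAlg_self _ _ _) (algebraMap_mem _ c))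
  convert h.measurableSet hA using 1
  ext x
  simp

/-- The functions on `X × ℝ` that are polynomial in the last variable. -/
def polyAlg {X : Type} (A : Subalgebra ℝ (X → ℝ)) : Subalgebra ℝ (X × ℝ → ℝ) :=
  evalAlg Prod.fst A Prod.snd

lemma SA.determined {X : Type} {A : Subalgebra ℝ (X → ℝ)} {T : Set (X × ℝ)}
    (hT : SA (polyAlg A) T) : ∃ P : Finset A[X], ∀ x z z',
      (∀ p ∈ P, (0 < (spec p x).eval z ↔ 0 < (spec p x).eval z')) →
        ((x, z) ∈ T ↔ (x, z') ∈ T) := by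
  induction hT with
  | pos hf =>
    obtain ⟨p, rfl⟩ := hf
    exact ⟨{p}, fun x z z' h => h p (by simp)⟩
  | compl _ ih =>
    obtain ⟨P, hP⟩ := ih
    exact ⟨P, fun x z z' h => not_congr (hP x z z' h)⟩
  | inter _ _ ih ih' =>
    obtain ⟨P, hP⟩ := ih
    obtain ⟨P', hP'⟩ := ih'
    exact ⟨P ∪ P', fun x z z' h => and_congr (hP x z z' fun p hp => h p (by simp [hp]))
      (hP' x z z' fun p hp => h p (by simp [hp]))⟩

lemma Tame.algebraic {X : Type} {A : Subalgebra ℝ (X → ℝ)} {f : X → ℝ} (hf : Tame A f) :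
    ∃ P : Finset A[X], ∀ x, ∃ p ∈ P, spec p x ≠ 0 ∧ (spec p x).eval (f x) = 0 := by
  have h := hf (X × ℝ) Prod.fst (polyAlg A) (fun a ha => evalAlg_base _ _ _ ha)
    (f ∘ Prod.fst - Prod.snd)
    (sub_mem (evalAlg_self _ _ _) (evalAlg_base id _ _ (evalAlg_self _ _ _)))
  obtain ⟨P, hP⟩ := h.determined
  refine ⟨P, fun x => ?_⟩
  by_contra! hc
  have ev : ∀ p ∈ P, ∀ᶠ z in nhds (f x), (0 < (spec p x).eval z ↔ 0 < (spec p x).eval (f x)) := by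
    intro p hp
    by_cases h0 : spec p x = 0
    · simp [h0]
    have hcont := (spec p x).continuous.tendsto (f x)
    rcases lt_or_gt_of_ne (hc p hp h0) with h1 | h1
    · filter_upwards [hcont.eventually (gt_mem_nhds h1)] with z hz
      exact ⟨fun h => absurd h hz.not_gt, fun h => absurd h h1.not_gt⟩
    · filter_upwards [hcont.eventually (lt_mem_nhds h1)] with z hz
      exact ⟨fun _ => h1, fun _ => hz⟩
  have ev' := (Filter.eventually_all_finset P).2 ev
  have hfr : ∃ᶠ z in nhds (f x), z < f x := by
    have := (Filter.Eventually.frequently (f := nhdsWithin (f x) (Set.Iio (f x)))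
      (self_mem_nhdsWithin (s := Set.Iio (f x)) (a := f x)))
    exact this.filter_mono nhdsWithin_le_nhds
  obtain ⟨z, hz1, hz2⟩ := (hfr.and_eventually ev').exists
  have := hP x z (f x) hz2
  simp [hz1] at this

end Semialg

namespace Semialg
open Polynomial

lemma eval_add_eq_sum_iterate_derivative {d : ℕ} {p : ℝ[X]} (hp : p.natDegree ≤ d) (y h : ℝ) :
    p.eval (y + h) =
      ∑ k ∈ Finset.range (d + 1), (derivative^[k] p).eval y / (k.factorial : ℝ) * h ^ k := by
  have h1 : p.eval (y + h) = (taylor y p).eval h := by rw [taylor_eval, add_comm]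
  rw [h1, eval_eq_sum_range' (n := d + 1) (by rw [natDegree_taylor]; omega)]
  refine Finset.sum_congr rfl fun k _ => ?_
  have e : derivative^[k] p = k.factorial • hasseDeriv k p := by
    rw [← factorial_smul_hasseDeriv]; rfl
  rw [taylor_coeff, e]
  have : (k.factorial : ℝ) ≠ 0 := by exact_mod_cast k.factorial_ne_zero
  rw [eval_smul, nsmul_eq_mul]
  field_simp

/-- No derivative of `p` vanishes on the interval, unless it vanishes identically. -/
def NoRoots (p : ℝ[X]) (y t : ℝ) : Prop :=
  ∀ j, derivative^[j] p ≠ 0 → ∀ z ∈ Set.Ioo (y - t) (y + t), (derivative^[j] p).eval z ≠ 0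

lemma NoRoots.derivative {p : ℝ[X]} {y t : ℝ} (h : NoRoots p y t) :
    NoRoots (derivative p) y t := fun j => h (j + 1)

lemma NoRoots.neg {p : ℝ[X]} {y t : ℝ} (h : NoRoots p y t) : NoRoots (-p) y t := by
  intro j hj z hz
  rw [iterate_derivative_neg, neg_ne_zero] at hj
  rw [iterate_derivative_neg, eval_neg, neg_ne_zero]
  exact h j hj z hz

lemma harnack (d : ℕ) : ∃ C : ℝ, 1 ≤ C ∧ ∀ p : ℝ[X], p.natDegree ≤ d → ∀ y t : ℝ, 0 < t →
    NoRoots p y t → ∀ j, |(derivative^[j] p).eval y| * t ^ j ≤ C * |p.eval y| := by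
  induction d with
  | zero =>
    refine ⟨1, le_rfl, fun p hp y t ht _ j => ?_⟩
    rw [eq_C_of_natDegree_eq_zero (Nat.le_zero.1 hp)]
    rcases j with _ | j
    · simp
    · simp
  | succ d ih =>
    obtain ⟨C, hC, ih⟩ := ih
    set ε : ℝ := 1 / (2 * (d + 1) * C) with hε
    have hε0 : 0 < ε := by positivity
    have hε1 : ε < 1 := by
      rw [hε, div_lt_one (by positivity)]
      nlinarith [(Nat.cast_nonneg d : (0 : ℝ) ≤ d)]
    have hεC : (d + 1) * C * ε = 1 / 2 := by rw [hε]; field_simp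
    have main : ∀ p : ℝ[X], p.natDegree ≤ d + 1 → ∀ y t : ℝ, 0 < t → NoRoots p y t →
        0 < p.eval y → |(derivative p).eval y| * t ≤ 2 / ε * p.eval y := by
      intro p hp y t ht hnr hpos
      have ih' := ih (derivative p) (by have := natDegree_derivative_le p; omega) y t ht
        hnr.derivative
      obtain ⟨σ, hσ, hσ'⟩ : ∃ σ : ℝ, |σ| = 1 ∧
          (derivative p).eval y * σ = - |(derivative p).eval y| := by
        rcases le_total 0 ((derivative p).eval y) with h | h
        · exact ⟨-1, by simp, by rw [abs_of_nonneg h]; ring⟩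
        · exact ⟨1, by simp, by rw [abs_of_nonpos h]; ring⟩
      have hσab := abs_le.1 hσ.le
      have hq : 0 < p.eval (y + σ * (ε * t)) := by
        have hp0 : p ≠ 0 := by rintro rfl; simp at hpos
        have hmem : y ∈ Set.Ioo (y - t) (y + t) := ⟨by linarith, by linarith⟩
        have hmem' : y + σ * (ε * t) ∈ Set.Ioo (y - t) (y + t) := by
          have : ε * t < t := by nlinarith
          have : 0 < ε * t := by positivity
          constructor <;> nlinarith
        rcases sign_const_of_no_root (hnr 0 hp0) with h | h
        · exact h _ hmem'
        · exact absurd (h y hmem) (not_lt.2 hpos.le)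
      rw [eval_add_eq_sum_iterate_derivative hp, Finset.sum_range_succ', Finset.sum_range_succ']
        at hq
      have hb : ∀ k ∈ Finset.range d, (derivative^[k + 1 + 1] p).eval y /
          ((k + 1 + 1).factorial : ℝ) * (σ * (ε * t)) ^ (k + 1 + 1) ≤
            C * ε * (ε * t * |(derivative p).eval y|) := by
        intro k _
        refine (le_abs_self _).trans ?_
        rw [abs_mul, abs_pow, abs_mul, hσ, one_mul, abs_div, abs_of_pos (mul_pos hε0 ht),
          Nat.abs_cast]
        have h1 : |(derivative^[k + 1 + 1] p).eval y| * t ^ (k + 1) ≤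
          C * |(derivative p).eval y| := ih' (k + 1)
        have h2 : |(derivative^[k + 1 + 1] p).eval y| / ((k + 1 + 1).factorial : ℝ) ≤
            |(derivative^[k + 1 + 1] p).eval y| :=
          div_le_self (abs_nonneg _) (by exact_mod_cast (k + 1 + 1).factorial_pos)
        have h3 : ε ^ (k + 1 + 1) ≤ ε ^ 2 := pow_le_pow_of_le_one hε0.le hε1.le (by omega)
        calc _ ≤ |(derivative^[k + 1 + 1] p).eval y| * (ε * t) ^ (k + 1 + 1) := by gcongr
          _ = (|(derivative^[k + 1 + 1] p).eval y| * t ^ (k + 1)) * (ε ^ (k + 1 + 1) * t) := by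
              rw [mul_pow]; ring
          _ ≤ (C * |(derivative p).eval y|) * (ε ^ 2 * t) := by gcongr
          _ = _ := by ring
      have hs := Finset.sum_le_sum hb
      rw [Finset.sum_const, Finset.card_range, nsmul_eq_mul] at hs
      have e1 : (derivative^[0 + 1] p).eval y / ((0 + 1).factorial : ℝ) *
          (σ * (ε * t)) ^ (0 + 1) = - (ε * t * |(derivative p).eval y|) := by
        simp only [zero_add, Function.iterate_one, Nat.factorial_one, Nat.cast_one, div_one,
          pow_one]
        rw [← mul_assoc, hσ']; ring
      rw [e1] at hq
      simp only [Function.iterate_zero, id, Nat.factorial_zero, Nat.cast_one, div_one, pow_zero,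
        mul_one] at hq
      have hu : 0 ≤ ε * t * |(derivative p).eval y| := by positivity
      have h4 : (d : ℝ) * (C * ε * (ε * t * |(derivative p).eval y|)) ≤
          1 / 2 * (ε * t * |(derivative p).eval y|) := by
        rw [← hεC]
        have : 0 ≤ C * ε * (ε * t * |(derivative p).eval y|) := by positivity
        nlinarith
      rw [div_mul_eq_mul_div, le_div_iff₀ hε0]
      nlinarith
    have main' : ∀ p : ℝ[X], p.natDegree ≤ d + 1 → ∀ y t : ℝ, 0 < t → NoRoots p y t →
        |(derivative p).eval y| * t ≤ 2 / ε * |p.eval y| := by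
      intro p hp y t ht hnr
      by_cases hp0 : p = 0
      · simp [hp0]
      rcases lt_or_gt_of_ne (hnr 0 hp0 y ⟨by linarith, by linarith⟩) with h | h
      · have := main (-p) (by rwa [natDegree_neg]) y t ht hnr.neg (by simpa using h)
        simpa [abs_of_neg (show p.eval y < 0 from h)] using this
      · have := main p hp y t ht hnr h
        rwa [abs_of_pos (show 0 < p.eval y from h)]
    refine ⟨max 1 (C * (2 / ε)), le_max_left _ _, fun p hp y t ht hnr j => ?_⟩
    rcases j with _ | j
    · simp only [Function.iterate_zero, id, pow_zero, mul_one]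
      exact le_mul_of_one_le_left (abs_nonneg _) (le_max_left _ _)
    · have h1 := ih (derivative p) (by have := natDegree_derivative_le p; omega) y t ht
        hnr.derivative j
      have h2 := main' p hp y t ht hnr
      calc _ = |(derivative^[j] (derivative p)).eval y| * t ^ j * t := by
              rw [Function.iterate_succ_apply]; ring
        _ ≤ C * |(derivative p).eval y| * t := by gcongr
        _ = C * (|(derivative p).eval y| * t) := by ring
        _ ≤ C * (2 / ε * |p.eval y|) := by gcongr
        _ = (C * (2 / ε)) * |p.eval y| := by ring
        _ ≤ _ := by gcongr; exact le_max_right _ _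

/-- Off the zeros of its derivatives a polynomial is comparable with the sum of the moduli of the
terms of its Taylor expansion at an end of the interval. -/
lemma taylor_comparable (d : ℕ) : ∃ C : ℝ, 1 ≤ C ∧ ∀ p : ℝ[X], p.natDegree ≤ d →
    ∀ θ σ t : ℝ, |σ| = 1 → 0 < t → NoRoots p (θ + σ * t) t →
      |p.eval (θ + σ * t)| ≤ ∑ k ∈ Finset.range (d + 1), |(derivative^[k] p).eval θ| * t ^ k ∧
      ∑ k ∈ Finset.range (d + 1), |(derivative^[k] p).eval θ| * t ^ k ≤
        C * |p.eval (θ + σ * t)| := by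
  obtain ⟨C, hC, h⟩ := harnack d
  refine ⟨(d + 1) * ((d + 1) * C), ?_, fun p hp θ σ t hσ ht hnr => ⟨?_, ?_⟩⟩
  · nlinarith [(Nat.cast_nonneg d : (0 : ℝ) ≤ d), mul_nonneg (Nat.cast_nonneg d : (0 : ℝ) ≤ d)
      (by linarith : 0 ≤ C)]
  · rw [eval_add_eq_sum_iterate_derivative hp]
    refine (Finset.abs_sum_le_sum_abs _ _).trans (Finset.sum_le_sum fun k _ => ?_)
    rw [abs_mul, abs_pow, abs_mul, hσ, one_mul, abs_of_pos ht, abs_div, Nat.abs_cast]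
    gcongr
    exact div_le_self (abs_nonneg _) (by exact_mod_cast k.factorial_pos)
  · have hb : ∀ k ∈ Finset.range (d + 1), |(derivative^[k] p).eval θ| * t ^ k ≤
        (d + 1) * C * |p.eval (θ + σ * t)| := by
      intro k _
      have e : θ = (θ + σ * t) + -(σ * t) := by ring
      have hd : (derivative^[k] p).natDegree ≤ d :=
        (natDegree_iterate_derivative p k).trans (by omega)
      conv_lhs => rw [e]
      rw [eval_add_eq_sum_iterate_derivative hd]
      calc _ ≤ (∑ j ∈ Finset.range (d + 1), C * |p.eval (θ + σ * t)| / t ^ k) * t ^ k := by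
            gcongr
            refine (Finset.abs_sum_le_sum_abs _ _).trans (Finset.sum_le_sum fun j _ => ?_)
            rw [abs_mul, abs_pow, abs_neg, abs_mul, hσ, one_mul, abs_of_pos ht, abs_div,
              Nat.abs_cast, le_div_iff₀ (by positivity)]
            have h1 := h p hp (θ + σ * t) t ht hnr (j + k)
            rw [Function.iterate_add_apply, pow_add] at h1
            refine le_trans ?_ h1
            rw [← mul_assoc]
            gcongr
            exact div_le_self (abs_nonneg _) (by exact_mod_cast j.factorial_pos)
        _ = _ := by
            rw [Finset.sum_const, Finset.card_range, nsmul_eq_mul]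
            push_cast
            field_simp
    have hs := Finset.sum_le_sum hb
    rw [Finset.sum_const, Finset.card_range, nsmul_eq_mul] at hs
    refine hs.trans (le_of_eq ?_)
    push_cast
    ring

end Semialg

namespace Semialg
open Polynomial

lemma exists_gap {X : Type} {L : Finset (X → ℝ)} {u v : X → ℝ} (hu : u ∈ L) (hv : v ∈ L) {x : X}
    {t : ℝ} (hut : u x < t) (htv : t < v x) (ht : ∀ z ∈ L, z x ≠ t) :
    ∃ l ∈ L, ∃ l' ∈ L, (u x ≤ l x ∧ l' x ≤ v x) ∧ (l x < t ∧ t < l' x) ∧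
      ∀ z ∈ L, ¬ (l x < z x ∧ z x < l' x) := by
  obtain ⟨l, hl, hl'⟩ := (L.filter fun z => z x < t).exists_max_image (fun z => z x)
    ⟨u, by simp [hu, hut]⟩
  obtain ⟨r, hr, hr'⟩ := (L.filter fun z => t < z x).exists_min_image (fun z => z x)
    ⟨v, by simp [hv, htv]⟩
  simp only [Finset.mem_filter, and_imp] at hl hl' hr hr'
  refine ⟨l, hl.1, r, hr.1, ⟨hl' u hu hut, hr' v hv htv⟩, ⟨hl.2, hr.2⟩, ?_⟩
  rintro z hz ⟨h1, h2⟩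
  rcases lt_or_gt_of_ne (ht z hz) with h | h
  · linarith [hl' z hz h]
  · linarith [hr' z hz h]

/-- A cell: over each point of the base `S` an open interval `(lo, hi)` of distances to a tame
centre `θ`, on the side given by the sign `σ`. -/
structure Cell {X : Type} (B : Subalgebra ℝ (X → ℝ)) where
  S : Set X
  hS : SA B S
  θ : X → ℝ
  hθ : θ ∈ B
  σ : ℝ
  hσ : |σ| = 1
  lo : X → ℝ
  hlo : lo ∈ B
  hi : X → ℝ
  hhi : hi ∈ B
  lo_nonneg : ∀ x ∈ S, 0 ≤ lo x

namespace Cell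
variable {X : Type} {B : Subalgebra ℝ (X → ℝ)}

/-- Membership in a cell, in terms of the distance to the centre. -/
def Mem (c : Cell B) (x : X) (t : ℝ) : Prop := x ∈ c.S ∧ c.lo x < t ∧ t < c.hi x

lemma Mem.pos {c : Cell B} {x : X} {t : ℝ} (h : c.Mem x t) : 0 < t :=
  (c.lo_nonneg x h.1).trans_lt h.2.1

/-- A cell with the same centre contained in another one. -/
def Sub (c' c : Cell B) : Prop := c'.θ = c.θ ∧ c'.σ = c.σ ∧ ∀ x t, c'.Mem x t → c.Mem x t

lemma Sub.refl (c : Cell B) : Sub c c := ⟨rfl, rfl, fun _ _ h => h⟩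

lemma Sub.trans {c c' c'' : Cell B} (h : Sub c c') (h' : Sub c' c'') : Sub c c'' :=
  ⟨h.1.trans h'.1, h.2.1.trans h'.2.1, fun x t ht => h'.2.2 x t (h.2.2 x t ht)⟩

/-- The cell can be cut, up to finitely many points of each fibre, into cells satisfying `Q`. -/
def Ev (c : Cell B) (Q : Cell B → Prop) : Prop :=
  ∃ L : Finset (Cell B), (∀ c' ∈ L, Sub c' c ∧ Q c') ∧
    ∀ x, {t | c.Mem x t ∧ ∀ c' ∈ L, ¬ c'.Mem x t}.Finite

lemma Ev.of_self {c : Cell B} {Q : Cell B → Prop} (h : Q c) : c.Ev Q :=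
  ⟨{c}, by simpa using ⟨Sub.refl c, h⟩, fun x => by simp⟩

lemma Ev.bind {c : Cell B} {P Q : Cell B → Prop} (h : c.Ev P)
    (h' : ∀ c', Sub c' c → P c' → c'.Ev Q) : c.Ev Q := by
  obtain ⟨L, hL, hc⟩ := h
  choose! M hM hM' using fun c' (hc' : c' ∈ L) => h' c' (hL c' hc').1 (hL c' hc').2
  refine ⟨L.biUnion M, ?_, fun x => ?_⟩
  · intro c'' hc''
    obtain ⟨c', h1, h2⟩ := Finset.mem_biUnion.1 hc''
    have := hM c' h1 c'' h2
    exact ⟨this.1.trans (hL c' h1).1, this.2⟩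
  · refine ((hc x).union (Set.Finite.biUnion L.finite_toSet fun c' hc' => hM' c' hc' x)).subset ?_
    rintro t ⟨h1, h2⟩
    by_cases h3 : ∃ c' ∈ L, c'.Mem x t
    · obtain ⟨c', h4, h5⟩ := h3
      exact Or.inr (Set.mem_biUnion h4 ⟨h5, fun c'' h6 =>
        h2 c'' (Finset.mem_biUnion.2 ⟨c', h4, h6⟩)⟩)
    · push Not at h3
      exact Or.inl ⟨h1, h3⟩

lemma Ev.forall_finset {ι : Type*} (I : Finset ι) {P : Cell B → Prop} {Q : ι → Cell B → Prop}
    (hP : ∀ c c', Sub c' c → P c → P c') (hQ : ∀ i, ∀ c c', Sub c' c → Q i c → Q i c')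
    (h : ∀ i ∈ I, ∀ c, P c → c.Ev (Q i)) : ∀ c, P c → c.Ev fun c' => ∀ i ∈ I, Q i c' := by
  induction I using Finset.induction_on with
  | empty => exact fun c _ => .of_self (by simp)
  | insert a s _ ih =>
    intro c hc
    refine (h a (by simp) c hc).bind fun c' hs hc' => ?_
    refine (ih (fun i hi => h i (by simp [hi])) c' (hP _ _ hs hc)).bind fun c'' hs' hc'' => ?_
    refine .of_self fun i hi => ?_
    rcases Finset.mem_insert.1 hi with rfl | hi
    · exact hQ _ _ _ hs' hc'
    · exact hc'' i hi

theorem split (hB : IsTame B) (c : Cell B) {ι : Type*} (I : Finset ι) (T : ι → Set (X × ℝ))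
    (hT : ∀ i ∈ I, SA (polyAlg B) (T i)) (hcov : ∀ x t, c.Mem x t → ∃ i ∈ I, (x, t) ∈ T i) :
    c.Ev fun c' => ∃ i ∈ I, ∀ x t, c'.Mem x t → (x, t) ∈ T i := by
  choose! P hP using fun i hi => (hT i hi).determined
  obtain ⟨L, hL, hLc⟩ := hB.root_cover (I.biUnion P)
  set L' := insert c.lo (insert c.hi L) with hL'
  have hL'B : ∀ z ∈ L', z ∈ B := by
    intro z hz
    simp only [hL', Finset.mem_insert] at hz
    rcases hz with rfl | rfl | hz
    · exact c.hlo
    · exact c.hhi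
    · exact hL z hz
  let S : (X → ℝ) → (X → ℝ) → ι → Set X := fun l l' i => {x | (x ∈ c.S ∧
    (c.lo x ≤ l x ∧ l' x ≤ c.hi x) ∧ ∀ z ∈ L', ¬ (l x < z x ∧ z x < l' x)) ∧
      (x, 2⁻¹ * (l x + l' x)) ∈ T i}
  have hS : ∀ l ∈ L', ∀ l' ∈ L', ∀ i ∈ I, SA B (S l l' i) := by
    intro l hl l' hl' i hi
    have hl := hL'B l hl
    have hl' := hL'B l' hl'
    refine SA.and (SA.and (c.hS : SA B {x | x ∈ c.S}) (((SA.le c.hlo hl).and (SA.le hl' c.hhi)).and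
      (SA.forall_finset L' (P := fun z x => ¬ (l x < z x ∧ z x < l' x)) fun z hz =>
        ((SA.lt hl (hL'B z hz)).and (SA.lt (hL'B z hz) hl')).not))) ?_
    refine (hT i hi).comap (π := fun x => (x, 2⁻¹ * (l x + l' x))) ?_
    rintro _ ⟨p, rfl⟩
    exact .pos (eval_mem id (fun _ h => h)
      (B.mul_mem (IsTame.const_mem (2⁻¹ : ℝ)) (B.add_mem hl hl')) p)
  let K : L' × L' × I → Cell B := fun k =>
    { S := S k.1 k.2.1 k.2.2
      hS := hS _ k.1.2 _ k.2.1.2 _ k.2.2.2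
      θ := c.θ
      hθ := c.hθ
      σ := c.σ
      hσ := c.hσ
      lo := k.1
      hlo := hL'B _ k.1.2
      hi := k.2.1
      hhi := hL'B _ k.2.1.2
      lo_nonneg := fun x hx => (c.lo_nonneg x hx.1.1).trans hx.1.2.1.1 }
  have hK : ∀ k x t t', (∀ z ∈ L', ¬ (((k : L' × L' × I).1 : X → ℝ) x < z x ∧
      z x < (k.2.1 : X → ℝ) x)) →
      t ∈ Set.Ioo ((k.1 : X → ℝ) x) ((k.2.1 : X → ℝ) x) →
      t' ∈ Set.Ioo ((k.1 : X → ℝ) x) ((k.2.1 : X → ℝ) x) →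
      ((x, t) ∈ T k.2.2 ↔ (x, t') ∈ T k.2.2) := by
    intro k x t t' hz ht ht'
    refine hP k.2.2 k.2.2.2 x t t' fun p hp => ?_
    by_cases h0 : spec p x = 0
    · simp [h0]
    have hr : ∀ y ∈ Set.Ioo ((k.1 : X → ℝ) x) ((k.2.1 : X → ℝ) x), (spec p x).eval y ≠ 0 := by
      intro y hy hy0
      obtain ⟨z, hzL, rfl⟩ := hLc p (Finset.mem_biUnion.2 ⟨_, k.2.2.2, hp⟩) x h0 y hy0
      exact hz z (by simp [hL', hzL]) hy
    rcases sign_const_of_no_root hr with h | h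
    · simp [h t ht, h t' ht']
    · simp [(h t ht).not_gt, (h t' ht').not_gt]
  refine ⟨Finset.univ.image K, ?_, fun x => ?_⟩
  · intro c' hc'
    obtain ⟨k, -, rfl⟩ := Finset.mem_image.1 hc'
    refine ⟨⟨rfl, rfl, fun x t ht => ⟨ht.1.1.1, ?_, ?_⟩⟩, k.2.2, k.2.2.2, fun x t ht => ?_⟩
    · exact ht.1.1.2.1.1.trans_lt ht.2.1
    · exact ht.2.2.trans_le ht.1.1.2.1.2
    · refine (hK k x t (2⁻¹ * ((k.1 : X → ℝ) x + (k.2.1 : X → ℝ) x)) ht.1.1.2.2 ht.2 ?_).2 ht.1.2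
      have : ((k.1 : X → ℝ) x) < ((k.2.1 : X → ℝ) x) := ht.2.1.trans ht.2.2
      constructor <;> linarith
  · refine ((L'.image fun z => z x).finite_toSet).subset ?_
    rintro t ⟨h1, h2⟩
    by_contra h3
    simp only [Finset.coe_image, Set.mem_image, Finset.mem_coe, not_exists, not_and] at h3
    obtain ⟨l, hl, l', hl', h4, h5, h6⟩ := exists_gap (L := L') (u := c.lo) (v := c.hi)
      (by simp [hL']) (by simp [hL']) h1.2.1 h1.2.2 h3
    obtain ⟨i, hi, h7⟩ := hcov x t h1
    refine h2 (K (⟨l, hl⟩, ⟨l', hl'⟩, ⟨i, hi⟩)) (Finset.mem_image_of_mem _ (Finset.mem_univ _))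
      ⟨⟨⟨h1.1, h4, h6⟩, ?_⟩, h5⟩
    refine (hK (⟨l, hl⟩, ⟨l', hl'⟩, ⟨i, hi⟩) x t (2⁻¹ * (l x + l' x)) h6 h5 ?_).1 h7
    have : l x < l' x := h5.1.trans h5.2
    constructor <;> linarith

/-- On the cell the polynomials of `P` and their derivatives have no zeros at distance less than
that to the centre. -/
def Simple (P : Finset B[X]) (c : Cell B) : Prop :=
  ∀ p ∈ P, ∀ x t, c.Mem x t → NoRoots (spec p x) (c.θ x + c.σ * t) t

/-- The cell lies above the interval `(-1,1)`. -/
def InBox (c : Cell B) : Prop := ∀ x t, c.Mem x t → c.θ x + c.σ * t ∈ Set.Ioo (-1 : ℝ) 1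

lemma Simple.sub {P : Finset B[X]} {c c' : Cell B} (h : Sub c' c) (hc : Simple P c) :
    Simple P c' := fun p hp x t ht => by
  rw [h.1, h.2.1]; exact hc p hp x t (h.2.2 x t ht)

lemma InBox.sub {c c' : Cell B} (h : Sub c' c) (hc : InBox c) : InBox c' := fun x t ht => by
  rw [h.1, h.2.1]; exact hc x t (h.2.2 x t ht)

/-- A finite family of cells covers `(-1,1)` up to finitely many points of each fibre. -/
def Covering (L : Finset (Cell B)) : Prop :=
  ∀ x, {y | y ∈ Set.Ioo (-1 : ℝ) 1 ∧ ∀ c ∈ L, ∀ t, c.Mem x t → y ≠ c.θ x + c.σ * t}.Finite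

lemma Covering.bind {L : Finset (Cell B)} (hL : Covering L) {Q : Cell B → Prop}
    (h : ∀ c ∈ L, c.Ev Q) : ∃ M : Finset (Cell B),
      (∀ c' ∈ M, ∃ c ∈ L, Sub c' c ∧ Q c') ∧ Covering M := by
  choose! M hM hM' using h
  refine ⟨L.biUnion M, ?_, fun x => ?_⟩
  · intro c'' hc''
    obtain ⟨c', h1, h2⟩ := Finset.mem_biUnion.1 hc''
    exact ⟨c', h1, hM c' h1 c'' h2⟩
  · refine ((hL x).union (Set.Finite.biUnion L.finite_toSet fun c hc =>
      (hM' c hc x).image fun t => c.θ x + c.σ * t)).subset ?_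
    rintro y ⟨h1, h2⟩
    by_cases h3 : ∃ c ∈ L, ∃ t, c.Mem x t ∧ y = c.θ x + c.σ * t
    · obtain ⟨c, h4, t, h5, h6⟩ := h3
      refine Or.inr (Set.mem_biUnion h4 ⟨t, ⟨h5, fun c' hc' hm => ?_⟩, h6.symm⟩)
      have hs := (hM c h4 c' hc').1
      refine h2 c' (Finset.mem_biUnion.2 ⟨c, h4, hc'⟩) t hm ?_
      rw [hs.1, hs.2.1, h6]
    · push Not at h3
      exact Or.inl ⟨h1, h3⟩

theorem exists_simple_covering (hB : IsTame B) (P : Finset B[X]) :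
    ∃ L : Finset (Cell B), (∀ c ∈ L, Simple P c ∧ InBox c) ∧ Covering L := by
  obtain ⟨Z, hZ, hZc⟩ := hB.root_cover
    (P.biUnion fun p => (Finset.range (p.natDegree + 1)).image fun j => derivative^[j] p)
  set Z' := insert (fun _ => (-1 : ℝ)) (insert (fun _ => (1 : ℝ)) Z) with hZ'
  have hZB : ∀ z ∈ Z', z ∈ B := by
    intro z hz
    simp only [hZ', Finset.mem_insert] at hz
    rcases hz with rfl | rfl | hz
    · exact IsTame.const_mem _
    · exact IsTame.const_mem _
    · exact hZ z hz
  let S : (X → ℝ) → (X → ℝ) → Set X := fun l l' => {x | (-1 ≤ l x ∧ l' x ≤ 1) ∧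
    ∀ z ∈ Z', ¬ (l x < z x ∧ z x < l' x)}
  have hS : ∀ l ∈ Z', ∀ l' ∈ Z', SA B (S l l') := by
    intro l hl l' hl'
    have hl := hZB l hl
    have hl' := hZB l' hl'
    exact ((SA.le (IsTame.const_mem (-1)) hl).and (SA.le hl' (IsTame.const_mem 1))).and
      (SA.forall_finset Z' (P := fun z x => ¬ (l x < z x ∧ z x < l' x)) fun z hz =>
        ((SA.lt hl (hZB z hz)).and (SA.lt (hZB z hz) hl')).not)
  let K : Z' × Z' × Bool → Cell B := fun k =>
    { S := S k.1 k.2.1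
      hS := hS _ k.1.2 _ k.2.1.2
      θ := if k.2.2 then k.1 else k.2.1
      hθ := by split_ifs; exacts [hZB _ k.1.2, hZB _ k.2.1.2]
      σ := if k.2.2 then 1 else -1
      hσ := by split_ifs <;> simp
      lo := 0
      hlo := B.zero_mem
      hi := fun x => 2⁻¹ * ((k.2.1 : X → ℝ) x - (k.1 : X → ℝ) x)
      hhi := B.mul_mem (IsTame.const_mem (2⁻¹ : ℝ)) (B.sub_mem (hZB _ k.2.1.2) (hZB _ k.1.2))
      lo_nonneg := fun x hx => le_rfl }
  have hK : ∀ k x t, (K k).Mem x t → x ∈ S k.1 k.2.1 ∧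
      ∀ z ∈ Set.Ioo ((K k).θ x + (K k).σ * t - t) ((K k).θ x + (K k).σ * t + t),
        (k.1 : X → ℝ) x < z ∧ z < (k.2.1 : X → ℝ) x := by
    rintro ⟨l, l', b⟩ x t ⟨h1, h2, h3⟩
    refine ⟨h1, fun z hz => ?_⟩
    simp only [K, Pi.zero_apply] at h2 h3 hz
    cases b
    · simp only [Bool.false_eq_true, if_false] at hz
      exact ⟨by linarith [hz.1], by linarith [hz.2]⟩
    · simp only [if_true] at hz
      exact ⟨by linarith [hz.1], by linarith [hz.2]⟩
  refine ⟨Finset.univ.image K, ?_, fun x => ?_⟩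
  · intro c hc
    obtain ⟨k, -, rfl⟩ := Finset.mem_image.1 hc
    refine ⟨fun p hp x t ht j hj z hz hz0 => ?_, fun x t ht => ?_⟩
    · obtain ⟨h1, h2⟩ := hK k x t ht
      rw [← spec_iterate_derivative] at hj hz0
      have hjd : j < p.natDegree + 1 := by
        by_contra! h
        rw [iterate_derivative_eq_zero (by omega)] at hj
        simp [spec] at hj
      obtain ⟨w, hw, rfl⟩ := hZc (derivative^[j] p) (Finset.mem_biUnion.2 ⟨p, hp,
        Finset.mem_image_of_mem _ (Finset.mem_range.2 hjd)⟩) x hj z hz0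
      exact h1.2 w (by simp [hZ', hw]) (h2 _ hz)
    · obtain ⟨h1, h2⟩ := hK k x t ht
      have htp := ht.pos
      have h3 := h2 ((K k).θ x + (K k).σ * t) ⟨by linarith, by linarith⟩
      exact ⟨h1.1.1.trans_lt h3.1, h3.2.trans_le h1.1.2⟩
  · refine (((Z' ×ˢ Z').image fun z => 2⁻¹ * (z.1 x + z.2 x)).finite_toSet.union
      (Z'.image fun z => z x).finite_toSet).subset ?_
    rintro y ⟨h1, h2⟩
    by_contra h3
    simp only [Set.mem_union, not_or, Finset.coe_image, Set.mem_image, Finset.mem_coe, not_exists,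
      not_and, Finset.mem_product, Prod.forall] at h3
    obtain ⟨l, hl, l', hl', h4, h5, h6⟩ := exists_gap (L := Z') (u := fun _ => -1) (v := fun _ => 1)
      (x := x) (t := y) (by simp [hZ']) (by simp [hZ']) h1.1 h1.2 h3.2
    have hm := h3.1 l l' ⟨hl, hl'⟩
    rcases lt_or_gt_of_ne hm with h7 | h7
    · refine h2 (K (⟨l, hl⟩, ⟨l', hl'⟩, false))
        (Finset.mem_image_of_mem _ (Finset.mem_univ _)) (l' x - y) ⟨⟨h4, h6⟩, ?_, ?_⟩ ?_
      · simp only [K, Pi.zero_apply]; linarith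
      · simp only [K]; linarith
      · simp only [K, Bool.false_eq_true, if_false]; ring
    · refine h2 (K (⟨l, hl⟩, ⟨l', hl'⟩, true))
        (Finset.mem_image_of_mem _ (Finset.mem_univ _)) (y - l x) ⟨⟨h4, h6⟩, ?_, ?_⟩ ?_
      · simp only [K, Pi.zero_apply]; linarith
      · simp only [K]; linarith
      · simp only [K, if_true]; ring

end Cell
end Semialg

namespace Semialg
open Polynomial

lemma exists_two_comparable_terms {N : ℕ} {b : ℕ → ℝ} (hs : ∑ k ∈ Finset.range N, b k = 0)
    (hb : ∃ k ∈ Finset.range N, b k ≠ 0) :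
    ∃ k ∈ Finset.range N, ∃ j ∈ Finset.range N, j ≠ k ∧ b k ≠ 0 ∧ b j ≠ 0 ∧
      |b j| ≤ N * |b k| ∧ |b k| ≤ N * |b j| := by
  obtain ⟨k₀, hk₀, hk₀'⟩ := hb
  obtain ⟨k, hk, hmax⟩ := (Finset.range N).exists_max_image (fun k => |b k|) ⟨k₀, hk₀⟩
  have hN : (1 : ℝ) ≤ N := by
    have := Finset.mem_range.1 hk
    exact_mod_cast (by omega : 1 ≤ N)
  have hpos : 0 < |b k| := (abs_pos.2 hk₀').trans_le (hmax k₀ hk₀)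
  obtain ⟨j, hj, hj'⟩ : ∃ j ∈ (Finset.range N).erase k, |b k| ≤ N * |b j| := by
    by_contra! hc
    have h1 : |b k| ≤ ∑ j ∈ (Finset.range N).erase k, |b j| := by
      rw [← Finset.add_sum_erase _ _ hk] at hs
      rw [eq_neg_of_add_eq_zero_left hs, abs_neg]
      exact Finset.abs_sum_le_sum_abs _ _
    have h2 : ∑ j ∈ (Finset.range N).erase k, |b j| ≤ ((Finset.range N).erase k).card •
        (|b k| / N) := Finset.sum_le_card_nsmul _ _ _ fun j hj => by
      rw [le_div_iff₀' (by linarith)]; exact (hc j hj).le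
    rw [Finset.card_erase_of_mem hk, Finset.card_range, nsmul_eq_mul,
      Nat.cast_sub (by exact_mod_cast hN), Nat.cast_one] at h2
    have h3 : ((N : ℝ) - 1) * (|b k| / N) = |b k| - |b k| / N := by field_simp
    have h4 : 0 < |b k| / N := by positivity
    linarith
  have hj0 : b j ≠ 0 := by
    rintro h; rw [h] at hj'; simp at hj'; simp [hj'] at hpos
  have hjm := Finset.mem_of_mem_erase hj
  exact ⟨k, hk, j, hjm, Finset.ne_of_mem_erase hj, abs_pos.1 hpos, hj0,
    (hmax j hjm).trans (le_mul_of_one_le_left (abs_nonneg _) hN), hj'⟩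

lemma root_comparable {φ u v K : ℝ} {j n : ℕ} (hφ : 0 < φ) (hu : 0 < u) (hv : 0 < v) (hn : n ≠ 0)
    (hK : 1 ≤ K) (h1 : u * φ ^ j ≤ K * (v * φ ^ (j + n))) (h2 : v * φ ^ (j + n) ≤ K * (u * φ ^ j)) :
    (u / v) ^ (1 / (n : ℝ)) ≤ K * φ ∧ φ ≤ K * (u / v) ^ (1 / (n : ℝ)) := by
  have hj : 0 < φ ^ j := by positivity
  have hn' : (n : ℝ) ≠ 0 := by exact_mod_cast hn
  have hKn : K ≤ K ^ n := le_self_pow₀ hK hn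
  have e : ∀ y : ℝ, 0 ≤ y → (y ^ n) ^ (1 / (n : ℝ)) = y := fun y hy => by
    rw [← Real.rpow_natCast, ← Real.rpow_mul hy, mul_one_div_cancel hn', Real.rpow_one]
  have e' : ∀ y : ℝ, 0 ≤ y → (y ^ (1 / (n : ℝ))) ^ n = y := fun y hy => by
    rw [← Real.rpow_natCast, ← Real.rpow_mul hy, one_div_mul_cancel hn', Real.rpow_one]
  have hn0 : 0 ≤ 1 / (n : ℝ) := by positivity
  rw [pow_add] at h1 h2
  constructor
  · have h3 : u / v ≤ (K * φ) ^ n := by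
      rw [div_le_iff₀ hv, mul_pow]
      have : u ≤ K * (v * φ ^ n) := le_of_mul_le_mul_right (by linarith) hj
      have h4 : K * (v * φ ^ n) ≤ K ^ n * (v * φ ^ n) := by gcongr
      linarith
    have := Real.rpow_le_rpow (by positivity) h3 hn0
    rwa [e _ (by positivity)] at this
  · have h3 : φ ^ n ≤ (K * (u / v) ^ (1 / (n : ℝ))) ^ n := by
      rw [mul_pow, e' _ (by positivity), mul_div_assoc', le_div_iff₀ hv]
      have : v * φ ^ n ≤ K * u := le_of_mul_le_mul_right (by linarith) hj
      have h4 : K * u ≤ K ^ n * u := by gcongr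
      linarith
    exact le_of_pow_le_pow_left₀ hn (by positivity) h3

namespace Cell
variable {X : Type} {B : Subalgebra ℝ (X → ℝ)}

/-- On the cell `f` is comparable with a monomial in the distance to the centre. -/
def Prep (c : Cell B) (f : X × ℝ → ℝ) : Prop :=
  ∃ a ∈ B, (∀ x, 0 ≤ a x) ∧ ∃ q : ℚ, ∃ C : ℝ, 1 ≤ C ∧ ∀ x t, c.Mem x t →
    a x * t ^ (q : ℝ) ≤ C * |f (x, c.θ x + c.σ * t)| ∧
    |f (x, c.θ x + c.σ * t)| ≤ C * (a x * t ^ (q : ℝ))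

lemma Prep.sub {f : X × ℝ → ℝ} {c c' : Cell B} (h : Sub c' c) (hc : Prep c f) : Prep c' f := by
  obtain ⟨a, h1, h2, q, C, h3, h4⟩ := hc
  refine ⟨a, h1, h2, q, C, h3, fun x t ht => ?_⟩
  rw [h.1, h.2.1]; exact h4 x t (h.2.2 x t ht)

lemma ev_prep_poly (hB : IsTame B) {P : Finset B[X]} {p : B[X]} (hp : p ∈ P) (c : Cell B)
    (hc : Simple P c) : c.Ev fun c' => c'.Prep fun w => (spec p w.1).eval w.2 := by
  obtain ⟨C, hC, hT⟩ := taylor_comparable p.natDegree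
  set R := Finset.range (p.natDegree + 1) with hR
  let b : ℕ → X → ℝ := fun k x => |(spec (derivative^[k] p) x).eval (c.θ x)|
  have hb : ∀ k, b k ∈ B := fun k => hB.abs_mem (eval_mem id (fun _ h => h) c.hθ _)
  have hmon : ∀ k, (fun w : X × ℝ => b k w.1 * w.2 ^ k) ∈ polyAlg B := fun k =>
    mul_mem (evalAlg_base Prod.fst B Prod.snd (hb k)) (pow_mem (evalAlg_self _ _ _) k)
  refine (split hB c R (fun j => {w | ∀ k ∈ R, b k w.1 * w.2 ^ k ≤ b j w.1 * w.2 ^ j})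
    (fun j hj => SA.forall_finset R (P := fun k (w : X × ℝ) =>
      b k w.1 * w.2 ^ k ≤ b j w.1 * w.2 ^ j) fun k hk => SA.le (hmon k) (hmon j))
    fun x t ht => ?_).bind fun c' hs hc' => .of_self ?_
  · obtain ⟨j, hj, h⟩ := R.exists_max_image (fun k => b k x * t ^ k) ⟨0, by simp [hR]⟩
    exact ⟨j, hj, h⟩
  · obtain ⟨j, hj, hmax⟩ := hc'
    refine ⟨b j, hb j, fun x => abs_nonneg _, j, (p.natDegree + 1) * C, ?_, fun x t ht => ?_⟩
    · nlinarith [(Nat.cast_nonneg p.natDegree : (0 : ℝ) ≤ p.natDegree)]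
    have ht' := hs.2.2 x t ht
    obtain ⟨h1, h2⟩ := hT (spec p x) (natDegree_spec_le p x) (c.θ x) c.σ t c.hσ ht'.pos
      (hc p hp x t ht')
    have e : ∀ k, |(derivative^[k] (spec p x)).eval (c.θ x)| = b k x := fun k => by simp [b]
    simp only [e] at h1 h2
    rw [hs.1, hs.2.1]
    simp only [Rat.cast_natCast, Real.rpow_natCast]
    have h0 : ∀ k, 0 ≤ b k x * t ^ k := fun k => mul_nonneg (abs_nonneg _) (pow_nonneg ht.pos.le k)
    have hd : (0 : ℝ) ≤ p.natDegree := Nat.cast_nonneg _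
    constructor
    · have := Finset.single_le_sum (f := fun k => b k x * t ^ k) (fun k _ => h0 k) hj
      refine (this.trans h2).trans ?_
      have : 0 ≤ C * |eval (c.θ x + c.σ * t) (spec p x)| := by positivity
      nlinarith
    · have := Finset.sum_le_card_nsmul R _ _ (hmax x t ht)
      rw [hR, Finset.card_range, nsmul_eq_mul] at this
      refine (h1.trans this).trans ?_
      push_cast
      have := mul_nonneg (by linarith : 0 ≤ (p.natDegree : ℝ) + 1) (h0 j)
      nlinarith

lemma Prep.of_two_terms (hB : IsTame B) {c : Cell B} {f f₁ f₂ : X × ℝ → ℝ} (h₁ : c.Prep f₁)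
    (h₂ : c.Prep f₂) {j n : ℕ} (hn : n ≠ 0) {D : ℝ} (hD : 1 ≤ D)
    (h : ∀ x t, c.Mem x t → ∀ w, w = (x, c.θ x + c.σ * t) → f w ≠ 0 ∧ f₁ w ≠ 0 ∧ f₂ w ≠ 0 ∧
      |f₁ w * f w ^ j| ≤ D * |f₂ w * f w ^ (j + n)| ∧
      |f₂ w * f w ^ (j + n)| ≤ D * |f₁ w * f w ^ j|) : c.Prep f := by
  obtain ⟨a₁, ha₁, h0₁, q₁, C₁, hC₁, H₁⟩ := h₁
  obtain ⟨a₂, ha₂, h0₂, q₂, C₂, hC₂, H₂⟩ := h₂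
  have hq : ∀ x, 0 ≤ a₁ x * (a₂ x)⁻¹ := fun x => mul_nonneg (h0₁ x) (inv_nonneg.2 (h0₂ x))
  refine ⟨fun x => (a₁ x * (a₂ x)⁻¹) ^ (((1 / n : ℚ)) : ℝ),
    hB.rpow_mem (mul_mem ha₁ (hB.inv_mem ha₂)) hq _, fun x => Real.rpow_nonneg (hq x) _,
    (q₁ - q₂) / n, D * C₁ * C₂, ?_, fun x t ht => ?_⟩
  · have : 1 ≤ D * C₁ := one_le_mul_of_one_le_of_one_le hD hC₁
    exact one_le_mul_of_one_le_of_one_le this hC₂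
  obtain ⟨hf, hf₁, hf₂, k1, k2⟩ := h x t ht _ rfl
  obtain ⟨l1, l2⟩ := H₁ x t ht
  obtain ⟨m1, m2⟩ := H₂ x t ht
  set w : X × ℝ := (x, c.θ x + c.σ * t)
  have htp := ht.pos
  have u0 : 0 < a₁ x * t ^ (q₁ : ℝ) := by
    have := (abs_pos.2 hf₁).trans_le l2
    exact (pos_iff_pos_of_mul_pos this).1 (by linarith)
  have v0 : 0 < a₂ x * t ^ (q₂ : ℝ) := by
    have := (abs_pos.2 hf₂).trans_le m2
    exact (pos_iff_pos_of_mul_pos this).1 (by linarith)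
  have a0 : 0 < a₁ x := (pos_iff_pos_of_mul_pos u0).2 (by positivity)
  have b0 : 0 < a₂ x := (pos_iff_pos_of_mul_pos v0).2 (by positivity)
  have hφ := abs_pos.2 hf
  rw [abs_mul, abs_mul, abs_pow, abs_pow] at k1 k2
  have key := root_comparable (φ := |f w|) (u := a₁ x * t ^ (q₁ : ℝ)) (v := a₂ x * t ^ (q₂ : ℝ))
    (K := D * C₁ * C₂) (j := j) hφ u0 v0 hn
    (one_le_mul_of_one_le_of_one_le (one_le_mul_of_one_le_of_one_le hD hC₁) hC₂) ?_ ?_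
  · have e : (a₁ x * t ^ (q₁ : ℝ) / (a₂ x * t ^ (q₂ : ℝ))) ^ (1 / (n : ℝ)) =
        (a₁ x * (a₂ x)⁻¹) ^ (((1 / n : ℚ)) : ℝ) * t ^ ((((q₁ - q₂) / n : ℚ)) : ℝ) := by
      rw [mul_div_mul_comm, ← Real.rpow_sub htp, Real.mul_rpow (by positivity) (by positivity),
        ← Real.rpow_mul htp.le]
      push_cast
      rw [div_eq_mul_inv (a₁ x), mul_one_div]
    rw [e] at key
    exact key
  · calc _ ≤ C₁ * |f₁ w| * |f w| ^ j := by gcongr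
      _ = C₁ * (|f₁ w| * |f w| ^ j) := by ring
      _ ≤ C₁ * (D * (|f₂ w| * |f w| ^ (j + n))) := by gcongr
      _ ≤ C₁ * (D * ((C₂ * (a₂ x * t ^ (q₂ : ℝ))) * |f w| ^ (j + n))) := by gcongr
      _ = _ := by ring
  · calc _ ≤ C₂ * |f₂ w| * |f w| ^ (j + n) := by gcongr
      _ = C₂ * (|f₂ w| * |f w| ^ (j + n)) := by ring
      _ ≤ C₂ * (D * (|f₁ w| * |f w| ^ j)) := by gcongr
      _ ≤ C₂ * (D * ((C₁ * (a₁ x * t ^ (q₁ : ℝ))) * |f w| ^ j)) := by gcongr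
      _ = _ := by ring

lemma ev_prep_algebraic (hB : IsTame B) {f : X × ℝ → ℝ} (hf : f ∈ tameClosure (polyAlg B))
    {Q : Finset (polyAlg B)[X]}
    (hQ : ∀ w, ∃ p ∈ Q, spec p w ≠ 0 ∧ (spec p w).eval (f w) = 0) (c : Cell B)
    (hc : ∀ p ∈ Q, ∀ k, c.Prep (p.coeff k : X × ℝ → ℝ)) : c.Ev fun c' => c'.Prep f := by
  set N := Q.sup natDegree + 1 with hN
  have hN1 : (1 : ℝ) ≤ N := by rw [hN]; push_cast; linarith [(Nat.cast_nonneg (Q.sup natDegree) :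
    (0 : ℝ) ≤ (Q.sup natDegree : ℕ))]
  set R := Finset.range N with hR
  let good : (polyAlg B)[X] → ℕ → ℕ → X × ℝ → Prop := fun p j k w =>
    (f w ≠ 0 ∧ (p.coeff j : X × ℝ → ℝ) w ≠ 0 ∧ (p.coeff k : X × ℝ → ℝ) w ≠ 0) ∧
      |(p.coeff j : X × ℝ → ℝ) w * f w ^ j| ≤ N * |(p.coeff k : X × ℝ → ℝ) w * f w ^ k| ∧
      |(p.coeff k : X × ℝ → ℝ) w * f w ^ k| ≤ N * |(p.coeff j : X × ℝ → ℝ) w * f w ^ j|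
  let G : (polyAlg B)[X] × ℕ × ℕ → X × ℝ → Prop := fun i w =>
    (i.2.1 = i.2.2 ∧ f w = 0) ∨ (i.2.1 ≠ i.2.2 ∧ good i.1 i.2.1 i.2.2 w)
  have hSA : ∀ i, SA (polyAlg B) {w | G i w} := by
    intro i
    refine SA.of_tameClosure ?_
    have hT := isTame_tameClosure (polyAlg B)
    have z := (tameClosure (polyAlg B)).zero_mem
    have hco : ∀ k, (i.1.coeff k : X × ℝ → ℝ) ∈ tameClosure (polyAlg B) :=
      fun k => le_tameClosure (i.1.coeff k).2
    have habs : ∀ k, (fun w => |(i.1.coeff k : X × ℝ → ℝ) w * f w ^ k|) ∈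
        tameClosure (polyAlg B) := fun k => hT.abs_mem (mul_mem (hco k) (pow_mem hf k))
    have hN' : (fun _ => (N : ℝ)) ∈ tameClosure (polyAlg B) := IsTame.const_mem _
    exact ((SA.const _).and (SA.eq hf z)).or ((SA.const _).and
      (((SA.eq hf z).not.and ((SA.eq (hco _) z).not.and (SA.eq (hco _) z).not)).and
      ((SA.le (habs _) (mul_mem hN' (habs _))).and (SA.le (habs _) (mul_mem hN' (habs _))))))
  refine (split hB c (Q ×ˢ (R ×ˢ R)) (fun i => {w | G i (w.1, c.θ w.1 + c.σ * w.2)})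
    (fun i _ => ?_) fun x t ht => ?_).bind fun c' hs hc' => .of_self ?_
  · refine (hSA i).comap (π := fun w : X × ℝ => (w.1, c.θ w.1 + c.σ * w.2)) ?_
    rintro _ ⟨p, rfl⟩
    refine .pos (eval_mem Prod.fst (fun a ha => evalAlg_base _ _ _ ha) ?_ p)
    exact add_mem (evalAlg_base Prod.fst B Prod.snd c.hθ)
      (mul_mem (IsTame.const_mem c.σ) (evalAlg_self _ _ _))
  · obtain ⟨p, hp, hp0, hroot⟩ := hQ (x, c.θ x + c.σ * t)
    by_cases h0 : f (x, c.θ x + c.σ * t) = 0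
    · exact ⟨(p, 0, 0), by simp [hp, hR, hN], Or.inl ⟨rfl, h0⟩⟩
    have hpN : p.natDegree < N := Nat.lt_succ_of_le (Finset.le_sup (f := natDegree) hp)
    have hdeg := (natDegree_spec_le p (x, c.θ x + c.σ * t)).trans_lt hpN
    rw [eval_eq_sum_range' hdeg] at hroot
    obtain ⟨k, hk, j, hj, h1, h2, h3, h4, h5⟩ := exists_two_comparable_terms hroot
      ⟨_, Finset.mem_range.2 hdeg, mul_ne_zero (leadingCoeff_ne_zero.2 hp0) (pow_ne_zero _ h0)⟩
    simp only [spec_coeff] at h2 h3 h4 h5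
    exact ⟨(p, j, k), by simp [hp, hR, Finset.mem_range.1 hk, Finset.mem_range.1 hj],
      Or.inr ⟨h1, ⟨h0, left_ne_zero_of_mul h3, left_ne_zero_of_mul h2⟩, h4, h5⟩⟩
  · obtain ⟨⟨p, j, k⟩, hi, h⟩ := hc'
    have hp : p ∈ Q := (Finset.mem_product.1 hi).1
    rw [← hs.1, ← hs.2.1] at h
    have pj := (hc p hp j).sub hs
    have pk := (hc p hp k).sub hs
    rcases lt_trichotomy j k with hjk | hjk | hjk
    · obtain ⟨n, rfl⟩ := Nat.exists_eq_add_of_lt hjk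
      refine Prep.of_two_terms hB pj pk (j := j) (n := n + 1) (by omega) hN1 ?_
      rintro x t ht w rfl
      rcases h x t ht with h | h
      · have h6 : j = j + n + 1 := h.1
        omega
      · obtain ⟨-, ⟨h1, h2, h3⟩, h4, h5⟩ := h
        exact ⟨h1, h2, h3, h4, h5⟩
    · subst hjk
      refine ⟨0, B.zero_mem, fun _ => le_rfl, 0, 1, le_rfl, fun x t ht => ?_⟩
      rcases h x t ht with h | h
      · have h6 := h.2
        simp only at h6
        simp [h6]
      · exact absurd rfl h.1
    · obtain ⟨n, rfl⟩ := Nat.exists_eq_add_of_lt hjk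
      refine Prep.of_two_terms hB pk pj (j := k) (n := n + 1) (by omega) hN1 ?_
      rintro x t ht w rfl
      rcases h x t ht with h | h
      · have h6 : k + n + 1 = k := h.1
        omega
      · obtain ⟨-, ⟨h1, h2, h3⟩, h4, h5⟩ := h
        exact ⟨h1, h3, h2, h5, h4⟩

/-- The preparation theorem: over a tame algebra, finitely many tame functions on `X × (-1,1)` are
comparable with monomials on the cells of a common finite covering. -/
theorem exists_prepared_covering (hB : IsTame B) (F : Finset (X × ℝ → ℝ))
    (hF : ∀ f ∈ F, f ∈ tameClosure (polyAlg B)) :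
    ∃ L : Finset (Cell B), (∀ c ∈ L, InBox c ∧ ∀ f ∈ F, c.Prep f) ∧ Covering L := by
  choose! Q hQ using fun f hf => Tame.algebraic (hF f hf)
  have hrep : ∀ a : polyAlg B, ∃ p : B[X], (a : X × ℝ → ℝ) = fun w => (spec p w.1).eval w.2 :=
    fun a => a.2
  choose p hp using hrep
  let P : Finset B[X] := F.biUnion fun f => (Q f).biUnion fun q => insert (p 0) (q.support.image
    fun k => p (q.coeff k))
  have hP : ∀ f ∈ F, ∀ q ∈ Q f, ∀ k, p (q.coeff k) ∈ P := by
    intro f hf q hq k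
    refine Finset.mem_biUnion.2 ⟨f, hf, Finset.mem_biUnion.2 ⟨q, hq, ?_⟩⟩
    by_cases h : q.coeff k = 0
    · rw [h]; exact Finset.mem_insert_self _ _
    · exact Finset.mem_insert_of_mem (Finset.mem_image_of_mem _ (mem_support_iff.2 h))
  obtain ⟨L, hL, hLc⟩ := exists_simple_covering hB P
  have step1 : ∀ c, Simple P c →
      c.Ev fun c' => ∀ g ∈ P, c'.Prep fun w => (spec g w.1).eval w.2 :=
    Ev.forall_finset P (fun _ _ h => Simple.sub h) (fun _ _ _ h => Prep.sub h)
      fun g hg c hc => ev_prep_poly hB hg c hc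
  have step2 : ∀ c : Cell B, (∀ g ∈ P, c.Prep fun w => (spec g w.1).eval w.2) →
      c.Ev fun c' => ∀ f ∈ F, c'.Prep f :=
    Ev.forall_finset F (fun _ _ h hc g hg => (hc g hg).sub h) (fun _ _ _ h => Prep.sub h)
      fun f hf c hc => ev_prep_algebraic hB (hF f hf) (hQ f hf) c fun q hq k => by
        rw [hp (q.coeff k)]; exact hc _ (hP f hf q hq k)
  obtain ⟨M, hM, hMc⟩ := hLc.bind (Q := fun c' => ∀ f ∈ F, c'.Prep f) fun c hc =>
    (step1 c (hL c hc).1).bind fun c' _ hc' => step2 c' hc'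
  refine ⟨M, fun c' hc' => ?_, hMc⟩
  obtain ⟨c, hc, hs, hq⟩ := hM c' hc'
  exact ⟨(hL c hc).2.sub hs, hq⟩

end Cell
end Semialg

namespace Semialg
open Real

/-- The extended nonnegative `G` and the real number `e` are comparable. -/
def Cmp (C : ℝ) (G : ENNReal) (e : ℝ) : Prop :=
  ENNReal.ofReal e ≤ ENNReal.ofReal C * G ∧ G ≤ ENNReal.ofReal (C * e)

lemma Cmp.mono {C C' : ℝ} {G : ENNReal} {e : ℝ} (h : Cmp C G e) (hC : C ≤ C') (he : 0 ≤ e) :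
    Cmp C' G e :=
  ⟨h.1.trans (mul_le_mul_left (ENNReal.ofReal_le_ofReal hC) _), h.2.trans
    (ENNReal.ofReal_le_ofReal (by gcongr))⟩

lemma posLog_eq_max (x : ℝ) : log⁺ x = max 0 (log x) := rfl

lemma one_add_posLog_pos (u : ℝ) : 0 < 1 + log⁺ u := by have := posLog_nonneg (x := u); linarith

lemma one_le_one_add_posLog (u : ℝ) : 1 ≤ 1 + log⁺ u := by
  have := posLog_nonneg (x := u); linarith

lemma one_add_posLog_mul (u v : ℝ) : 1 + log⁺ (u * v) ≤ (1 + log⁺ u) * (1 + log⁺ v) := by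
  have h1 := posLog_mul (x := u) (y := v)
  have h2 := posLog_nonneg (x := u)
  have h3 := posLog_nonneg (x := v)
  nlinarith [mul_nonneg h2 h3]

/-- A monomial times a product of logarithms of monomials. -/
noncomputable def logMonomial {d : ℕ} (a q : ℝ) (b p : Fin d → ℝ) (t : ℝ) : ℝ :=
  a * t ^ q * ∏ j, (1 + log⁺ (b j * t ^ p j))

lemma logMonomial_nonneg {d : ℕ} {a : ℝ} (ha : 0 ≤ a) (q : ℝ) (b p : Fin d → ℝ) {t : ℝ}
    (ht : 0 ≤ t) : 0 ≤ logMonomial a q b p t :=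
  mul_nonneg (mul_nonneg ha (rpow_nonneg ht _))
    (Finset.prod_nonneg fun _ _ => (one_add_posLog_pos _).le)

lemma logMonomial_le {d : ℕ} (q : ℝ) (p : Fin d → ℝ) {ε : ℝ} (hε : 0 < ε) :
    ∃ C : ℝ, 1 ≤ C ∧ ∀ (a : ℝ) (b : Fin d → ℝ) (s t : ℝ), 0 ≤ a → 0 < s → 0 < t →
      logMonomial a q b p t ≤
        C * logMonomial a q b p s * ((t / s) ^ q * exp (ε * |log (t / s)|)) := by
  set δ : ℝ := ε / (d + 1) with hδ
  have hδ0 : 0 < δ := by positivity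
  refine ⟨∏ j, (1 + |p j| / δ), Finset.one_le_prod fun j => ?_, fun a b s t ha hs ht => ?_⟩
  · have : 0 ≤ |p j| / δ := by positivity
    simpa using this
  set τ := t / s with hτ
  have hτ0 : 0 < τ := div_pos ht hs
  have hts : t = s * τ := by rw [hτ]; field_simp
  have hfac : ∀ j, 1 + log⁺ (b j * t ^ p j) ≤
      (1 + |p j| / δ) * (1 + log⁺ (b j * s ^ p j)) * exp (δ * |log τ|) := by
    intro j
    have e : b j * t ^ p j = b j * s ^ p j * τ ^ p j := by
      rw [hts, mul_rpow hs.le hτ0.le]; ring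
    rw [e]
    refine (one_add_posLog_mul _ _).trans ?_
    have h1 : 1 + log⁺ (τ ^ p j) ≤ (1 + |p j| / δ) * exp (δ * |log τ|) := by
      rw [posLog_eq_max, log_rpow hτ0]
      have h2 : max 0 (p j * log τ) ≤ |p j| * |log τ| := by
        rw [← abs_mul]; exact max_le (abs_nonneg _) (le_abs_self _)
      have h3 := add_one_le_exp (δ * |log τ|)
      have h4 : (1 : ℝ) ≤ exp (δ * |log τ|) := one_le_exp (by positivity)
      have h5 : |p j| * |log τ| = |p j| / δ * (δ * |log τ|) := by field_simp
      have h6 : |p j| / δ * (δ * |log τ|) ≤ |p j| / δ * exp (δ * |log τ|) := by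
        gcongr; linarith
      linarith
    calc _ ≤ (1 + log⁺ (b j * s ^ p j)) * ((1 + |p j| / δ) * exp (δ * |log τ|)) := by
          gcongr; exact (one_add_posLog_pos _).le
      _ = _ := by ring
  have hprod := Finset.prod_le_prod (s := Finset.univ)
    (fun j _ => (one_add_posLog_pos (b j * t ^ p j)).le) (fun j _ => hfac j)
  rw [Finset.prod_mul_distrib, Finset.prod_mul_distrib, Finset.prod_const, Finset.card_univ,
    Fintype.card_fin, ← exp_nat_mul] at hprod
  have hexp : exp (d * (δ * |log τ|)) ≤ exp (ε * |log τ|) := by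
    rw [exp_le_exp, ← mul_assoc]
    gcongr
    rw [hδ, mul_div_assoc', div_le_iff₀ (by positivity)]
    nlinarith
  have hP : 0 ≤ ∏ j, (1 + log⁺ (b j * s ^ p j)) :=
    Finset.prod_nonneg fun _ _ => (one_add_posLog_pos _).le
  have hC : 0 ≤ ∏ j, (1 + |p j| / δ) := Finset.prod_nonneg fun _ _ => by positivity
  unfold logMonomial
  calc _ ≤ a * t ^ q * ((∏ j, (1 + |p j| / δ)) * (∏ j, (1 + log⁺ (b j * s ^ p j))) *
        exp (ε * |log τ|)) := by
        gcongr
        exact hprod.trans (by gcongr)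
    _ = _ := by rw [hts, mul_rpow hs.le hτ0.le]; ring

lemma ofReal_mul_le_setLIntegral {f : ℝ → ℝ} {A B A' B' e C : ℝ} (hC : 0 ≤ C) (he : 0 ≤ e)
    (hsub : Set.Ioo A' B' ⊆ Set.Ioo A B) (h : ∀ t ∈ Set.Ioo A' B', e ≤ C * f t) :
    ENNReal.ofReal (e * (B' - A')) ≤
      ENNReal.ofReal C * ∫⁻ t in Set.Ioo A B, ENNReal.ofReal (f t) := by
  rw [ENNReal.ofReal_mul he, ← Real.volume_Ioo, ← setLIntegral_const,
    ← lintegral_const_mul' _ _ ENNReal.ofReal_ne_top]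
  refine (setLIntegral_mono' measurableSet_Ioo fun t ht => ?_).trans (lintegral_mono_set hsub)
  rw [← ENNReal.ofReal_mul hC]
  exact ENNReal.ofReal_le_ofReal (h t ht)

lemma abs_log_div_le {s t : ℝ} (hs : 0 < s) (ht : 0 < t) (h1 : t ≤ 2 * s) (h2 : s ≤ 2 * t) :
    |log (t / s)| ≤ 1 := by
  have hl := log_two_lt_d9
  rw [log_div ht.ne' hs.ne', abs_le]
  have e1 := log_le_log ht h1
  have e2 := log_le_log hs h2
  rw [log_mul two_ne_zero hs.ne'] at e1
  rw [log_mul two_ne_zero ht.ne'] at e2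
  constructor <;> linarith

lemma logMonomial_le_of_close {d : ℕ} (q : ℝ) (p : Fin d → ℝ) :
    ∃ C : ℝ, 1 ≤ C ∧ ∀ (a : ℝ) (b : Fin d → ℝ) (s t : ℝ), 0 ≤ a → 0 < s → 0 < t →
      t ≤ 2 * s → s ≤ 2 * t → logMonomial a q b p t ≤ C * logMonomial a q b p s := by
  obtain ⟨C, hC, h⟩ := logMonomial_le q p one_pos
  refine ⟨C * exp (|q| + 1), ?_, fun a b s t ha hs ht h1 h2 => ?_⟩
  · exact one_le_mul_of_one_le_of_one_le hC (one_le_exp (by positivity))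
  · refine (h a b s t ha hs ht).trans ?_
    have hl := abs_log_div_le hs ht h1 h2
    have e : (t / s) ^ q * exp (1 * |log (t / s)|) ≤ exp (|q| + 1) := by
      rw [rpow_def_of_pos (div_pos ht hs), ← exp_add, exp_le_exp]
      have : log (t / s) * q ≤ |q| := by
        refine (le_abs_self _).trans ?_
        rw [abs_mul]
        exact mul_le_of_le_one_left (abs_nonneg _) hl
      linarith
    have := logMonomial_nonneg ha q b p hs.le
    calc _ ≤ C * logMonomial a q b p s * exp (|q| + 1) := by gcongr
      _ = _ := by ring

lemma lintegral_short {d : ℕ} (q : ℝ) (p : Fin d → ℝ) :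
    ∃ C : ℝ, 1 ≤ C ∧ ∀ (a : ℝ) (b : Fin d → ℝ) (A B : ℝ), 0 ≤ a → 0 < A → A < B → B ≤ 2 * A →
      Cmp C (∫⁻ t in Set.Ioo A B, ENNReal.ofReal (logMonomial a q b p t))
        (logMonomial a q b p B * (B - A)) := by
  obtain ⟨C, hC, h⟩ := logMonomial_le_of_close q p
  refine ⟨C, hC, fun a b A B ha hA hAB hBA => ⟨?_, ?_⟩⟩
  · refine ofReal_mul_le_setLIntegral (by linarith)
      (logMonomial_nonneg ha q b p (hA.trans hAB).le) le_rfl fun t ht => ?_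
    exact h a b t B ha (hA.trans ht.1) (hA.trans hAB) (by linarith [ht.1]) (by linarith [ht.2])
  · rw [← mul_assoc, ENNReal.ofReal_mul (mul_nonneg (by linarith)
      (logMonomial_nonneg ha q b p (hA.trans hAB).le)), ← Real.volume_Ioo, ← setLIntegral_const]
    refine setLIntegral_mono' measurableSet_Ioo fun t ht => ENNReal.ofReal_le_ofReal ?_
    exact h a b B t ha (hA.trans hAB) (hA.trans ht.1) (by linarith [ht.2]) (by linarith [ht.1])

lemma lintegral_rpow_Ioo {e B : ℝ} (he : -1 < e) (hB : 0 < B) :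
    ∫⁻ t in Set.Ioo 0 B, ENNReal.ofReal ((t / B) ^ e) = ENNReal.ofReal (B / (e + 1)) := by
  have hi : IntegrableOn (fun t : ℝ => (t / B) ^ e) (Set.Ioo 0 B) := by
    have h1 : IntegrableOn (fun t : ℝ => t ^ e / B ^ e) (Set.Ioo 0 B) :=
      (((intervalIntegral.intervalIntegrable_rpow' he).1).mono_set
        Set.Ioo_subset_Ioc_self).div_const _
    exact h1.congr_fun (fun t ht => (div_rpow ht.1.le hB.le e).symm) measurableSet_Ioo
  rw [← ofReal_integral_eq_lintegral_ofReal hi ((ae_restrict_iff' measurableSet_Ioo).2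
    (Filter.Eventually.of_forall fun t ht => rpow_nonneg (div_nonneg ht.1.le hB.le) _))]
  congr 1
  rw [setIntegral_congr_fun (g := fun t => t ^ e / B ^ e) measurableSet_Ioo
    (fun t ht => div_rpow ht.1.le hB.le e), integral_div, ← integral_Ioc_eq_integral_Ioo,
    ← intervalIntegral.integral_of_le hB.le, integral_rpow (Or.inl he), zero_rpow (by linarith),
    sub_zero, rpow_add_one hB.ne']
  have := (rpow_pos_of_pos hB e).ne'
  field_simp

lemma lintegral_rpow_Ioi {e A : ℝ} (he : e < -1) (hA : 0 < A) :
    ∫⁻ t in Set.Ioi A, ENNReal.ofReal ((t / A) ^ e) = ENNReal.ofReal (A / (-(e + 1))) := by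
  have hi : IntegrableOn (fun t : ℝ => (t / A) ^ e) (Set.Ioi A) := by
    have h1 : IntegrableOn (fun t : ℝ => t ^ e / A ^ e) (Set.Ioi A) :=
      (integrableOn_Ioi_rpow_of_lt he hA).div_const _
    exact h1.congr_fun (fun t ht => (div_rpow (hA.trans ht).le hA.le e).symm) measurableSet_Ioi
  rw [← ofReal_integral_eq_lintegral_ofReal hi ((ae_restrict_iff' measurableSet_Ioi).2
    (Filter.Eventually.of_forall fun t ht => rpow_nonneg (div_nonneg (hA.trans ht).le hA.le) _))]
  congr 1
  rw [setIntegral_congr_fun (g := fun t => t ^ e / A ^ e) measurableSet_Ioi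
    (fun t ht => div_rpow (hA.trans ht).le hA.le e), integral_div,
    integral_Ioi_rpow_of_lt he hA, rpow_add_one hA.ne']
  have := (rpow_pos_of_pos hA e).ne'
  have h2 : e + 1 ≠ 0 := by linarith
  field_simp

lemma lintegral_long_pos {d : ℕ} {q : ℝ} (hq : 0 < q + 1) (p : Fin d → ℝ) :
    ∃ C : ℝ, 1 ≤ C ∧ ∀ (a : ℝ) (b : Fin d → ℝ) (A B : ℝ), 0 ≤ a → 0 ≤ A → 2 * A < B →
      Cmp C (∫⁻ t in Set.Ioo A B, ENNReal.ofReal (logMonomial a q b p t))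
        (logMonomial a q b p B * B) := by
  obtain ⟨C, hC, h⟩ := logMonomial_le_of_close q p
  obtain ⟨C', hC', h'⟩ := logMonomial_le q p (ε := (q + 1) / 2) (by linarith)
  refine ⟨max (2 * C) (C' * (2 / (q + 1))), le_max_of_le_left (by linarith),
    fun a b A B ha hA hAB => ?_⟩
  have hB : 0 < B := by linarith
  have hW := logMonomial_nonneg ha q b p hB.le
  constructor
  · have h1 := ofReal_mul_le_setLIntegral (A := A) (B := B) (A' := B / 2) (B' := B) (C := C)
      (f := logMonomial a q b p) (by linarith) hW (Set.Ioo_subset_Ioo (by linarith) le_rfl)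
      fun t ht => h a b t B ha (by linarith [ht.1]) hB (by linarith [ht.1]) (by linarith [ht.2])
    have e : logMonomial a q b p B * B = 2 * (logMonomial a q b p B * (B - B / 2)) := by ring
    rw [e, ENNReal.ofReal_mul zero_le_two]
    calc _ ≤ ENNReal.ofReal 2 * (ENNReal.ofReal C *
          ∫⁻ t in Set.Ioo A B, ENNReal.ofReal (logMonomial a q b p t)) := by gcongr
      _ = ENNReal.ofReal (2 * C) *
          ∫⁻ t in Set.Ioo A B, ENNReal.ofReal (logMonomial a q b p t) := by
          rw [ENNReal.ofReal_mul zero_le_two, mul_assoc]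
      _ ≤ _ := by gcongr; exact le_max_left _ _
  · calc _ ≤ ∫⁻ t in Set.Ioo 0 B, ENNReal.ofReal (logMonomial a q b p t) :=
          lintegral_mono_set (Set.Ioo_subset_Ioo hA le_rfl)
      _ ≤ ∫⁻ t in Set.Ioo 0 B, ENNReal.ofReal (C' * logMonomial a q b p B) *
          ENNReal.ofReal ((t / B) ^ ((q - 1) / 2)) := by
          refine setLIntegral_mono' measurableSet_Ioo fun t ht => ?_
          rw [← ENNReal.ofReal_mul (by positivity)]
          refine ENNReal.ofReal_le_ofReal ((h' a b B t ha hB ht.1).trans (le_of_eq ?_))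
          have hτ : 0 < t / B := div_pos ht.1 hB
          rw [abs_of_nonpos (log_nonpos hτ.le ((div_le_one hB).2 ht.2.le)),
            rpow_def_of_pos hτ, rpow_def_of_pos hτ, ← exp_add]
          congr 2
          ring
      _ = ENNReal.ofReal (C' * logMonomial a q b p B) * ENNReal.ofReal (B / ((q - 1) / 2 + 1)) := by
          rw [lintegral_const_mul' _ _ ENNReal.ofReal_ne_top, lintegral_rpow_Ioo (by linarith) hB]
      _ = ENNReal.ofReal (C' * (2 / (q + 1)) * (logMonomial a q b p B * B)) := by
          rw [← ENNReal.ofReal_mul (by positivity)]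
          congr 1
          have : (q - 1) / 2 + 1 = (q + 1) / 2 := by ring
          rw [this]
          field_simp
      _ ≤ _ := by
          refine ENNReal.ofReal_le_ofReal ?_
          gcongr
          exact le_max_right _ _

lemma lintegral_long_neg {d : ℕ} {q : ℝ} (hq : q + 1 < 0) (p : Fin d → ℝ) :
    ∃ C : ℝ, 1 ≤ C ∧ ∀ (a : ℝ) (b : Fin d → ℝ) (A B : ℝ), 0 ≤ a → 0 < A → 2 * A < B →
      Cmp C (∫⁻ t in Set.Ioo A B, ENNReal.ofReal (logMonomial a q b p t))
        (logMonomial a q b p A * A) := by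
  obtain ⟨C, hC, h⟩ := logMonomial_le_of_close q p
  obtain ⟨C', hC', h'⟩ := logMonomial_le q p (ε := -(q + 1) / 2) (by linarith)
  have hq' : 0 < -(q + 1) := by linarith
  refine ⟨max C (C' * (2 / -(q + 1))), le_max_of_le_left (by linarith),
    fun a b A B ha hA hAB => ?_⟩
  have hW := logMonomial_nonneg ha q b p hA.le
  constructor
  · have h1 := ofReal_mul_le_setLIntegral (A := A) (B := B) (A' := A) (B' := 2 * A) (C := C)
      (f := logMonomial a q b p) (by linarith) hW (Set.Ioo_subset_Ioo le_rfl (by linarith))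
      fun t ht => h a b t A ha (by linarith [ht.1]) hA (by linarith [ht.1]) (by linarith [ht.2])
    have e : logMonomial a q b p A * A = logMonomial a q b p A * (2 * A - A) := by ring
    rw [e]
    refine h1.trans ?_
    gcongr
    exact le_max_left _ _
  · calc _ ≤ ∫⁻ t in Set.Ioi A, ENNReal.ofReal (logMonomial a q b p t) :=
          lintegral_mono_set Set.Ioo_subset_Ioi_self
      _ ≤ ∫⁻ t in Set.Ioi A, ENNReal.ofReal (C' * logMonomial a q b p A) *
          ENNReal.ofReal ((t / A) ^ ((q - 1) / 2)) := by
          refine setLIntegral_mono' measurableSet_Ioi fun t (ht : A < t) => ?_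
          rw [← ENNReal.ofReal_mul (by positivity)]
          have ht0 := hA.trans ht
          refine ENNReal.ofReal_le_ofReal ((h' a b A t ha hA ht0).trans (le_of_eq ?_))
          have hτ : 0 < t / A := div_pos ht0 hA
          rw [abs_of_nonneg (log_nonneg ((one_le_div hA).2 ht.le)),
            rpow_def_of_pos hτ, rpow_def_of_pos hτ, ← exp_add]
          congr 2
          ring
      _ = ENNReal.ofReal (C' * logMonomial a q b p A) *
          ENNReal.ofReal (A / (-((q - 1) / 2 + 1))) := by
          rw [lintegral_const_mul' _ _ ENNReal.ofReal_ne_top, lintegral_rpow_Ioi (by linarith) hA]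
      _ = ENNReal.ofReal (C' * (2 / -(q + 1)) * (logMonomial a q b p A * A)) := by
          rw [← ENNReal.ofReal_mul (by positivity)]
          congr 1
          have : -((q - 1) / 2 + 1) = -(q + 1) / 2 := by ring
          rw [this]
          field_simp
      _ ≤ _ := by
          refine ENNReal.ofReal_le_ofReal ?_
          gcongr
          exact le_max_right _ _

lemma lintegral_inv_Ioo {A B : ℝ} (hA : 0 < A) (hAB : A ≤ B) :
    ∫⁻ t in Set.Ioo A B, ENNReal.ofReal (t ^ (-1 : ℝ)) = ENNReal.ofReal (log (B / A)) := by
  have hB := hA.trans_le hAB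
  have h0 : (0 : ℝ) ∉ Set.uIcc A B := Set.notMem_uIcc_of_lt hA hB
  have hi : IntegrableOn (fun t : ℝ => t ^ (-1 : ℝ)) (Set.Ioo A B) :=
    (intervalIntegral.intervalIntegrable_rpow (Or.inr h0)).1.mono_set Set.Ioo_subset_Ioc_self
  rw [← ofReal_integral_eq_lintegral_ofReal hi ((ae_restrict_iff' measurableSet_Ioo).2
    (Filter.Eventually.of_forall fun t ht => rpow_nonneg (hA.trans ht.1).le _))]
  congr 1
  rw [← integral_Ioc_eq_integral_Ioo, ← intervalIntegral.integral_of_le hAB,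
    ← integral_inv_of_pos hA hB]
  exact intervalIntegral.integral_congr fun t _ => rpow_neg_one t

lemma lintegral_long_zero {d : ℕ} (p : Fin d → ℝ) {K : ℝ} (hK : 1 ≤ K) :
    ∃ C : ℝ, 1 ≤ C ∧ ∀ (a : ℝ) (b : Fin d → ℝ) (A B : ℝ), 0 ≤ a → 0 < A → 2 * A < B →
      (∀ j, 1 ≤ K * (b j * A ^ p j) ∧ 1 ≤ K * (b j * B ^ p j)) →
      Cmp C (∫⁻ t in Set.Ioo A B, ENNReal.ofReal (logMonomial a (-1) b p t))
        (a * ((1 + log⁺ (B / A)) *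
          ∏ j, (1 + (log⁺ (b j * A ^ p j) + log⁺ (b j * B ^ p j))))) := by
  set M := 3 + 3 * log K with hM
  have hlK : 0 ≤ log K := log_nonneg hK
  have hM1 : 1 ≤ M := by linarith
  have hMd : 1 ≤ M ^ d := one_le_pow₀ hM1
  refine ⟨9 * M ^ d, by linarith, fun a b A B ha hA hAB hb => ?_⟩
  have hB : 0 < B := by linarith
  set Pr := ∏ j, (1 + (log⁺ (b j * A ^ p j) + log⁺ (b j * B ^ p j))) with hPr
  have hPr0 : 0 ≤ Pr := Finset.prod_nonneg fun j _ => by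
    have := posLog_nonneg (x := b j * A ^ p j)
    have := posLog_nonneg (x := b j * B ^ p j)
    linarith
  have hBA : 2 < B / A := (lt_div_iff₀ hA).2 hAB
  have hl2 := log_two_gt_d9
  have hlog : log 2 ≤ log (B / A) := log_le_log two_pos hBA.le
  have hpl : log⁺ (B / A) = log (B / A) := posLog_eq_log (by
    rw [abs_of_pos (by linarith)]; linarith)
  have hlAB : log (B / A) = log B - log A := log_div hB.ne' hA.ne'
  have hbpos : ∀ j, 0 < b j * A ^ p j ∧ 0 < b j * B ^ p j := fun j =>
    ⟨(pos_iff_pos_of_mul_pos (by linarith [(hb j).1] : 0 < K * (b j * A ^ p j))).1 (by linarith),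
     (pos_iff_pos_of_mul_pos (by linarith [(hb j).2] : 0 < K * (b j * B ^ p j))).1 (by linarith)⟩
  have hbj : ∀ j, 0 < b j := fun j => (pos_iff_pos_of_mul_pos (hbpos j).1).2 (rpow_pos_of_pos hA _)
  constructor
  · set A' := exp (2 / 3 * log A + 1 / 3 * log B) with hA'
    set B' := exp (1 / 3 * log A + 2 / 3 * log B) with hB'
    have hA'0 : 0 < A' := exp_pos _
    have hA'B' : A' ≤ B' := exp_le_exp.2 (by linarith)
    have hAA' : A ≤ A' := by
      rw [hA', ← log_le_iff_le_exp hA]; linarith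
    have hBB' : B' ≤ B := by
      rw [hB', ← le_log_iff_exp_le hB]; linarith
    have hlog' : log (B' / A') = 1 / 3 * log (B / A) := by
      rw [log_div (exp_pos _).ne' (exp_pos _).ne', log_exp, log_exp, hlAB]; ring
    have hpt : ∀ t ∈ Set.Ioo A' B', a * Pr * t ^ (-1 : ℝ) ≤ M ^ d * logMonomial a (-1) b p t := by
      intro t ht
      have ht0 := hA'0.trans ht.1
      have hprod : Pr ≤ M ^ d * ∏ j, (1 + log⁺ (b j * t ^ p j)) := by
        have : M ^ d = ∏ _j : Fin d, M := by simp
        rw [this, ← Finset.prod_mul_distrib, hPr]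
        refine Finset.prod_le_prod (fun j _ => ?_) fun j _ => ?_
        · have := posLog_nonneg (x := b j * A ^ p j)
          have := posLog_nonneg (x := b j * B ^ p j)
          linarith
        have k1 := log_nonneg (hb j).1
        have k2 := log_nonneg (hb j).2
        rw [log_mul (by linarith) (hbpos j).1.ne', log_mul (hbj j).ne' (rpow_pos_of_pos hA _).ne',
          log_rpow hA] at k1
        rw [log_mul (by linarith) (hbpos j).2.ne', log_mul (hbj j).ne' (rpow_pos_of_pos hB _).ne',
          log_rpow hB] at k2
        have m1 : log⁺ (b j * A ^ p j) ≤ log K + (log (b j) + p j * log A) := by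
          rw [posLog_eq_max, log_mul (hbj j).ne' (rpow_pos_of_pos hA _).ne', log_rpow hA]
          exact max_le k1 (by linarith)
        have m2 : log⁺ (b j * B ^ p j) ≤ log K + (log (b j) + p j * log B) := by
          rw [posLog_eq_max, log_mul (hbj j).ne' (rpow_pos_of_pos hB _).ne', log_rpow hB]
          exact max_le k2 (by linarith)
        have m3 : log (b j) + p j * log t ≤ log⁺ (b j * t ^ p j) := by
          rw [posLog_eq_max, log_mul (hbj j).ne' (rpow_pos_of_pos ht0 _).ne', log_rpow ht0]
          exact le_max_right _ _
        have n1 : 2 / 3 * log A + 1 / 3 * log B ≤ log t := by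
          rw [le_log_iff_exp_le ht0]; exact ht.1.le
        have n2 : log t ≤ 1 / 3 * log A + 2 / 3 * log B := by
          rw [log_le_iff_le_exp ht0]; exact ht.2.le
        have key : (log K + (log (b j) + p j * log A)) + (log K + (log (b j) + p j * log B)) ≤
            3 * (log K + (log (b j) + p j * log t)) := by
          rcases le_total 0 (p j) with hp | hp <;> nlinarith
        have := posLog_nonneg (x := b j * t ^ p j)
        rw [hM]
        nlinarith
      unfold logMonomial
      have : 0 ≤ a * t ^ (-1 : ℝ) := mul_nonneg ha (rpow_nonneg ht0.le _)
      nlinarith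
    have haPr : 0 ≤ a * Pr := mul_nonneg ha hPr0
    calc _ ≤ ENNReal.ofReal (9 * (a * Pr * log (B' / A'))) := by
          refine ENNReal.ofReal_le_ofReal ?_
          rw [hpl, hlog']
          have : 1 + log (B / A) ≤ 3 * log (B / A) := by linarith
          calc a * ((1 + log (B / A)) * Pr) = a * Pr * (1 + log (B / A)) := by ring
            _ ≤ a * Pr * (3 * log (B / A)) := by gcongr
            _ = _ := by ring
      _ = ENNReal.ofReal 9 * ∫⁻ t in Set.Ioo A' B', ENNReal.ofReal (a * Pr * t ^ (-1 : ℝ)) := by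
          rw [ENNReal.ofReal_mul (by norm_num), ENNReal.ofReal_mul haPr,
            ← lintegral_inv_Ioo hA'0 hA'B', ← lintegral_const_mul' _ _ ENNReal.ofReal_ne_top]
          simp_rw [ENNReal.ofReal_mul haPr]
      _ ≤ ENNReal.ofReal 9 * ∫⁻ t in Set.Ioo A' B',
            ENNReal.ofReal (M ^ d) * ENNReal.ofReal (logMonomial a (-1) b p t) := by
          gcongr 1
          refine setLIntegral_mono' measurableSet_Ioo fun t ht => ?_
          rw [← ENNReal.ofReal_mul (by linarith)]
          exact ENNReal.ofReal_le_ofReal (hpt t ht)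
      _ = ENNReal.ofReal (9 * M ^ d) * ∫⁻ t in Set.Ioo A' B',
            ENNReal.ofReal (logMonomial a (-1) b p t) := by
          rw [lintegral_const_mul' _ _ ENNReal.ofReal_ne_top, ENNReal.ofReal_mul (by norm_num),
            mul_assoc]
      _ ≤ _ := by
          gcongr
  · calc _ ≤ ∫⁻ t in Set.Ioo A B, ENNReal.ofReal (a * Pr) * ENNReal.ofReal (t ^ (-1 : ℝ)) := by
          refine setLIntegral_mono' measurableSet_Ioo fun t ht => ?_
          have ht0 := hA.trans ht.1
          rw [← ENNReal.ofReal_mul (mul_nonneg ha hPr0)]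
          refine ENNReal.ofReal_le_ofReal ?_
          unfold logMonomial
          have hprod : ∏ j, (1 + log⁺ (b j * t ^ p j)) ≤ Pr := by
            refine Finset.prod_le_prod (fun j _ => (one_add_posLog_pos _).le) fun j _ => ?_
            have i1 := posLog_nonneg (x := b j * A ^ p j)
            have i2 := posLog_nonneg (x := b j * B ^ p j)
            rcases le_total 0 (p j) with hp | hp
            · have := posLog_le_posLog (mul_nonneg (hbj j).le (rpow_nonneg ht0.le (p j)))
                (mul_le_mul_of_nonneg_left (rpow_le_rpow ht0.le ht.2.le hp) (hbj j).le)
              linarith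
            · have := posLog_le_posLog (mul_nonneg (hbj j).le (rpow_nonneg ht0.le (p j)))
                (mul_le_mul_of_nonneg_left (rpow_le_rpow_of_nonpos hA ht.1.le hp) (hbj j).le)
              linarith
          have : 0 ≤ a * t ^ (-1 : ℝ) := mul_nonneg ha (rpow_nonneg ht0.le _)
          nlinarith
      _ = ENNReal.ofReal (a * Pr * log (B / A)) := by
          rw [lintegral_const_mul' _ _ ENNReal.ofReal_ne_top, lintegral_inv_Ioo hA (by linarith),
            ENNReal.ofReal_mul (mul_nonneg ha hPr0)]
      _ ≤ _ := by
          refine ENNReal.ofReal_le_ofReal ?_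
          rw [hpl]
          have h0 : 0 ≤ a * Pr := mul_nonneg ha hPr0
          have h1 : 0 ≤ log (B / A) := by linarith
          have h2 := mul_nonneg h0 h1
          nlinarith

lemma lintegral_eq_top {d : ℕ} {q : ℝ} (hq : q + 1 ≤ 0) (p b : Fin d → ℝ) {a B : ℝ} (ha : 0 < a)
    (hB : 0 < B) : ∫⁻ t in Set.Ioo 0 B, ENNReal.ofReal (logMonomial a q b p t) = ⊤ := by
  by_contra hne
  have h1 : ∫⁻ t in Set.Ioo 0 B, ENNReal.ofReal (t ^ q) < ⊤ := by
    have h2 : ENNReal.ofReal a * ∫⁻ t in Set.Ioo 0 B, ENNReal.ofReal (t ^ q) ≤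
        ∫⁻ t in Set.Ioo 0 B, ENNReal.ofReal (logMonomial a q b p t) := by
      rw [← lintegral_const_mul' _ _ ENNReal.ofReal_ne_top]
      refine setLIntegral_mono' measurableSet_Ioo fun t ht => ?_
      rw [← ENNReal.ofReal_mul ha.le]
      refine ENNReal.ofReal_le_ofReal (le_mul_of_one_le_right
        (mul_nonneg ha.le (rpow_nonneg ht.1.le _)) (Finset.one_le_prod fun j => ?_))
      exact fun _ => one_le_one_add_posLog _
    have h3 := h2.trans_lt (lt_top_iff_ne_top.2 hne)
    exact ENNReal.lt_top_of_mul_ne_top_right h3.ne (by simpa using ha)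
  have h2 : IntegrableOn (fun t : ℝ => t ^ q) (Set.Ioo 0 B) := by
    refine ⟨(measurable_id.pow_const q).aestronglyMeasurable, ?_⟩
    rw [hasFiniteIntegral_iff_ofReal ((ae_restrict_iff' measurableSet_Ioo).2
      (Filter.Eventually.of_forall fun t ht => rpow_nonneg ht.1.le _))]
    exact h1
  have := (intervalIntegral.integrableOn_Ioo_rpow_iff hB).1 h2
  linarith

end Semialg

namespace Semialg
open Real

variable {X : Type} {B : Subalgebra ℝ (X → ℝ)}

lemma posLog_max_one_abs (u : ℝ) : log⁺ (max 1 |u|) = log⁺ u := by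
  rcases le_total |u| 1 with h | h
  · rw [max_eq_left h, posLog_one, posLog_eq_zero_iff u |>.2 h]
  · rw [max_eq_right h, posLog_abs]

lemma posLog_max_mul_max (u v : ℝ) :
    log⁺ (max 1 |u| * max 1 |v|) = log⁺ u + log⁺ v := by
  have h1 : 1 ≤ max 1 |u| := le_max_left _ _
  have h2 : 1 ≤ max 1 |v| := le_max_left _ _
  have h3 := one_le_mul_of_one_le_of_one_le h1 h2
  rw [posLog_eq_log (by rwa [abs_of_nonneg (by linarith)]),
    log_mul (by linarith) (by linarith), ← posLog_eq_log (by rwa [abs_of_nonneg (by linarith)]),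
    ← posLog_eq_log (by rwa [abs_of_nonneg (by linarith)]), posLog_max_one_abs, posLog_max_one_abs]

/-- Products of a nonnegative function of `B` and `d` logarithms of functions of `B`. -/
def logMon (B : Subalgebra ℝ (X → ℝ)) (d : ℕ) : Set (X → ℝ) :=
  {e | ∃ g ∈ B, (∀ x, 0 ≤ g x) ∧ ∃ h : Fin d → X → ℝ, (∀ j, h j ∈ B ∧ ∀ x, 1 ≤ h j x) ∧
    e = fun x => g x * ∏ j, (1 + log⁺ (h j x))}

lemma logMon_mk (hB : IsTame B) {d : ℕ} {g : X → ℝ} (hg : g ∈ B) (h0 : ∀ x, 0 ≤ g x)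
    {h : Fin d → X → ℝ} (hh : ∀ j, h j ∈ B) :
    (fun x => g x * ∏ j, (1 + log⁺ (h j x))) ∈ logMon B d :=
  ⟨g, hg, h0, fun j x => max 1 |h j x|, fun j =>
    ⟨hB.max_mem (IsTame.const_mem 1) (hB.abs_mem (hh j)), fun _ => le_max_left _ _⟩, by
      simp only [posLog_max_one_abs]⟩

lemma logMon_mk_succ (hB : IsTame B) {d : ℕ} {g : X → ℝ} (hg : g ∈ B) (h0 : ∀ x, 0 ≤ g x)
    {k : X → ℝ} (hk : k ∈ B) {h : Fin d → X → ℝ} (hh : ∀ j, h j ∈ B) :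
    (fun x => g x * ((1 + log⁺ (k x)) * ∏ j, (1 + log⁺ (h j x)))) ∈ logMon B (d + 1) := by
  have := logMon_mk hB hg h0 (h := Fin.cons k h) (fun j => by
    refine Fin.cases ?_ (fun j => ?_) j
    · exact hk
    · exact hh j)
  simpa [Fin.prod_univ_succ] using this

lemma logMon_succ (hB : IsTame B) {d : ℕ} {e : X → ℝ} (he : e ∈ logMon B d) :
    e ∈ logMon B (d + 1) := by
  obtain ⟨g, hg, h0, h, hh, rfl⟩ := he
  simpa using logMon_mk_succ hB hg h0 (k := fun _ => 1) (IsTame.const_mem 1) fun j => (hh j).1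

lemma logMon_ite (hB : IsTame B) {d : ℕ} {e : X → ℝ} (he : e ∈ logMon B d) {S : Set X}
    (hS : SA B S) : (fun x => if x ∈ S then e x else 0) ∈ logMon B d := by
  obtain ⟨g, hg, h0, h, hh, rfl⟩ := he
  refine ⟨_, hB.ite_mem (P := fun x => x ∈ S) hS hg B.zero_mem, fun x => ?_, h, hh, ?_⟩
  · split_ifs
    · exact h0 x
    · exact le_rfl
  · funext x
    split_ifs <;> simp

lemma logMon_comap {Y : Type} {D : Subalgebra ℝ (Y → ℝ)} {φ : Y → X} (hφ : ∀ f ∈ B, f ∘ φ ∈ D)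
    {d : ℕ} {e : X → ℝ} (he : e ∈ logMon B d) : e ∘ φ ∈ logMon D d := by
  obtain ⟨g, hg, h0, h, hh, rfl⟩ := he
  exact ⟨g ∘ φ, hφ g hg, fun x => h0 _, fun j => h j ∘ φ, fun j => ⟨hφ _ (hh j).1, fun x =>
    (hh j).2 _⟩, rfl⟩

lemma logMon_nonneg {d : ℕ} {e : X → ℝ} (he : e ∈ logMon B d) (x : X) : 0 ≤ e x := by
  obtain ⟨g, hg, h0, h, hh, rfl⟩ := he
  exact mul_nonneg (h0 x) (Finset.prod_nonneg fun _ _ => (one_add_posLog_pos _).le)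

/-- Finite sums of products of a function of `B` and `d` logarithms. -/
def logSum (B : Subalgebra ℝ (X → ℝ)) (d : ℕ) : AddSubmonoid (X → ℝ) :=
  AddSubmonoid.closure (logMon B d)

lemma logSum_nonneg {d : ℕ} {e : X → ℝ} (he : e ∈ logSum B d) (x : X) : 0 ≤ e x := by
  induction he using AddSubmonoid.closure_induction with
  | mem e he => exact logMon_nonneg he x
  | zero => exact le_rfl
  | add e e' _ _ h h' => exact add_nonneg h h'

lemma logSum_succ (hB : IsTame B) {d : ℕ} {e : X → ℝ} (he : e ∈ logSum B d) :
    e ∈ logSum B (d + 1) :=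
  AddSubmonoid.closure_mono (fun _ h => logMon_succ hB h) he

lemma logSum_comap {Y : Type} {D : Subalgebra ℝ (Y → ℝ)} {φ : Y → X} (hφ : ∀ f ∈ B, f ∘ φ ∈ D)
    {d : ℕ} {e : X → ℝ} (he : e ∈ logSum B d) : e ∘ φ ∈ logSum D d := by
  induction he using AddSubmonoid.closure_induction with
  | mem e he => exact AddSubmonoid.subset_closure (logMon_comap hφ he)
  | zero => exact zero_mem _
  | add _ _ _ _ h₁ h₂ => exact add_mem h₁ h₂

/-- Functions comparable with a finite sum of products of a function of `B` and `d` logarithms. -/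
def LogClass (B : Subalgebra ℝ (X → ℝ)) (d : ℕ) (G : X → ENNReal) : Prop :=
  ∃ E ∈ logSum B d, ∃ C : ℝ, 1 ≤ C ∧ ∀ x, Cmp C (G x) (E x)

namespace LogClass

variable {d : ℕ} {G G' : X → ENNReal}

lemma zero : LogClass B d fun _ => 0 :=
  ⟨0, zero_mem _, 1, le_rfl, fun x => by simp [Cmp]⟩

lemma add (h : LogClass B d G) (h' : LogClass B d G') : LogClass B d fun x => G x + G' x := by
  obtain ⟨E, hE, C, hC, h⟩ := h
  obtain ⟨E', hE', C', hC', h'⟩ := h'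
  refine ⟨E + E', add_mem hE hE', C + C', by linarith, fun x => ?_⟩
  have h0 := logSum_nonneg hE x
  have h0' := logSum_nonneg hE' x
  have k := (h x).mono (by linarith : C ≤ C + C') h0
  have k' := (h' x).mono (by linarith : C' ≤ C + C') h0'
  constructor
  · rw [Pi.add_apply, ENNReal.ofReal_add h0 h0', mul_add]
    exact add_le_add k.1 k'.1
  · rw [Pi.add_apply, mul_add, ENNReal.ofReal_add (by positivity) (by positivity)]
    exact add_le_add k.2 k'.2

lemma sum {ι : Type*} (s : Finset ι) {G : ι → X → ENNReal} (h : ∀ i ∈ s, LogClass B d (G i)) :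
    LogClass B d fun x => ∑ i ∈ s, G i x := by
  induction s using Finset.induction_on with
  | empty => simpa using zero
  | insert a s ha ih =>
    simp_rw [Finset.sum_insert ha]
    exact (h a (by simp)).add (ih fun i hi => h i (by simp [hi]))

lemma succ (hB : IsTame B) (h : LogClass B d G) : LogClass B (d + 1) G := by
  obtain ⟨E, hE, h⟩ := h
  exact ⟨E, logSum_succ hB hE, h⟩

lemma mono (hB : IsTame B) {d' : ℕ} (hd : d ≤ d') (h : LogClass B d G) : LogClass B d' G := by
  induction hd with
  | refl => exact h
  | step _ ih => exact ih.succ hB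

lemma comap {Y : Type} {D : Subalgebra ℝ (Y → ℝ)} {φ : Y → X} (hφ : ∀ f ∈ B, f ∘ φ ∈ D)
    (h : LogClass B d G) : LogClass D d fun y => G (φ y) := by
  obtain ⟨E, hE, C, hC, h⟩ := h
  exact ⟨E ∘ φ, logSum_comap hφ hE, C, hC, fun y => h _⟩

lemma congr (h : LogClass B d G) {K : ℝ} (hK : 1 ≤ K)
    (h1 : ∀ x, G x ≤ ENNReal.ofReal K * G' x) (h2 : ∀ x, G' x ≤ ENNReal.ofReal K * G x) :
    LogClass B d G' := by
  obtain ⟨E, hE, C, hC, h⟩ := h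
  refine ⟨E, hE, C * K, one_le_mul_of_one_le_of_one_le hC hK, fun x => ⟨?_, ?_⟩⟩
  · rw [ENNReal.ofReal_mul (by linarith), mul_assoc]
    exact (h x).1.trans (mul_le_mul_right (h1 x) _)
  · rw [mul_comm C K, mul_assoc, ENNReal.ofReal_mul (by linarith)]
    exact (h2 x).trans (mul_le_mul_right (h x).2 _)

lemma of_logMon (hB : IsTame B) {S : Set X} (hS : SA B S) {e : X → ℝ} (he : e ∈ logMon B d)
    {C : ℝ} (hC : 1 ≤ C) (h : ∀ x ∈ S, Cmp C (G x) (e x)) :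
    LogClass B d fun x => if x ∈ S then G x else 0 := by
  refine ⟨_, AddSubmonoid.subset_closure (logMon_ite hB he hS), C, hC, fun x => ?_⟩
  by_cases hx : x ∈ S
  · simpa [hx] using h x hx
  · simp [hx, Cmp]

lemma of_two (hB : IsTame B) {S T : Set X} (hS : SA B S) (hT : SA B T)
    {e e' : X → ℝ} (he : e ∈ logMon B d) (he' : e' ∈ logMon B d) {C C' : ℝ} (hC : 1 ≤ C)
    (hC' : 1 ≤ C') (h : ∀ x ∈ S, Cmp C (G x) (e x)) (h' : ∀ x ∈ T, Cmp C' (G x) (e' x))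
    (h0 : ∀ x, x ∉ S → x ∉ T → G x = 0) : LogClass B d G := by
  refine ((of_logMon hB hS he hC h).add (of_logMon hB hT he' hC' h')).congr one_le_two
    (fun x => ?_) fun x => ?_
  · rw [ENNReal.ofReal_ofNat, two_mul]
    refine add_le_add ?_ ?_
    all_goals
      split_ifs
      · exact le_rfl
      · exact zero_le
  · by_cases hx : x ∈ S
    · rw [if_pos hx, ENNReal.ofReal_ofNat, two_mul]
      exact le_add_right (le_self_add)
    by_cases hx' : x ∈ T
    · rw [if_pos hx', ENNReal.ofReal_ofNat, two_mul]
      exact le_add_right (le_add_self)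
    · simp [h0 x hx hx']

end LogClass

/-- Integrals of monomials over varying intervals. -/
theorem logClass_lintegral_logMonomial (hB : IsTame B) {d : ℕ} {S : Set X} (hS : SA B S)
    {lo hi a : X → ℝ} (hlo : lo ∈ B) (hhi : hi ∈ B) (ha : a ∈ B) (lo0 : ∀ x ∈ S, 0 ≤ lo x)
    (a0 : ∀ x, 0 ≤ a x) {b : Fin d → X → ℝ} (hb : ∀ j, b j ∈ B) (q : ℚ) (p : Fin d → ℚ) {K : ℝ}
    (hK : 1 ≤ K)
    (hbK : ∀ j, ∀ x ∈ S, ∀ t ∈ Set.Ioo (lo x) (hi x), 1 ≤ K * (b j x * t ^ (p j : ℝ)))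
    (hfin : ∀ x ∈ S, ∫⁻ t in Set.Ioo (lo x) (hi x),
      ENNReal.ofReal (logMonomial (a x) q (fun j => b j x) (fun j => p j) t) < ⊤) :
    LogClass B (d + 1) fun x => if x ∈ S then ∫⁻ t in Set.Ioo (lo x) (hi x),
      ENNReal.ofReal (logMonomial (a x) q (fun j => b j x) (fun j => p j) t) else 0 := by
  have hz := B.zero_mem
  have h2lo : (fun x => 2 * lo x) ∈ B := B.mul_mem (IsTame.const_mem 2) hlo
  have max0 : ∀ {f : X → ℝ}, f ∈ B → (fun x => max 0 (f x)) ∈ B :=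
    fun hf => hB.max_mem hz hf
  have hrp : ∀ {f : X → ℝ}, f ∈ B → ∀ r : ℚ, (fun x => max 0 (f x) ^ (r : ℝ)) ∈ B :=
    fun hf r => hB.rpow_mem (max0 hf) (fun _ => le_max_left _ _) r
  have hx0 : ∀ x, 0 ≤ max 0 (hi x) := fun x => le_max_left _ _
  have hl0 : ∀ x, 0 ≤ max 0 (lo x) := fun x => le_max_left _ _
  set T : Set X := {x | x ∈ S ∧ lo x < hi x ∧ hi x ≤ 2 * lo x} with hT
  have sT : SA B T := SA.and hS ((SA.lt hlo hhi).and (SA.le hhi h2lo))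
  obtain ⟨C₁, hC₁, k₁⟩ := lintegral_short (d := d) q (fun j => (p j : ℝ))
  have he₁ := logMon_mk_succ hB (d := d) (g := fun x => a x * max 0 (hi x) ^ (q : ℝ) *
      max 0 (hi x - lo x)) (B.mul_mem (B.mul_mem ha (hrp hhi q)) (max0 (B.sub_mem hhi hlo)))
    (fun x => mul_nonneg (mul_nonneg (a0 x) (rpow_nonneg (hx0 x) _)) (le_max_left _ _))
    (k := fun _ => 1) (IsTame.const_mem 1) (h := fun j x => b j x * max 0 (hi x) ^ (p j : ℝ))
    (fun j => B.mul_mem (hb j) (hrp hhi _))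
  have c₁ : ∀ x ∈ T, Cmp C₁ (if x ∈ S then ∫⁻ t in Set.Ioo (lo x) (hi x),
      ENNReal.ofReal (logMonomial (a x) q (fun j => b j x) (fun j => p j) t) else 0)
      (a x * max 0 (hi x) ^ (q : ℝ) *
        max 0 (hi x - lo x) * ((1 + log⁺ 1) *
        ∏ j, (1 + log⁺ (b j x * max 0 (hi x) ^ (p j : ℝ))))) := by
    intro x hx
    have hlox := lo0 x hx.1
    have hlo' : 0 < lo x := by linarith [hx.2.1, hx.2.2]
    rw [if_pos hx.1]
    have := k₁ (a x) (fun j => b j x) (lo x) (hi x) (a0 x) hlo' hx.2.1 hx.2.2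
    refine (congrArg (Cmp _ _) ?_).mp this
    rw [max_eq_right (hlo'.trans hx.2.1).le, max_eq_right (sub_pos.2 hx.2.1).le, posLog_one]
    unfold logMonomial
    ring
  have hzero : ∀ x, x ∈ S → hi x ≤ lo x → ∀ f : ℝ → ENNReal,
      ∫⁻ t in Set.Ioo (lo x) (hi x), f t = 0 := fun x _ h f => by
    rw [Set.Ioo_eq_empty h.not_gt]; simp
  have fin0 : (q : ℝ) + 1 ≤ 0 → ∀ x ∈ S, lo x = 0 → 0 < hi x → a x = 0 := by
    intro hq x hx h0 h1
    by_contra hne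
    have h2 := hfin x hx
    rw [h0, lintegral_eq_top hq _ _ ((a0 x).lt_of_ne' hne) h1] at h2
    exact h2.ne rfl
  have zero0 : (q : ℝ) + 1 ≤ 0 → ∀ x, x ∉ T → x ∉ {x | x ∈ S ∧ 0 < lo x ∧ 2 * lo x < hi x} →
      (if x ∈ S then ∫⁻ t in Set.Ioo (lo x) (hi x),
      ENNReal.ofReal (logMonomial (a x) q (fun j => b j x) (fun j => p j) t) else 0) = 0 := by
    intro hq x h1 h2
    split_ifs with hx
    · rcases le_or_gt (hi x) (lo x) with h | h
      · exact hzero x hx h _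
      have h3 : 2 * lo x < hi x := by
        by_contra h4
        exact h1 ⟨hx, h, not_lt.1 h4⟩
      have h4 : lo x = 0 := by
        refine le_antisymm ?_ (lo0 x hx)
        by_contra h5
        exact h2 ⟨hx, not_le.1 h5, h3⟩
      simp [logMonomial, fin0 hq x hx h4 (by linarith)]
    · rfl
  rcases lt_trichotomy ((q : ℝ) + 1) 0 with hq | hq | hq
  · obtain ⟨C₂, hC₂, k₂⟩ := lintegral_long_neg (d := d) hq (fun j => (p j : ℝ))
    have he₂ := logMon_mk_succ hB (d := d) (g := fun x => a x * max 0 (lo x) ^ (q : ℝ) *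
        max 0 (lo x)) (B.mul_mem (B.mul_mem ha (hrp hlo q)) (max0 hlo))
      (fun x => mul_nonneg (mul_nonneg (a0 x) (rpow_nonneg (hl0 x) _)) (le_max_left _ _))
      (k := fun _ => 1) (IsTame.const_mem 1) (h := fun j x => b j x * max 0 (lo x) ^ (p j : ℝ))
      (fun j => B.mul_mem (hb j) (hrp hlo _))
    refine LogClass.of_two hB sT (T := {x | x ∈ S ∧ 0 < lo x ∧ 2 * lo x < hi x})
      (SA.and hS ((SA.lt hz hlo).and (SA.lt h2lo hhi))) he₁ he₂ hC₁ hC₂ c₁ ?_ (zero0 hq.le)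
    intro x hx
    rw [if_pos hx.1]
    refine (congrArg (Cmp _ _) ?_).mp
      (k₂ (a x) (fun j => b j x) (lo x) (hi x) (a0 x) hx.2.1 hx.2.2)
    rw [max_eq_right hx.2.1.le, posLog_one]
    unfold logMonomial
    ring
  · have hq' : (q : ℝ) = -1 := by linarith
    obtain ⟨C₂, hC₂, k₂⟩ := lintegral_long_zero (d := d) (fun j => (p j : ℝ)) hK
    have m1 : ∀ {f : X → ℝ}, f ∈ B → (fun x => max 1 |f x|) ∈ B :=
      fun hf => hB.max_mem (IsTame.const_mem 1) (hB.abs_mem hf)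
    have he₂ := logMon_mk_succ hB (d := d) (g := a) ha a0
      (k := fun x => hi x * (lo x)⁻¹) (B.mul_mem hhi (hB.inv_mem hlo))
      (h := fun j x => max 1 |b j x * max 0 (lo x) ^ (p j : ℝ)| *
        max 1 |b j x * max 0 (hi x) ^ (p j : ℝ)|)
      (fun j => B.mul_mem (m1 (B.mul_mem (hb j) (hrp hlo _))) (m1 (B.mul_mem (hb j) (hrp hhi _))))
    refine LogClass.of_two hB sT (T := {x | x ∈ S ∧ 0 < lo x ∧ 2 * lo x < hi x})
      (SA.and hS ((SA.lt hz hlo).and (SA.lt h2lo hhi))) he₁ he₂ hC₁ hC₂ c₁ ?_ (zero0 hq.le)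
    intro x hx
    have hxl : lo x < hi x := by linarith [hx.2.1, hx.2.2]
    rw [if_pos hx.1, hq']
    have hend : ∀ j, ∀ t ∈ Set.Icc (lo x) (hi x), 1 ≤ K * (b j x * t ^ (p j : ℝ)) := by
      intro j t ht
      rw [← closure_Ioo hxl.ne] at ht
      refine le_on_closure (f := fun _ => (1 : ℝ)) (hbK j x hx.1) continuousOn_const ?_ ht
      rw [closure_Ioo hxl.ne]
      refine continuousOn_const.mul (continuousOn_const.mul (continuousOn_id.rpow_const ?_))
      exact fun t ht => Or.inl (hx.2.1.trans_le ht.1).ne'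
    refine (congrArg (Cmp _ _) ?_).mp
      (k₂ (a x) (fun j => b j x) (lo x) (hi x) (a0 x) hx.2.1 hx.2.2 fun j =>
        ⟨hend j _ ⟨le_rfl, hxl.le⟩, hend j _ ⟨hxl.le, le_rfl⟩⟩)
    simp only [posLog_max_mul_max]
    rw [max_eq_right hx.2.1.le, max_eq_right (hx.2.1.trans hxl).le, div_eq_mul_inv]
  · obtain ⟨C₂, hC₂, k₂⟩ := lintegral_long_pos (d := d) hq (fun j => (p j : ℝ))
    have he₂ := logMon_mk_succ hB (d := d) (g := fun x => a x * max 0 (hi x) ^ (q : ℝ) *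
        max 0 (hi x)) (B.mul_mem (B.mul_mem ha (hrp hhi q)) (max0 hhi))
      (fun x => mul_nonneg (mul_nonneg (a0 x) (rpow_nonneg (hx0 x) _)) (le_max_left _ _))
      (k := fun _ => 1) (IsTame.const_mem 1) (h := fun j x => b j x * max 0 (hi x) ^ (p j : ℝ))
      (fun j => B.mul_mem (hb j) (hrp hhi _))
    refine LogClass.of_two hB sT (T := {x | x ∈ S ∧ 2 * lo x < hi x})
      (SA.and hS (SA.lt h2lo hhi)) he₁ he₂ hC₁ hC₂ c₁ ?_ ?_
    · intro x hx
      have := lo0 x hx.1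
      rw [if_pos hx.1]
      refine (congrArg (Cmp _ _) ?_).mp
        (k₂ (a x) (fun j => b j x) (lo x) (hi x) (a0 x) (lo0 x hx.1) hx.2)
      rw [max_eq_right (by linarith [hx.2] : 0 ≤ hi x), posLog_one]
      unfold logMonomial
      ring
    · intro x h1 h2
      split_ifs with hx
      · refine hzero x hx ?_ _
        by_contra h3
        rcases le_or_gt (hi x) (2 * lo x) with h4 | h4
        · exact h1 ⟨hx, not_le.1 h3, h4⟩
        · exact h2 ⟨hx, h4⟩
      · rfl

end Semialg

namespace Semialg
open Real

variable {X : Type} {B : Subalgebra ℝ (X → ℝ)}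

lemma one_add_posLog_le {u v K : ℝ} (hu : 0 ≤ u) (h : u ≤ K * v) :
    1 + log⁺ u ≤ (1 + log⁺ K) * (1 + log⁺ v) := by
  have := posLog_le_posLog hu h
  linarith [one_add_posLog_mul K v]

lemma one_add_posLog_prod_le {d : ℕ} {u v : Fin d → ℝ} {K g g' : ℝ} (hK : 1 ≤ K)
    (hu : ∀ j, 0 ≤ u j) (h : ∀ j, u j ≤ K * v j) (hg' : 0 ≤ g') (hg : g ≤ K * g') :
    g * ∏ j, (1 + log⁺ (u j)) ≤
      K * (1 + log⁺ K) ^ d * (g' * ∏ j, (1 + log⁺ (v j))) := by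
  have h1 := Finset.prod_le_prod (s := Finset.univ) (fun j _ => (one_add_posLog_pos (u j)).le)
    fun j _ => one_add_posLog_le (hu j) (h j)
  rw [Finset.prod_mul_distrib, Finset.prod_const, Finset.card_univ, Fintype.card_fin] at h1
  have h2 : 0 ≤ ∏ j, (1 + log⁺ (u j)) := Finset.prod_nonneg fun _ _ => (one_add_posLog_pos _).le
  calc _ ≤ (K * g') * ((1 + log⁺ K) ^ d * ∏ j, (1 + log⁺ (v j))) := by gcongr
    _ = _ := by ring

namespace Cell

lemma logClass_lintegral (hB : IsTame B) {d : ℕ} {c : Cell B} {g : X × ℝ → ℝ}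
    {h : Fin d → X × ℝ → ℝ} (hg : c.Prep g) (hh : ∀ j, c.Prep (h j)) (g0 : ∀ w, 0 ≤ g w)
    (h1 : ∀ j w, 1 ≤ h j w)
    (hfin : ∀ x, ∫⁻ t in {t | c.Mem x t},
      ENNReal.ofReal (g (x, c.θ x + c.σ * t) * ∏ j, (1 + log⁺ (h j (x, c.θ x + c.σ * t)))) < ⊤) :
    LogClass B (d + 1) fun x => ∫⁻ t in {t | c.Mem x t},
      ENNReal.ofReal (g (x, c.θ x + c.σ * t) * ∏ j, (1 + log⁺ (h j (x, c.θ x + c.σ * t)))) := by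
  obtain ⟨a, ha, a0, q, C, hC, hac⟩ := hg
  choose b hb b0 p D hD hbc using hh
  set K := C + ∑ j, D j with hK
  have hD0 : ∀ j ∈ Finset.univ, 0 ≤ D j := fun j _ => by linarith [hD j]
  have hK1 : 1 ≤ K := by linarith [Finset.sum_nonneg hD0]
  have hCK : C ≤ K := by linarith [Finset.sum_nonneg hD0]
  have hDK : ∀ j, D j ≤ K := fun j => by linarith [Finset.single_le_sum hD0 (Finset.mem_univ j)]
  set M := K * (1 + log⁺ K) ^ d with hM
  have hM1 : 1 ≤ M := one_le_mul_of_one_le_of_one_le hK1 (one_le_pow₀ (one_le_one_add_posLog _))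
  set E : X → ℝ → ℝ := fun x t =>
    g (x, c.θ x + c.σ * t) * ∏ j, (1 + log⁺ (h j (x, c.θ x + c.σ * t))) with hE
  set W : X → ℝ → ℝ := fun x => logMonomial (a x) q (fun j => b j x) (fun j => p j) with hW
  have cmp : ∀ x t, c.Mem x t → E x t ≤ M * W x t ∧ W x t ≤ M * E x t ∧
      ∀ j, 1 ≤ K * (b j x * t ^ (p j : ℝ)) := by
    intro x t ht
    have ht0 := Mem.pos ht
    obtain ⟨e1, e2⟩ := hac x t ht
    have f := fun j => hbc j x t ht
    rw [abs_of_nonneg (g0 _)] at e1 e2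
    have at0 : 0 ≤ a x * t ^ (q : ℝ) := mul_nonneg (a0 x) (rpow_nonneg ht0.le _)
    have bt0 : ∀ j, 0 ≤ b j x * t ^ (p j : ℝ) := fun j =>
      mul_nonneg (b0 j x) (rpow_nonneg ht0.le _)
    have hh0 : ∀ j, 0 ≤ h j (x, c.θ x + c.σ * t) := fun j => by linarith [h1 j (x, c.θ x + c.σ * t)]
    have f1 : ∀ j, b j x * t ^ (p j : ℝ) ≤ K * h j (x, c.θ x + c.σ * t) := fun j => by
      have := (f j).1
      rw [abs_of_nonneg (hh0 j)] at this
      exact this.trans (mul_le_mul_of_nonneg_right (hDK j) (hh0 j))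
    have f2 : ∀ j, h j (x, c.θ x + c.σ * t) ≤ K * (b j x * t ^ (p j : ℝ)) := fun j => by
      have := (f j).2
      rw [abs_of_nonneg (hh0 j)] at this
      exact this.trans (mul_le_mul_of_nonneg_right (hDK j) (bt0 j))
    exact ⟨one_add_posLog_prod_le hK1 hh0 f2 at0
        (e2.trans (mul_le_mul_of_nonneg_right hCK at0)),
      one_add_posLog_prod_le hK1 bt0 f1 (g0 _)
        (e1.trans (mul_le_mul_of_nonneg_right hCK (g0 _))),
      fun j => (h1 j _).trans (f2 j)⟩
  have hset : ∀ x ∈ c.S, {t | c.Mem x t} = Set.Ioo (c.lo x) (c.hi x) := fun x hx => by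
    ext t
    exact ⟨fun h => h.2, fun h => ⟨hx, h⟩⟩
  have le1 : ∀ x ∈ c.S, ∫⁻ t in Set.Ioo (c.lo x) (c.hi x), ENNReal.ofReal (E x t) ≤
      ENNReal.ofReal M * ∫⁻ t in Set.Ioo (c.lo x) (c.hi x), ENNReal.ofReal (W x t) := by
    intro x hx
    rw [← lintegral_const_mul' _ _ ENNReal.ofReal_ne_top]
    refine setLIntegral_mono' measurableSet_Ioo fun t ht => ?_
    rw [← ENNReal.ofReal_mul (by linarith)]
    exact ENNReal.ofReal_le_ofReal (cmp x t ⟨hx, ht⟩).1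
  have le2 : ∀ x ∈ c.S, ∫⁻ t in Set.Ioo (c.lo x) (c.hi x), ENNReal.ofReal (W x t) ≤
      ENNReal.ofReal M * ∫⁻ t in Set.Ioo (c.lo x) (c.hi x), ENNReal.ofReal (E x t) := by
    intro x hx
    rw [← lintegral_const_mul' _ _ ENNReal.ofReal_ne_top]
    refine setLIntegral_mono' measurableSet_Ioo fun t ht => ?_
    rw [← ENNReal.ofReal_mul (by linarith)]
    exact ENNReal.ofReal_le_ofReal (cmp x t ⟨hx, ht⟩).2.1
  refine (logClass_lintegral_logMonomial hB c.hS c.hlo c.hhi ha c.lo_nonneg a0 hb q p hK1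
    (fun j x hx t ht => (cmp x t ⟨hx, ht⟩).2.2 j) fun x hx => ?_).congr hM1
      (fun x => ?_) fun x => ?_
  · refine (le2 x hx).trans_lt (ENNReal.mul_lt_top ENNReal.ofReal_lt_top ?_)
    rw [← hset x hx]
    exact hfin x
  · split_ifs with hx
    · rw [hset x hx]
      exact le2 x hx
    · exact zero_le
  · split_ifs with hx
    · rw [hset x hx]
      exact le1 x hx
    · have : {t | c.Mem x t} = ∅ := Set.eq_empty_of_forall_notMem fun t ht => hx ht.1
      rw [this]
      simp

lemma setLIntegral_comp (c : Cell B) (x : X) (s : Set ℝ) (f : ℝ → ENNReal) :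
    ∫⁻ t in s, f (c.θ x + c.σ * t) = ∫⁻ y in (fun t => c.θ x + c.σ * t) '' s, f y := by
  rcases abs_eq zero_le_one |>.1 c.hσ with h | h
  · simp only [h, one_mul]
    exact (measurePreserving_add_left volume (c.θ x)).setLIntegral_comp_emb
      (measurableEmbedding_addLeft _) f s
  · simp only [h, neg_one_mul, ← sub_eq_add_neg]
    exact (Measure.measurePreserving_sub_left volume (c.θ x)).setLIntegral_comp_emb
      (measurableEmbedding_subLeft _) f s

lemma InBox.lintegral_le {c : Cell B} (hc : c.InBox) (x : X) (f : ℝ → ENNReal) :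
    ∫⁻ t in {t | c.Mem x t}, f (c.θ x + c.σ * t) ≤ ∫⁻ y in Set.Ioo (-1) 1, f y := by
  rw [setLIntegral_comp]
  refine lintegral_mono_set ?_
  rintro _ ⟨t, ht, rfl⟩
  exact hc x t ht

lemma Covering.lintegral_le {L : Finset (Cell B)} (hL : Covering L) (x : X) (f : ℝ → ENNReal) :
    ∫⁻ y in Set.Ioo (-1) 1, f y ≤ ∑ c ∈ L, ∫⁻ t in {t | c.Mem x t}, f (c.θ x + c.σ * t) := by
  simp_rw [setLIntegral_comp]
  set N := {y | y ∈ Set.Ioo (-1:ℝ) 1 ∧ ∀ c ∈ L, ∀ t, c.Mem x t → y ≠ c.θ x + c.σ * t} with hN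
  have hN0 : volume N = 0 := (hL x).measure_zero _
  calc _ ≤ ∫⁻ y in (⋃ c : L, (fun t => (c : Cell B).θ x + (c : Cell B).σ * t) ''
          {t | (c : Cell B).Mem x t}) ∪ N, f y := by
        refine lintegral_mono_set fun y hy => ?_
        by_cases h : y ∈ N
        · exact Or.inr h
        · refine Or.inl ?_
          have h' : ¬ ∀ c ∈ L, ∀ t, c.Mem x t → y ≠ c.θ x + c.σ * t := fun h' => h ⟨hy, h'⟩
          push Not at h'
          obtain ⟨c, hc, t, ht, rfl⟩ := h'
          exact Set.mem_iUnion.2 ⟨⟨c, hc⟩, t, ht, rfl⟩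
    _ ≤ _ := lintegral_union_le _ _ _
    _ ≤ ∑' c : L, (∫⁻ y in (fun t => (c : Cell B).θ x + (c : Cell B).σ * t) ''
          {t | (c : Cell B).Mem x t}, f y) + 0 := by
        rw [setLIntegral_measure_zero _ _ hN0]
        exact add_le_add (lintegral_iUnion_le _ _) le_rfl
    _ = _ := by
        rw [add_zero, tsum_fintype]
        exact Finset.sum_coe_sort L fun c => ∫⁻ y in (fun t => c.θ x + c.σ * t) ''
          {t | c.Mem x t}, f y

end Cell

theorem logClass_lintegral_logMon (hB : IsTame B) {d : ℕ} {E : X × ℝ → ℝ}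
    (hE : E ∈ logMon (tameClosure (polyAlg B)) d)
    (hfin : ∀ x, ∫⁻ y in Set.Ioo (-1) 1, ENNReal.ofReal (E (x, y)) < ⊤) :
    LogClass B (d + 1) fun x => ∫⁻ y in Set.Ioo (-1) 1, ENNReal.ofReal (E (x, y)) := by
  obtain ⟨g, hg, g0, h, hh, rfl⟩ := hE
  obtain ⟨L, hL, hcov⟩ := Cell.exists_prepared_covering hB
    (insert g (Finset.univ.image h)) (by
      intro f hf
      simp only [Finset.mem_insert, Finset.mem_image, Finset.mem_univ, true_and] at hf
      rcases hf with rfl | ⟨j, rfl⟩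
      · exact hg
      · exact (hh j).1)
  set F : X → ℝ → ENNReal := fun x y =>
    ENNReal.ofReal (g (x, y) * ∏ j, (1 + log⁺ (h j (x, y)))) with hF
  have key := LogClass.sum L (d := d + 1) (B := B)
    (G := fun c x => ∫⁻ t in {t | c.Mem x t}, F x (c.θ x + c.σ * t)) fun c hc =>
    Cell.logClass_lintegral hB ((hL c hc).2 g (by simp)) (fun j => (hL c hc).2 (h j) (by simp)) g0
      (fun j => (hh j).2) fun x => ((hL c hc).1.lintegral_le x (F x)).trans_lt (hfin x)
  refine key.congr (K := (L.card : ℝ) + 1) (by linarith [(Nat.cast_nonneg L.card : (0 : ℝ) ≤ _)])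
    (fun x => ?_) fun x => ?_
  · calc _ ≤ ∑ c ∈ L, ∫⁻ y in Set.Ioo (-1) 1, F x y :=
          Finset.sum_le_sum fun c hc => (hL c hc).1.lintegral_le x (F x)
      _ = (L.card : ENNReal) * ∫⁻ y in Set.Ioo (-1) 1, F x y := by
          rw [Finset.sum_const, nsmul_eq_mul]
      _ ≤ _ := by
          gcongr
          rw [← ENNReal.ofReal_natCast]
          exact ENNReal.ofReal_le_ofReal (by linarith)
  · refine (hcov.lintegral_le x (F x)).trans (le_mul_of_one_le_left zero_le ?_)
    rw [ENNReal.one_le_ofReal]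
    linarith [(Nat.cast_nonneg L.card : (0 : ℝ) ≤ _)]

end Semialg

namespace Semialg
open Real

variable {X : Type} {B : Subalgebra ℝ (X → ℝ)}

lemma measurable_section {f : X × ℝ → ℝ} (hf : f ∈ tameClosure (polyAlg B)) (x : X) :
    Measurable fun y => f (x, y) := by
  refine Tame.measurable (A := evalAlg (fun _ => x) B id) ?_
    (Tame.pullback (hf : Tame _ f) (fun y : ℝ => (x, y)) ?_)
  · rintro _ ⟨p, rfl⟩
    exact (spec p x).continuous.measurable
  · rintro _ ⟨p, rfl⟩
    exact ⟨p, rfl⟩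

lemma measurable_posLog : Measurable (log⁺ : ℝ → ℝ) :=
  (measurable_const.max measurable_log : Measurable fun x => max 0 (log x))

lemma measurable_section_logSum {d : ℕ} {E : X × ℝ → ℝ}
    (hE : E ∈ logSum (tameClosure (polyAlg B)) d) (x : X) : Measurable fun y => E (x, y) := by
  induction hE using AddSubmonoid.closure_induction with
  | mem e he =>
    obtain ⟨g, hg, -, h, hh, rfl⟩ := he
    exact (measurable_section hg x).mul (Finset.measurable_prod _ fun j _ =>
      measurable_const.add (measurable_posLog.comp (measurable_section (hh j).1 x)))
  | zero => exact measurable_const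
  | add e e' _ _ h h' => exact h.add h'

lemma logClass_lintegral_logSum (hB : IsTame B) {d : ℕ} {E : X × ℝ → ℝ}
    (hE : E ∈ logSum (tameClosure (polyAlg B)) d)
    (hfin : ∀ x, ∫⁻ y in Set.Ioo (-1) 1, ENNReal.ofReal (E (x, y)) < ⊤) :
    LogClass B (d + 1) fun x => ∫⁻ y in Set.Ioo (-1) 1, ENNReal.ofReal (E (x, y)) := by
  induction hE using AddSubmonoid.closure_induction with
  | mem e he => exact logClass_lintegral_logMon hB he hfin
  | zero => simpa using LogClass.zero
  | add e e' he he' h h' =>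
    have e0 := logSum_nonneg he
    have e0' := logSum_nonneg he'
    have key : ∀ x, ∫⁻ y in Set.Ioo (-1) 1, ENNReal.ofReal ((e + e') (x, y)) =
        (∫⁻ y in Set.Ioo (-1) 1, ENNReal.ofReal (e (x, y))) +
          ∫⁻ y in Set.Ioo (-1) 1, ENNReal.ofReal (e' (x, y)) := fun x => by
      rw [← lintegral_add_left (measurable_section_logSum he x).ennreal_ofReal]
      simp only [Pi.add_apply, ENNReal.ofReal_add (e0 _) (e0' _)]
    simp only [key] at hfin ⊢
    exact (h fun x => (ENNReal.add_lt_top.1 (hfin x)).1).add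
      (h' fun x => (ENNReal.add_lt_top.1 (hfin x)).2)

namespace LogClass

theorem lintegral (hB : IsTame B) {d : ℕ} {G : X × ℝ → ENNReal}
    (hG : LogClass (tameClosure (polyAlg B)) d G)
    (hfin : ∀ x, ∫⁻ y in Set.Ioo (-1) 1, G (x, y) < ⊤) :
    LogClass B (d + 1) fun x => ∫⁻ y in Set.Ioo (-1) 1, G (x, y) := by
  obtain ⟨E, hE, C, hC, h⟩ := hG
  have k1 : ∀ x, ∫⁻ y in Set.Ioo (-1) 1, ENNReal.ofReal (E (x, y)) ≤
      ENNReal.ofReal C * ∫⁻ y in Set.Ioo (-1) 1, G (x, y) := fun x => by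
    rw [← lintegral_const_mul' _ _ ENNReal.ofReal_ne_top]
    exact lintegral_mono fun y => (h (x, y)).1
  refine (logClass_lintegral_logSum hB hE fun x => (k1 x).trans_lt
    (ENNReal.mul_lt_top ENNReal.ofReal_lt_top (hfin x))).congr hC k1 fun x => ?_
  rw [← lintegral_const_mul' _ _ ENNReal.ofReal_ne_top]
  refine lintegral_mono fun y => (h (x, y)).2.trans ?_
  rw [ENNReal.ofReal_mul (by linarith)]

theorem lintegral_const (hB : IsTame B) {d : ℕ} {G : X × ℝ → ENNReal}
    (hG : LogClass (tameClosure (polyAlg B)) d G) (hc : ∀ x y y', G (x, y) = G (x, y')) :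
    LogClass B d fun x => ∫⁻ y in Set.Ioo (-1) 1, G (x, y) := by
  have key : ∀ x, ∫⁻ y in Set.Ioo (-1) 1, G (x, y) = G (x, 0) * ENNReal.ofReal 2 := fun x => by
    simp_rw [hc x _ 0]
    rw [setLIntegral_const, Real.volume_Ioo]
    norm_num
  refine (hG.comap (D := B) (φ := fun x => (x, 0)) fun f hf => hB _ (Tame.pullback hf _ ?_)).congr
    one_le_two (fun x => ?_) fun x => ?_
  · rintro _ ⟨p, rfl⟩
    exact eval_mem id (fun _ h => h) B.zero_mem p
  · rw [key]
    calc G (x, 0) ≤ G (x, 0) * (ENNReal.ofReal 2 * ENNReal.ofReal 2) := by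
          refine le_mul_of_one_le_right zero_le ?_
          norm_num
      _ = _ := by ring
  · rw [key, mul_comm]

end LogClass

/-- The tame functions of a point of `X` and of `n` real variables. -/
def mvAlg (B : Subalgebra ℝ (X → ℝ)) (n : ℕ) : Subalgebra ℝ (X × (Fin n → ℝ) → ℝ) :=
  tameClosure (Algebra.adjoin ℝ ({f | ∃ b ∈ B, f = fun w => b w.1} ∪
    Set.range fun j w => w.2 j))

lemma base_mem_mvAlg {n : ℕ} {b : X → ℝ} (hb : b ∈ B) : (fun w => b w.1) ∈ mvAlg B n :=
  le_tameClosure (Algebra.subset_adjoin (Or.inl ⟨b, hb, rfl⟩))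

lemma coord_mem_mvAlg {n : ℕ} (j : Fin n) : (fun w => w.2 j) ∈ mvAlg B n :=
  le_tameClosure (Algebra.subset_adjoin (Or.inr ⟨j, rfl⟩))

lemma mvAlg_comap {Y : Type} {D : Subalgebra ℝ (Y → ℝ)} (hD : IsTame D) {n : ℕ}
    {φ : Y → X × (Fin n → ℝ)} (h1 : ∀ b ∈ B, (fun y => b (φ y).1) ∈ D)
    (h2 : ∀ j, (fun y => (φ y).2 j) ∈ D) : ∀ f ∈ mvAlg B n, f ∘ φ ∈ D := by
  intro f hf
  refine hD _ (Tame.pullback (hf : Tame _ f) φ fun a ha => ?_)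
  induction ha using Algebra.adjoin_induction with
  | mem a ha =>
    rcases ha with ⟨b, hb, rfl⟩ | ⟨j, rfl⟩
    · exact h1 b hb
    · exact h2 j
  | algebraMap r => exact D.algebraMap_mem r
  | add a b _ _ h h' => exact D.add_mem h h'
  | mul _ _ _ _ h₁ h₂ => exact D.mul_mem h₁ h₂

/-- The open cube. -/
def cube (n : ℕ) : Set (Fin n → ℝ) := Set.univ.pi fun _ => Set.Ioo (-1) 1

lemma measurableSet_cube (n : ℕ) : MeasurableSet (cube n) :=
  MeasurableSet.univ_pi fun _ => measurableSet_Ioo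

lemma volume_cube_lt_top (n : ℕ) : volume (cube n) < ⊤ := by
  rw [cube, volume_pi_pi]
  exact ENNReal.prod_lt_top fun _ _ => by simp

lemma lintegral_cube_succ {n : ℕ} {f : (Fin (n + 1) → ℝ) → ENNReal} (hf : Measurable f) :
    ∫⁻ y in cube (n + 1), f y =
      ∫⁻ t in Set.Ioo (-1) 1, ∫⁻ z in cube n, f (Fin.cons t z) := by
  have e := (volume_preserving_piFinSuccAbove (fun _ : Fin (n + 1) => ℝ) 0).symm
  rw [← e.setLIntegral_comp_preimage (measurableSet_cube _) hf]
  have hs : (MeasurableEquiv.piFinSuccAbove (fun _ : Fin (n + 1) => ℝ) 0).symm ⁻¹' cube (n + 1) =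
      Set.Ioo (-1) 1 ×ˢ cube n := by
    ext ⟨t, z⟩
    simp [cube, Fin.forall_fin_succ, MeasurableEquiv.piFinSuccAbove]
  rw [hs, Measure.volume_eq_prod, ← Measure.prod_restrict, lintegral_prod]
  · simp [MeasurableEquiv.piFinSuccAbove]
    rfl
  · exact (hf.comp e.measurable).aemeasurable

/-- Dependence on a coordinate. -/
def DependsOn {n : ℕ} (G : X → (Fin n → ℝ) → ENNReal) (j : Fin n) : Prop :=
  ∃ x y y', (∀ k, k ≠ j → y k = y' k) ∧ G x y ≠ G x y'

theorem logClass_lintegral_cube (n : ℕ) : ∀ {X : Type} {B : Subalgebra ℝ (X → ℝ)}, IsTame B →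
    ∀ {G : X → (Fin n → ℝ) → ENNReal} {d : ℕ}, LogClass (mvAlg B n) d (fun w => G w.1 w.2) →
    (∀ x, Measurable (G x)) → (∀ x, ∃ M : ENNReal, M < ⊤ ∧ ∀ y, G x y ≤ M) →
    LogClass B (d + (Finset.univ.filter (DependsOn G)).card) fun x => ∫⁻ y in cube n, G x y := by
  induction n with
  | zero =>
    intro X B hB G d hG _ _
    have h := hG.comap (D := B) (φ := fun x => (x, 0))
      (mvAlg_comap hB (fun b hb => hb) fun j => j.elim0)
    refine LogClass.mono hB (Nat.le_add_right _ _) ?_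
    convert h using 2 with x
    have : ∀ y, G x y = G x 0 := fun y => congrArg _ (Subsingleton.elim _ _)
    simp_rw [this]
    rw [setLIntegral_const, cube, volume_pi_pi]
    simp
  | succ n ih =>
    intro X B hB G d hG hm hM
    have hB' := isTame_tameClosure (polyAlg B)
    set G' : X × ℝ → (Fin n → ℝ) → ENNReal := fun w z => G w.1 (Fin.cons w.2 z) with hG'
    have hcons : ∀ t : ℝ, Measurable fun z : Fin n → ℝ => (Fin.cons t z : Fin (n + 1) → ℝ) :=
      fun t => measurable_pi_lambda _ fun j => by
        refine Fin.cases ?_ (fun j => ?_) j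
        · exact measurable_const
        · exact measurable_pi_apply j
    have h1 : LogClass (mvAlg (tameClosure (polyAlg B)) n) d (fun w => G' w.1 w.2) := by
      refine hG.comap (φ := fun w : (X × ℝ) × (Fin n → ℝ) => (w.1.1, Fin.cons w.1.2 w.2))
        (mvAlg_comap (isTame_tameClosure _) (fun b hb => ?_) fun j => ?_)
      · exact base_mem_mvAlg (le_tameClosure (evalAlg_base Prod.fst B Prod.snd hb))
      · refine Fin.cases ?_ (fun j => ?_) j
        · exact base_mem_mvAlg (le_tameClosure (evalAlg_self Prod.fst B Prod.snd))
        · exact coord_mem_mvAlg j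
    have h2 := ih hB' h1 (fun w => (hm w.1).comp (hcons w.2)) fun w => by
      obtain ⟨M, hM, h⟩ := hM w.1
      exact ⟨M, hM, fun z => h _⟩
    have hsub : (Finset.univ.filter (DependsOn G')).card ≤
        (Finset.univ.filter fun j : Fin n => DependsOn G j.succ).card := by
      refine Finset.card_le_card fun j hj => ?_
      simp only [Finset.mem_filter, Finset.mem_univ, true_and] at hj ⊢
      obtain ⟨w, z, z', h, hne⟩ := hj
      refine ⟨w.1, _, _, fun k hk => ?_, hne⟩
      induction k using Fin.cases with
      | zero => rfl
      | succ k => exact h k fun e => hk (by rw [e])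
    have h3 := h2.mono hB' (Nat.add_le_add_left hsub d)
    simp_rw [fun x => lintegral_cube_succ (hm x)]
    rw [Fin.card_filter_univ_succ]
    by_cases h0 : DependsOn G 0
    · rw [if_pos h0, ← add_assoc]
      refine h3.lintegral hB fun x => ?_
      obtain ⟨M, hM, h⟩ := hM x
      have hc : volume (Set.Ioo (-1 : ℝ) 1) < ⊤ := measure_Ioo_lt_top
      calc _ ≤ ∫⁻ t in Set.Ioo (-1 : ℝ) 1, ∫⁻ z in cube n, M :=
            lintegral_mono fun t => lintegral_mono fun z => h _
        _ = M * volume (cube n) * volume (Set.Ioo (-1 : ℝ) 1) := by simp only [setLIntegral_const]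
        _ < ⊤ := ENNReal.mul_lt_top (ENNReal.mul_lt_top hM (volume_cube_lt_top n)) hc
    · rw [if_neg h0]
      refine h3.lintegral_const hB fun x y y' => ?_
      refine lintegral_congr fun z => ?_
      by_contra hne
      refine h0 ⟨x, _, _, fun k hk => ?_, hne⟩
      induction k using Fin.cases with
      | zero => exact absurd rfl hk
      | succ k => rfl

end Semialg

namespace Semialg
open Real Filter Asymptotics Topology

/-- The tame functions of one real variable. -/
def lineAlg : Subalgebra ℝ (ℝ → ℝ) := tameClosure (Algebra.adjoin ℝ {id})

lemma rpow_bounds {m M t : ℝ} (hm : 0 < m) (h1 : m ≤ t) (h2 : t ≤ M) (q : ℝ) :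
    min (m ^ q) (M ^ q) ≤ t ^ q ∧ t ^ q ≤ max (m ^ q) (M ^ q) := by
  have ht : 0 < t := hm.trans_le h1
  rcases le_total 0 q with h | h
  · exact ⟨min_le_of_left_le (rpow_le_rpow hm.le h1 h),
      le_max_of_le_right (rpow_le_rpow ht.le h2 h)⟩
  · exact ⟨min_le_of_right_le (rpow_le_rpow_of_nonpos ht h2 h),
      le_max_of_le_left (rpow_le_rpow_of_nonpos hm h1 h)⟩

lemma exists_germ_cell {L : Finset (Cell (⊤ : Subalgebra ℝ (Unit → ℝ)))} (hL : Cell.Covering L) :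
    ∃ c ∈ L, ∀ᶠ y in 𝓝[>] (0 : ℝ), ∃ t, c.Mem () t ∧ y = c.θ () + c.σ * t := by
  have h1 : ∀ᶠ y in 𝓝[>] (0 : ℝ), ∃ c ∈ L, ∃ t, c.Mem () t ∧ y = c.θ () + c.σ * t := by
    have h3 : ∀ᶠ y in 𝓝[>] (0 : ℝ), y ∉ {y | y ∈ Set.Ioo (-1 : ℝ) 1 ∧
        ∀ c ∈ L, ∀ t, c.Mem () t → y ≠ c.θ () + c.σ * t} := by
      have h4 := ((hL ()).subset Set.sdiff_subset (t := _ \ {0})).isClosed.isOpen_compl.mem_nhds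
        (x := (0 : ℝ)) (by simp)
      filter_upwards [mem_nhdsWithin_of_mem_nhds h4, self_mem_nhdsWithin] with y hy hy0 hy1
      exact hy ⟨hy1, (ne_of_gt hy0 : y ≠ 0)⟩
    filter_upwards [h3, Ioo_mem_nhdsGT one_pos] with y hy hy1
    by_contra! h
    exact hy ⟨⟨by linarith [hy1.1], hy1.2⟩, h⟩
  obtain ⟨c, hc, hf⟩ : ∃ c ∈ L, ∃ᶠ y in 𝓝[>] (0 : ℝ), ∃ t, c.Mem () t ∧ y = c.θ () + c.σ * t := by
    by_contra! h
    obtain ⟨y, hy, c, hc, t, ht, e⟩ := ((eventually_all_finset L).2 h |>.and h1).exists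
    exact hy c hc t ht e
  refine ⟨c, hc, ?_⟩
  obtain ⟨ε, ⟨s, hs, hε⟩, hε0⟩ := (hf.and_eventually self_mem_nhdsWithin).exists
  filter_upwards [Ioo_mem_nhdsGT (hε0 : 0 < ε)] with y hy
  obtain ⟨z, ⟨u, hu, hz⟩, hz0⟩ := (hf.and_eventually (Ioo_mem_nhdsGT hy.1)).exists
  refine ⟨c.σ * (y - c.θ ()), ⟨hs.1, ?_⟩, ?_⟩
  · have a1 := hy.2
    have a2 := hz0.2
    rcases abs_eq zero_le_one |>.1 c.hσ with h | h <;> rw [h] at hε hz ⊢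
    · exact ⟨by linarith [hu.2.1], by linarith [hs.2.2]⟩
    · exact ⟨by linarith [hs.2.1], by linarith [hu.2.2]⟩
  · rcases abs_eq zero_le_one |>.1 c.hσ with h | h <;> rw [h] <;> ring

lemma lineAlg_isTheta {f : ℝ → ℝ} (hf : f ∈ lineAlg) :
    f =Θ[𝓝[>] 0] (0 : ℝ → ℝ) ∨ ∃ q : ℚ, f =Θ[𝓝[>] 0] fun y => y ^ (q : ℝ) := by
  have hB : Semialg.IsTame (⊤ : Subalgebra ℝ (Unit → ℝ)) := fun f _ => Algebra.mem_top
  have hf' : f ∘ Prod.snd ∈ tameClosure (polyAlg (⊤ : Subalgebra ℝ (Unit → ℝ))) := by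
    refine isTame_tameClosure _ _ (Tame.pullback (hf : Tame _ f) _ fun a ha => le_tameClosure ?_)
    induction ha using Algebra.adjoin_induction with
    | mem a ha =>
      rw [Set.mem_singleton_iff.1 ha]
      exact evalAlg_self _ _ _
    | algebraMap r => exact algebraMap_mem _ r
    | add a b _ _ h h' => exact add_mem h h'
    | mul a b _ _ h h' => exact mul_mem h h'
  obtain ⟨L, hL, hcov⟩ := Cell.exists_prepared_covering hB {f ∘ Prod.snd} (by simpa using hf')
  obtain ⟨c, hc, hmem⟩ := exists_germ_cell hcov
  obtain ⟨a, -, a0, q, C, hC, h⟩ := (hL c hc).2 _ (Finset.mem_singleton_self _)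
  have key : ∀ᶠ y in 𝓝[>] (0 : ℝ), ∃ t, 0 < t ∧ y = c.θ () + c.σ * t ∧
      a () * t ^ (q : ℝ) ≤ C * |f y| ∧ |f y| ≤ C * (a () * t ^ (q : ℝ)) := by
    filter_upwards [hmem] with y ⟨t, ht, e⟩
    refine ⟨t, ht.pos, e, ?_⟩
    have := h () t ht
    rw [← e] at this
    exact this
  rcases (a0 ()).eq_or_lt' with ha | ha
  · refine Or.inl (isTheta_zero_right.2 ?_)
    filter_upwards [key] with y ⟨t, _, _, _, h2⟩
    rw [ha] at h2
    simpa using h2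
  refine Or.inr ?_
  by_cases hθ : c.θ () = 0
  · refine ⟨q, ?_, ?_⟩
    · refine IsBigO.of_bound (C * a ()) ?_
      filter_upwards [key, self_mem_nhdsWithin] with y ⟨t, ht, e, h1, h2⟩ (hy : 0 < y)
      have hyt : y = t := by
        rw [hθ, zero_add] at e
        rcases abs_eq zero_le_one |>.1 c.hσ with h | h <;> rw [h] at e <;> linarith
      subst hyt
      rw [norm_eq_abs, norm_eq_abs, abs_of_pos (rpow_pos_of_pos hy _), mul_assoc]
      exact h2
    · refine IsBigO.of_bound (C / a ()) ?_
      filter_upwards [key, self_mem_nhdsWithin] with y ⟨t, ht, e, h1, h2⟩ (hy : 0 < y)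
      have hyt : y = t := by
        rw [hθ, zero_add] at e
        rcases abs_eq zero_le_one |>.1 c.hσ with h | h <;> rw [h] at e <;> linarith
      subst hyt
      rw [norm_eq_abs, norm_eq_abs, abs_of_pos (rpow_pos_of_pos hy _), div_mul_eq_mul_div,
        le_div_iff₀ ha, mul_comm]
      exact h1
  · refine ⟨0, ?_⟩
    have hθ0 : 0 < |c.θ ()| := abs_pos.2 hθ
    set m := min ((|c.θ ()| / 2) ^ (q : ℝ)) ((2 * |c.θ ()|) ^ (q : ℝ)) with hm
    set M := max ((|c.θ ()| / 2) ^ (q : ℝ)) ((2 * |c.θ ()|) ^ (q : ℝ)) with hM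
    have hm0 : 0 < m := lt_min (by positivity) (by positivity)
    have key' : ∀ᶠ y in 𝓝[>] (0 : ℝ), a () * m ≤ C * |f y| ∧ |f y| ≤ C * (a () * M) := by
      filter_upwards [key, Ioo_mem_nhdsGT (half_pos hθ0)] with y ⟨t, ht, e, h1, h2⟩ hy
      have htt : |c.θ ()| / 2 ≤ t ∧ t ≤ 2 * |c.θ ()| := by
        have h3 := hy.2
        have h4 := hy.1
        rcases abs_eq zero_le_one |>.1 c.hσ with h | h <;> rw [h] at e <;>
          rcases abs_cases (c.θ ()) with ⟨h5, h6⟩ | ⟨h5, h6⟩ <;>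
          rw [h5] at h3 ⊢ <;> constructor <;> linarith
      obtain ⟨h3, h4⟩ := rpow_bounds (half_pos hθ0) htt.1 htt.2 q
      refine ⟨(mul_le_mul_of_nonneg_left h3 ha.le).trans h1, h2.trans ?_⟩
      gcongr
    simp only [Rat.cast_zero, rpow_zero]
    constructor
    · refine IsBigO.of_bound (C * (a () * M)) ?_
      filter_upwards [key'] with y h
      simpa using h.2
    · refine IsBigO.of_bound (C / (a () * m)) ?_
      filter_upwards [key'] with y h
      have : 0 < a () * m := mul_pos ha hm0
      rw [norm_one, norm_eq_abs, div_mul_eq_mul_div, le_div_iff₀ this, one_mul]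
      exact h.1

lemma tendsto_log_inv : Tendsto (fun y : ℝ => log y⁻¹) (𝓝[>] 0) atTop :=
  tendsto_log_atTop.comp tendsto_inv_nhdsGT_zero

lemma one_add_posLog_isTheta {h : ℝ → ℝ} (hh : h ∈ lineAlg) (h1 : ∀ y, 1 ≤ h y) :
    ∃ k ≤ 1, (fun y => 1 + log⁺ (h y)) =Θ[𝓝[>] 0] fun y => log y⁻¹ ^ k := by
  rcases lineAlg_isTheta hh with h0 | ⟨p, hup, hlow⟩
  · obtain ⟨y, hy⟩ := (isTheta_zero_right.1 h0).exists
    have := h1 y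
    rw [hy] at this
    norm_num at this
  obtain ⟨C, hC⟩ := hup.bound
  obtain ⟨D, hD⟩ := hlow.bound
  have bd : ∀ᶠ y in 𝓝[>] (0 : ℝ), (0 < y ∧ y < 1) ∧ 1 ≤ log y⁻¹ ∧ h y ≤ C * y ^ (p : ℝ) ∧
      y ^ (p : ℝ) ≤ D * h y := by
    filter_upwards [hC, hD, Ioo_mem_nhdsGT one_pos, tendsto_log_inv.eventually_ge_atTop 1] with
      y h2 h3 h4 h5
    rw [norm_of_nonneg (rpow_nonneg h4.1.le _), norm_of_nonneg (by linarith [h1 y])] at h2 h3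
    exact ⟨h4, h5, h2, h3⟩
  rcases le_or_gt 0 p with hp | hp
  · refine ⟨0, zero_le_one, ?_, ?_⟩
    · refine IsBigO.of_bound (1 + log⁺ C) ?_
      filter_upwards [bd] with y ⟨h2, h3, h4, h5⟩
      rw [norm_of_nonneg (one_add_posLog_pos _).le, pow_zero, norm_one, mul_one]
      have h6 : y ^ (p : ℝ) ≤ 1 := rpow_le_one h2.1.le h2.2.le (by exact_mod_cast hp)
      have h7 : 0 < C := (pos_iff_pos_of_mul_pos (by linarith [h1 y])).2 (rpow_pos_of_pos h2.1 p)
      have : h y ≤ C := h4.trans (mul_le_of_le_one_right h7.le h6)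
      have := posLog_le_posLog (by linarith [h1 y]) this
      linarith
    · refine IsBigO.of_bound 1 ?_
      filter_upwards with y
      rw [norm_of_nonneg (one_add_posLog_pos _).le, pow_zero, norm_one, one_mul]
      exact one_le_one_add_posLog _
  · have hp' : (p : ℝ) < 0 := by exact_mod_cast hp
    have hl : ∀ y : ℝ, 0 < y → 1 ≤ log y⁻¹ → log⁺ (y ^ (p : ℝ)) = -p * log y⁻¹ := by
      intro y h2 h3
      rw [posLog_eq_max, log_rpow h2, log_inv, max_eq_right]
      · ring
      · rw [log_inv] at h3
        nlinarith
    refine ⟨1, le_rfl, ?_, ?_⟩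
    · refine IsBigO.of_bound ((1 + log⁺ C) * (1 + -p)) ?_
      filter_upwards [bd] with y ⟨h2, h3, h4, h5⟩
      rw [norm_of_nonneg (one_add_posLog_pos _).le, pow_one, norm_of_nonneg (by linarith),
        mul_assoc]
      refine (one_add_posLog_le (by linarith [h1 y]) h4).trans ?_
      rw [hl y h2.1 h3]
      have := one_add_posLog_pos C
      gcongr
      nlinarith
    · refine IsBigO.of_bound ((1 + log⁺ D) / -p) ?_
      filter_upwards [bd] with y ⟨h2, h3, h4, h5⟩
      rw [norm_of_nonneg (one_add_posLog_pos _).le, pow_one, norm_of_nonneg (by linarith),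
        div_mul_eq_mul_div, le_div_iff₀ (by linarith)]
      have := one_add_posLog_le (rpow_nonneg h2.1.le _) h5
      rw [hl y h2.1 h3] at this
      linarith

lemma prod_isTheta {d : ℕ} {h : Fin d → ℝ → ℝ} (hh : ∀ j, h j ∈ lineAlg ∧ ∀ y, 1 ≤ h j y)
    (s : Finset (Fin d)) :
    ∃ k ≤ s.card, (fun y => ∏ j ∈ s, (1 + log⁺ (h j y))) =Θ[𝓝[>] 0] fun y => log y⁻¹ ^ k := by
  induction s using Finset.induction_on with
  | empty => exact ⟨0, le_rfl, by simp⟩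
  | insert j s hj ih =>
    obtain ⟨k, hk, e⟩ := ih
    obtain ⟨k', hk', e'⟩ := one_add_posLog_isTheta (hh j).1 (hh j).2
    refine ⟨k' + k, by rw [Finset.card_insert_of_notMem hj]; omega, ?_⟩
    simp only [Finset.prod_insert hj, pow_add]
    exact e'.mul e

lemma monomial_isBigO {q q' : ℝ} {k k' : ℕ} (h : q' < q ∨ q' = q ∧ k ≤ k') :
    (fun y : ℝ => y ^ q * log y⁻¹ ^ k) =O[𝓝[>] 0] fun y => y ^ q' * log y⁻¹ ^ k' := by
  rcases h with h | ⟨rfl, h⟩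
  · have h1 : (fun y : ℝ => y ^ q * log y⁻¹ ^ k) =O[𝓝[>] 0] fun y => y ^ q' := by
      have h2 := ((isLittleO_log_rpow_rpow_atTop (s := q - q') (k : ℝ)
        (sub_pos.2 h)).comp_tendsto tendsto_inv_nhdsGT_zero).isBigO
      refine ((isBigO_refl (fun y : ℝ => y ^ q) _).mul h2).congr' ?_ ?_
      · exact Eventually.of_forall fun y => by simp
      · filter_upwards [self_mem_nhdsWithin] with y (hy : 0 < y)
        simp only [Function.comp]
        rw [inv_rpow hy.le, ← rpow_neg hy.le, ← rpow_add hy]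
        congr 1
        ring
    refine h1.trans (IsBigO.of_bound 1 ?_)
    filter_upwards [tendsto_log_inv.eventually_ge_atTop 1] with y hy
    rw [norm_mul, one_mul]
    refine le_mul_of_one_le_right (norm_nonneg _) ?_
    rw [norm_pow]
    exact one_le_pow₀ (hy.trans (le_norm_self _))
  · refine (isBigO_refl _ _).mul (IsBigO.of_bound 1 ?_)
    filter_upwards [tendsto_log_inv.eventually_ge_atTop 1] with y hy
    rw [norm_pow, norm_pow, one_mul]
    exact pow_le_pow_right₀ (hy.trans (le_norm_self _)) h

lemma add_isTheta {l : Filter ℝ} {f f' g g' : ℝ → ℝ} (hf : ∀ y, 0 ≤ f y) (hf₁ : ∀ y, 0 ≤ f' y)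
    (h : f =Θ[l] g) (h' : f' =Θ[l] g') (hg : g' =O[l] g) : (f + f') =Θ[l] g := by
  refine ⟨h.1.add (h'.1.trans hg), h.2.trans (IsBigO.of_bound 1 ?_)⟩
  filter_upwards with y
  rw [one_mul, norm_of_nonneg (hf y), Pi.add_apply, norm_of_nonneg (add_nonneg (hf y) (hf₁ y))]
  exact le_add_of_nonneg_right (hf₁ y)

/-- The asymptotics at `0⁺` of sums of products of tame functions and logarithms. -/
theorem logSum_isTheta {d : ℕ} {E : ℝ → ℝ} (hE : E ∈ logSum lineAlg d) :
    E =Θ[𝓝[>] 0] (0 : ℝ → ℝ) ∨ ∃ q : ℚ, ∃ k ≤ d,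
      E =Θ[𝓝[>] 0] fun y => y ^ (q : ℝ) * log y⁻¹ ^ k := by
  induction hE using AddSubmonoid.closure_induction with
  | mem e he =>
    obtain ⟨g, hg, g0, h, hh, rfl⟩ := he
    obtain ⟨k, hk, e⟩ := prod_isTheta hh Finset.univ
    rw [Finset.card_univ, Fintype.card_fin] at hk
    rcases lineAlg_isTheta hg with h0 | ⟨q, h1⟩
    · refine Or.inl (isTheta_zero_right.2 ?_)
      filter_upwards [isTheta_zero_right.1 h0] with y hy
      simp [hy]
    · exact Or.inr ⟨q, k, hk, h1.mul e⟩
  | zero => exact Or.inl (isTheta_refl _ _)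
  | add e e' he he' h h' =>
    have e0 := logSum_nonneg he
    have e0' := logSum_nonneg he'
    rcases h with h | ⟨q, k, hk, h⟩
    · have : e + e' =ᶠ[𝓝[>] 0] e' := by
        filter_upwards [isTheta_zero_right.1 h] with y hy
        simp [hy]
      rcases h' with h' | ⟨q, k, hk, h'⟩
      · exact Or.inl (this.trans_isTheta h')
      · exact Or.inr ⟨q, k, hk, this.trans_isTheta h'⟩
    rcases h' with h' | ⟨q', k', hk', h'⟩
    · exact Or.inr ⟨q, k, hk, add_isTheta e0 e0' h h' (isBigO_zero _ _)⟩
    rcases lt_trichotomy q q' with hq | hq | hq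
    · exact Or.inr ⟨q, k, hk, add_isTheta e0 e0' h h'
        (monomial_isBigO (Or.inl (by exact_mod_cast hq)))⟩
    · subst hq
      rcases le_total k' k with hkk | hkk
      · exact Or.inr ⟨q, k, hk, add_isTheta e0 e0' h h' (monomial_isBigO (Or.inr ⟨rfl, hkk⟩))⟩
      · rw [add_comm]
        exact Or.inr ⟨q, k', hk', add_isTheta e0' e0 h' h (monomial_isBigO (Or.inr ⟨rfl, hkk⟩))⟩
    · rw [add_comm]
      exact Or.inr ⟨q', k', hk', add_isTheta e0' e0 h' h
        (monomial_isBigO (Or.inl (by exact_mod_cast hq)))⟩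

/-- The asymptotics at `0⁺` of a function comparable with a sum of products of tame functions and
logarithms. -/
theorem LogClass.asymptotics {d : ℕ} {G : ℝ → ENNReal} (hG : LogClass lineAlg d G)
    (hpos : ∀ y, 0 < y → G y ≠ 0) (hfin : ∀ y, 0 < y → G y ≠ ⊤) :
    ∃ Q₀ : ℚ, ∃ k ≤ d, (fun y => (G y).toReal) =Θ[𝓝[>] 0]
      fun y => y ^ (-(Q₀ : ℝ)) * log (1 / y) ^ k := by
  obtain ⟨E, hE, C, hC, h⟩ := hG
  have hE0 := logSum_nonneg hE
  have hGE : (fun y => (G y).toReal) =Θ[𝓝[>] 0] E := by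
    constructor
    · refine IsBigO.of_bound C ?_
      filter_upwards with y
      rw [norm_of_nonneg ENNReal.toReal_nonneg, norm_of_nonneg (hE0 y)]
      exact ENNReal.toReal_le_of_le_ofReal (mul_nonneg (by linarith) (hE0 y)) (h y).2
    · refine IsBigO.of_bound C ?_
      filter_upwards [self_mem_nhdsWithin] with y (hy : 0 < y)
      rw [norm_of_nonneg ENNReal.toReal_nonneg, norm_of_nonneg (hE0 y)]
      have h1 := (h y).1
      rw [← ENNReal.ofReal_toReal (hfin y hy), ← ENNReal.ofReal_mul (by linarith)] at h1
      exact (ENNReal.ofReal_le_ofReal_iff (mul_nonneg (by linarith) ENNReal.toReal_nonneg)).1 h1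
  rcases logSum_isTheta hE with h0 | ⟨q, k, hk, h1⟩
  · obtain ⟨y, hy, hy0⟩ := ((isTheta_zero_right.1 (hGE.trans h0)).and self_mem_nhdsWithin).exists
    rcases (ENNReal.toReal_eq_zero_iff _).1 hy with h2 | h2
    · exact absurd h2 (hpos y hy0)
    · exact absurd h2 (hfin y hy0)
  · refine ⟨-q, k, hk, ?_⟩
    simp only [one_div, Rat.cast_neg, neg_neg]
    exact hGE.trans h1

end Semialg

namespace Semialg
open Filter Asymptotics Topology

/-- The dilation with exponents `α`. -/
def dilation {n : ℕ} (α : Fin n → ℕ) (t : ℝ) (x : Fin n → ℝ) : Fin n → ℝ := fun j => t ^ α j * x j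

lemma setLIntegral_dilation {n : ℕ} (α : Fin n → ℕ) {t : ℝ} (ht : 0 < t) {s : Set (Fin n → ℝ)}
    (hs : MeasurableSet s) {f : (Fin n → ℝ) → ENNReal} (hf : Measurable f) :
    ∫⁻ x in s, f x = ENNReal.ofReal (∏ j, t ^ α j) *
      ∫⁻ x in dilation α t ⁻¹' s, f (dilation α t x) := by
  have hdet : (Matrix.diagonal fun j => t ^ α j).det = ∏ j, t ^ α j := Matrix.det_diagonal
  have hpos : 0 < ∏ j, t ^ α j := Finset.prod_pos fun j _ => pow_pos ht _
  have hD : ⇑(Matrix.toLin' (Matrix.diagonal fun j => t ^ α j)) = dilation α t := by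
    funext x j
    simp [dilation, Matrix.mulVec_diagonal]
  have hm : Measurable (dilation α t) :=
    measurable_pi_lambda _ fun j => (measurable_pi_apply j).const_mul _
  have := Real.smul_map_diagonal_volume_pi (D := fun j => t ^ α j) (by rw [hdet]; exact hpos.ne')
  rw [hD, hdet, abs_of_pos hpos] at this
  conv_lhs => rw [← this]
  rw [setLIntegral_smul_measure, setLIntegral_map hs hf hm, smul_eq_mul]

lemma preimage_dilation_subset_cube {n : ℕ} {α : Fin n → ℕ} (hα : ∀ i, 0 < α i)
    {Ω : Set (Fin n → ℝ)} (hΩ : Bornology.IsBounded Ω) :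
    ∃ t, 0 < t ∧ dilation α t ⁻¹' Ω ⊆ cube n := by
  obtain ⟨R, hR0, hR⟩ := hΩ.exists_pos_norm_lt
  refine ⟨max 1 R, by positivity, fun x hx j _ => ?_⟩
  have h1 : |max 1 R ^ α j * x j| < R := (norm_le_pi_norm (dilation α _ x) j).trans_lt (hR _ hx)
  have h2 : R ≤ max 1 R ^ α j :=
    (le_max_right 1 R).trans (le_self_pow₀ (le_max_left 1 R) (hα j).ne')
  rw [abs_mul, abs_of_pos (hR0.trans_le h2)] at h1
  have h3 : |x j| < 1 := by
    by_contra! h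
    exact absurd h1 (not_lt.2 (h2.trans (le_mul_of_one_le_right (hR0.le.trans h2) h)))
  exact abs_lt.1 h3

lemma cube_subset_preimage_dilation {n : ℕ} {α : Fin n → ℕ} (hα : ∀ i, 0 < α i)
    {Ω : Set (Fin n → ℝ)} (hΩ : Ω ∈ 𝓝 0) :
    ∃ t, 0 < t ∧ cube n ⊆ dilation α t ⁻¹' Ω := by
  obtain ⟨ε, hε, h⟩ := Metric.mem_nhds_iff.1 hΩ
  refine ⟨min 1 (ε / 2), by positivity, fun x hx => h ?_⟩
  rw [mem_ball_zero_iff, pi_norm_lt_iff hε]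
  intro j
  have h1 : |x j| ≤ 1 := (abs_lt.2 (hx j trivial)).le
  have h0 : 0 < min 1 (ε / 2) := by positivity
  have h2 : min 1 (ε / 2) ^ α j ≤ ε / 2 :=
    (pow_le_of_le_one h0.le (min_le_left _ _) (hα j).ne').trans (min_le_right _ _)
  calc ‖dilation α (min 1 (ε / 2)) x j‖ = min 1 (ε / 2) ^ α j * |x j| := by
        rw [dilation, norm_mul, norm_pow, Real.norm_of_nonneg h0.le, Real.norm_eq_abs]
    _ ≤ ε / 2 * 1 := mul_le_mul h2 h1 (abs_nonneg _) (half_pos hε).le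
    _ < ε := by linarith

section

variable {n : ℕ} {ι : Type*} [Fintype ι]

/-- The weight `∑ᵢ |pᵢ(x)| r ^ dᵢ`. -/
noncomputable def weight (p : ι → MvPolynomial (Fin n) ℝ) (d : ι → ℕ) (r : ℝ) (x : Fin n → ℝ) :
    ℝ :=
  ∑ i, |MvPolynomial.eval x (p i)| * r ^ d i

variable {p : ι → MvPolynomial (Fin n) ℝ} {d : ι → ℕ}

lemma measurable_weight (r : ℝ) : Measurable (weight p d r) :=
  Finset.measurable_fun_sum _ fun i _ =>
    ((MvPolynomial.continuous_eval (p i)).abs.measurable).mul_const _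

lemma le_weight {i : ι} {c : ℝ} (hc : ∀ x, MvPolynomial.eval x (p i) = c) {r : ℝ} (hr : 0 < r)
    (x : Fin n → ℝ) : |c| * r ^ d i ≤ weight p d r x := by
  rw [← hc x]
  exact Finset.single_le_sum (f := fun i => |MvPolynomial.eval x (p i)| * r ^ d i)
    (fun i _ => by positivity) (Finset.mem_univ i)

lemma weight_dilation_comparable {α : Fin n → ℕ} {Q : ℝ}
    (hhom : ∀ i : ι, ∀ t : ℝ, 0 < t → ∀ x : Fin n → ℝ,
      MvPolynomial.eval (fun j => t ^ α j * x j) (p i) =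
        t ^ (Q - (d i : ℝ)) * MvPolynomial.eval x (p i)) {t : ℝ} (ht : 0 < t) :
    ∃ M : ℝ, 0 < M ∧ ∀ r, 0 < r → ∀ x, weight p d r (dilation α t x) ≤ M * weight p d r x ∧
      weight p d r x ≤ M * weight p d r (dilation α t x) := by
  set c : ι → ℝ := fun i => t ^ (Q - (d i : ℝ)) with hc
  have c0 : ∀ i, 0 < c i := fun i => Real.rpow_pos_of_pos ht _
  have e : ∀ r x, weight p d r (dilation α t x) =
      ∑ i, c i * (|MvPolynomial.eval x (p i)| * r ^ d i) := fun r x =>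
    Finset.sum_congr rfl fun i _ => by
      rw [show dilation α t x = fun j => t ^ α j * x j from rfl, hhom i t ht, abs_mul,
        abs_of_pos (c0 i), mul_assoc]
  have hM : ∀ i, c i + (c i)⁻¹ ≤ 1 + ∑ i, (c i + (c i)⁻¹) := fun i => by
    have := Finset.single_le_sum (f := fun i => c i + (c i)⁻¹)
      (fun i _ => (add_pos (c0 i) (inv_pos.2 (c0 i))).le) (Finset.mem_univ i)
    linarith
  have hM0 : 0 ≤ ∑ i, (c i + (c i)⁻¹) :=
    Finset.sum_nonneg fun i _ => (add_pos (c0 i) (inv_pos.2 (c0 i))).le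
  refine ⟨1 + ∑ i, (c i + (c i)⁻¹), by linarith, fun r hr x => ?_⟩
  rw [e, weight, Finset.mul_sum, Finset.mul_sum]
  constructor <;> refine Finset.sum_le_sum fun i _ => ?_
  · have := inv_pos.2 (c0 i)
    exact mul_le_mul_of_nonneg_right (by linarith [hM i]) (by positivity)
  · rw [← mul_assoc]
    refine le_mul_of_one_le_left (by positivity) ?_
    have := mul_le_mul_of_nonneg_right
      ((le_add_of_nonneg_left (c0 i).le).trans (hM i)) (c0 i).le
    rwa [inv_mul_cancel₀ (c0 i).ne'] at this

lemma eval_mem_mvAlg {X : Type} (B : Subalgebra ℝ (X → ℝ)) (q : MvPolynomial (Fin n) ℝ) :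
    (fun w : X × (Fin n → ℝ) => MvPolynomial.eval w.2 q) ∈ mvAlg B n := by
  induction q using MvPolynomial.induction_on with
  | C a => simpa using IsTame.const_mem a
  | add q q' h h' =>
    simp only [map_add]
    exact add_mem h h'
  | mul_X q j h =>
    simp only [map_mul, MvPolynomial.eval_X]
    exact mul_mem h (coord_mem_mvAlg j)

lemma weight_mem_mvAlg :
    (fun w : ℝ × (Fin n → ℝ) => weight p d w.1 w.2) ∈ mvAlg lineAlg n := by
  have hid : (fun w : ℝ × (Fin n → ℝ) => w.1) ∈ mvAlg lineAlg n :=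
    base_mem_mvAlg (b := id) (le_tameClosure (Algebra.subset_adjoin rfl))
  have := sum_mem (S := mvAlg lineAlg n) (t := Finset.univ)
    (f := fun (i : ι) (w : ℝ × (Fin n → ℝ)) => |MvPolynomial.eval w.2 (p i)| * w.1 ^ d i)
    fun i _ => mul_mem ((isTame_tameClosure _).abs_mem (eval_mem_mvAlg lineAlg (p i)))
      (pow_mem hid (d i))
  refine (congrArg (· ∈ mvAlg lineAlg n) (funext fun w => ?_)).mp this
  simp [weight]

/-- The reciprocal of the weight, extended by `0` to nonpositive parameters. -/
noncomputable def invWeight (p : ι → MvPolynomial (Fin n) ℝ) (d : ι → ℕ) (r : ℝ)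
    (x : Fin n → ℝ) : ENNReal :=
  ENNReal.ofReal (if 0 < r then (weight p d r x)⁻¹ else 0)

lemma invWeight_of_pos {r : ℝ} (hr : 0 < r) (x : Fin n → ℝ) :
    invWeight p d r x = ENNReal.ofReal (weight p d r x)⁻¹ := by
  rw [invWeight, if_pos hr]

lemma measurable_invWeight (r : ℝ) : Measurable (invWeight p d r) :=
  ((measurable_weight r).inv.ite (MeasurableSet.const _) measurable_const).ennreal_ofReal

lemma exists_invWeight_le {i : ι} {c : ℝ} (hc : ∀ x, MvPolynomial.eval x (p i) = c) (c0 : c ≠ 0)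
    (r : ℝ) : ∃ M : ENNReal, M < ⊤ ∧ ∀ x, invWeight p d r x ≤ M := by
  refine ⟨ENNReal.ofReal (|c| * r ^ d i)⁻¹, ENNReal.ofReal_lt_top, fun x => ?_⟩
  rw [invWeight]
  split_ifs with hr
  · have := abs_pos.2 c0
    exact ENNReal.ofReal_le_ofReal (inv_anti₀ (by positivity) (le_weight hc hr x))
  · simp

lemma logClass_invWeight :
    LogClass (mvAlg lineAlg n) 0 fun w => invWeight p d w.1 w.2 := by
  have hB : IsTame (mvAlg lineAlg n) := isTame_tameClosure _
  have hid : (fun w : ℝ × (Fin n → ℝ) => w.1) ∈ mvAlg lineAlg n :=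
    base_mem_mvAlg (b := id) (le_tameClosure (Algebra.subset_adjoin rfl))
  have hw := weight_mem_mvAlg (p := p) (d := d)
  have hg := hB.ite_mem (SA.lt (zero_mem _) hid) (hB.inv_mem hw) (zero_mem _)
  refine ⟨_, AddSubmonoid.subset_closure (logMon_mk hB (d := 0) (h := fun j => j.elim0) hg ?_
    fun j => j.elim0), 1, le_rfl, fun w => ?_⟩
  · intro w
    simp only [Pi.inv_apply, Pi.zero_apply]
    split_ifs with h
    · exact inv_nonneg.2 (Finset.sum_nonneg fun i _ => by have : 0 < w.1 := h; positivity)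
    · exact le_rfl
  · simp [Cmp, invWeight]

lemma setLIntegral_invWeight_lt_top {i : ι} {c : ℝ} (hc : ∀ x, MvPolynomial.eval x (p i) = c)
    (c0 : c ≠ 0) (r : ℝ) {s : Set (Fin n → ℝ)} (hs : volume s ≠ ⊤) :
    ∫⁻ x in s, invWeight p d r x < ⊤ := by
  obtain ⟨M, hM, h⟩ := exists_invWeight_le (p := p) (d := d) hc c0 r
  exact setLIntegral_lt_top_of_le_nnreal hs
    ⟨M.toNNReal, fun x _ => by rw [ENNReal.coe_toNNReal hM.ne]; exact h x⟩

lemma setLIntegral_invWeight_pos {i : ι} {c : ℝ} (hc : ∀ x, MvPolynomial.eval x (p i) = c)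
    (c0 : c ≠ 0) {r : ℝ} (hr : 0 < r) : 0 < ∫⁻ x in cube n, invWeight p d r x := by
  refine (setLIntegral_pos_iff (measurable_invWeight r)).2 ?_
  have : Function.support (invWeight p d r) = Set.univ := by
    refine Set.eq_univ_of_forall fun x => ?_
    rw [Function.mem_support, invWeight_of_pos hr]
    exact (ENNReal.ofReal_pos.2 (inv_pos.2 ((mul_pos (abs_pos.2 c0) (pow_pos hr _)).trans_le
      (le_weight hc hr x)))).ne'
  rw [this, Set.univ_inter]
  refine (isOpen_set_pi Set.finite_univ fun _ _ => isOpen_Ioo).measure_pos _ ⟨0, fun _ _ => ?_⟩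
  norm_num

/-- The asymptotics at `0⁺` of the integral of the reciprocal weight over the cube. -/
theorem lintegral_cube_invWeight_isTheta {i : ι} {c : ℝ}
    (hc : ∀ x, MvPolynomial.eval x (p i) = c) (c0 : c ≠ 0) :
    ∃ Q₀ : ℚ, ∃ k ≤ (Finset.univ.filter (fun j : Fin n =>
        ∃ r : ℝ, 0 < r ∧ ∃ x x' : Fin n → ℝ, (∀ k, k ≠ j → x k = x' k) ∧
          weight p d r x ≠ weight p d r x')).card,
      (fun r => (∫⁻ x in cube n, invWeight p d r x).toReal) =Θ[𝓝[>] 0]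
        fun r => r ^ (-(Q₀ : ℝ)) * Real.log (1 / r) ^ k := by
  have hG := logClass_lintegral_cube n (isTame_tameClosure _) (logClass_invWeight (p := p) (d := d))
    measurable_invWeight (exists_invWeight_le hc c0)
  obtain ⟨Q₀, k, hk, h⟩ := hG.asymptotics
    (fun r hr => (setLIntegral_invWeight_pos hc c0 hr).ne') fun r _ =>
    (setLIntegral_invWeight_lt_top hc c0 r (volume_cube_lt_top n).ne).ne
  refine ⟨Q₀, k, hk.trans ?_, h⟩
  rw [zero_add]
  refine Finset.card_le_card (Finset.monotone_filter_right _ fun j _ hj => ?_)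
  obtain ⟨r, x, x', hx, hne⟩ := hj
  have hr : 0 < r := by
    by_contra hr
    simp [invWeight, hr] at hne
  exact ⟨r, hr, x, x', hx, fun e => hne (by rw [invWeight, invWeight, e])⟩

lemma invWeight_dilation_comparable {i : ι} {c : ℝ} (hc : ∀ x, MvPolynomial.eval x (p i) = c)
    (c0 : c ≠ 0) {α : Fin n → ℕ} {Q : ℝ}
    (hhom : ∀ i : ι, ∀ t : ℝ, 0 < t → ∀ x : Fin n → ℝ,
      MvPolynomial.eval (fun j => t ^ α j * x j) (p i) =
        t ^ (Q - (d i : ℝ)) * MvPolynomial.eval x (p i)) {t : ℝ} (ht : 0 < t) :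
    ∃ M : ℝ, 0 < M ∧ ∀ r, 0 < r → ∀ x,
      invWeight p d r (dilation α t x) ≤ ENNReal.ofReal M * invWeight p d r x ∧
      invWeight p d r x ≤ ENNReal.ofReal M * invWeight p d r (dilation α t x) := by
  obtain ⟨M, hM, h⟩ := weight_dilation_comparable hhom ht
  have key : ∀ {a b : ℝ}, 0 < a → 0 < b → a ≤ M * b → b⁻¹ ≤ M * a⁻¹ := by
    intro a b ha hb hab
    rwa [← div_eq_mul_inv, le_div_iff₀ ha, inv_mul_le_iff₀ hb, mul_comm b]
  refine ⟨M, hM, fun r hr x => ?_⟩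
  have w0 : ∀ x, 0 < weight p d r x := fun x =>
    (mul_pos (abs_pos.2 c0) (pow_pos hr _)).trans_le (le_weight hc hr x)
  simp only [invWeight_of_pos hr, ← ENNReal.ofReal_mul hM.le]
  exact ⟨ENNReal.ofReal_le_ofReal (key (w0 _) (w0 _) (h r hr x).2),
    ENNReal.ofReal_le_ofReal (key (w0 _) (w0 _) (h r hr x).1)⟩

lemma setLIntegral_invWeight_comparable_cube {i : ι} {c : ℝ}
    (hc : ∀ x, MvPolynomial.eval x (p i) = c)
    (c0 : c ≠ 0) {α : Fin n → ℕ} (hα : ∀ i, 0 < α i) {Q : ℝ}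
    (hhom : ∀ i : ι, ∀ t : ℝ, 0 < t → ∀ x : Fin n → ℝ,
      MvPolynomial.eval (fun j => t ^ α j * x j) (p i) =
        t ^ (Q - (d i : ℝ)) * MvPolynomial.eval x (p i))
    {Ω : Set (Fin n → ℝ)} (hΩo : IsOpen Ω) (hΩb : Bornology.IsBounded Ω)
    (hΩ0 : (0 : Fin n → ℝ) ∈ Ω) :
    ∃ K : ℝ, 0 < K ∧ ∀ r, 0 < r →
      ∫⁻ x in Ω, invWeight p d r x ≤ ENNReal.ofReal K * ∫⁻ x in cube n, invWeight p d r x ∧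
      ∫⁻ x in cube n, invWeight p d r x ≤ ENNReal.ofReal K * ∫⁻ x in Ω, invWeight p d r x := by
  obtain ⟨t, ht, hsub⟩ := preimage_dilation_subset_cube hα hΩb
  obtain ⟨s, hs, hsup⟩ := cube_subset_preimage_dilation hα (hΩo.mem_nhds hΩ0)
  obtain ⟨M, hM, h⟩ := invWeight_dilation_comparable hc c0 hhom ht
  obtain ⟨N, hN, h'⟩ := invWeight_dilation_comparable hc c0 hhom hs
  have ht' : 0 < ∏ j, t ^ α j := Finset.prod_pos fun j _ => pow_pos ht _
  have hs' : 0 < ∏ j, s ^ α j := Finset.prod_pos fun j _ => pow_pos hs _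
  refine ⟨max ((∏ j, t ^ α j) * M) (N * (∏ j, s ^ α j)⁻¹), by positivity, fun r hr => ⟨?_, ?_⟩⟩
  · calc ∫⁻ x in Ω, invWeight p d r x
        = ENNReal.ofReal (∏ j, t ^ α j) *
            ∫⁻ x in dilation α t ⁻¹' Ω, invWeight p d r (dilation α t x) :=
          setLIntegral_dilation α ht hΩo.measurableSet (measurable_invWeight r)
      _ ≤ ENNReal.ofReal (∏ j, t ^ α j) *
            ∫⁻ x in cube n, ENNReal.ofReal M * invWeight p d r x := by
          refine mul_le_mul_right ?_ _
          exact (lintegral_mono_set hsub).trans (lintegral_mono fun x => (h r hr x).1)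
      _ = ENNReal.ofReal ((∏ j, t ^ α j) * M) * ∫⁻ x in cube n, invWeight p d r x := by
          rw [lintegral_const_mul _ (measurable_invWeight r), ENNReal.ofReal_mul ht'.le, mul_assoc]
      _ ≤ _ := by
          gcongr
          exact le_max_left _ _
  · calc ∫⁻ x in cube n, invWeight p d r x
        ≤ ∫⁻ x in dilation α s ⁻¹' Ω, ENNReal.ofReal N * invWeight p d r (dilation α s x) :=
          (lintegral_mono fun x => (h' r hr x).2).trans (lintegral_mono_set hsup)
      _ = ENNReal.ofReal N * ∫⁻ x in dilation α s ⁻¹' Ω, invWeight p d r (dilation α s x) :=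
          lintegral_const_mul' _ _ ENNReal.ofReal_ne_top
      _ = ENNReal.ofReal (N * (∏ j, s ^ α j)⁻¹) * ∫⁻ x in Ω, invWeight p d r x := by
          rw [setLIntegral_dilation α hs hΩo.measurableSet (measurable_invWeight r), ← mul_assoc,
            ← ENNReal.ofReal_mul (by positivity), inv_mul_cancel_right₀ hs'.ne']
      _ ≤ _ := by
          gcongr
          exact le_max_right _ _

end

end Semialg

/-- Let `(λ_i)` be a finite nonempty family of polynomials on `ℝⁿ` with
`λ_i(δ_t x) = t^{Q−d_i} λ_i(x)`, one of which is a nonzero constant, and set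
`Λ(x,r) = Σ_i |λ_i(x)| r^{d_i}`. If `v` is the number of coordinates on which `Λ` genuinely
depends (degenerate indices), then for every bounded open `Ω ∋ 0` there are `Q₀ ∈ ℚ` and
`d₀ ∈ {0,…,v}` with `∫_Ω Λ(x,r)⁻¹ dx ≈ r^{−Q₀} (ln(1/r))^{d₀}` as `r → 0⁺`. -/
theorem stmt14 (n : ℕ) (α : Fin n → ℕ) (hα : ∀ i, 0 < α i)
    {ι : Type*} [Fintype ι] [Nonempty ι]
    (p : ι → MvPolynomial (Fin n) ℝ) (d : ι → ℕ)
    (hhom : ∀ i : ι, ∀ t : ℝ, 0 < t → ∀ x : Fin n → ℝ,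
      MvPolynomial.eval (fun j => t ^ α j * x j) (p i) =
        t ^ (((∑ j, α j : ℕ) : ℝ) - (d i : ℝ)) * MvPolynomial.eval x (p i))
    (hconst : ∃ i₀ : ι, ∃ c : ℝ, c ≠ 0 ∧ ∀ x : Fin n → ℝ, MvPolynomial.eval x (p i₀) = c)
    (Ω : Set (Fin n → ℝ)) (hΩo : IsOpen Ω) (hΩb : Bornology.IsBounded Ω)
    (hΩ0 : (0 : Fin n → ℝ) ∈ Ω) :
    ∃ (Q₀ : ℚ) (d₀ : ℕ),
      d₀ ≤ (Finset.univ.filter (fun j : Fin n =>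
        ∃ r : ℝ, 0 < r ∧ ∃ x x' : Fin n → ℝ, (∀ k, k ≠ j → x k = x' k) ∧
          (∑ i : ι, |MvPolynomial.eval x (p i)| * r ^ d i) ≠
          (∑ i : ι, |MvPolynomial.eval x' (p i)| * r ^ d i))).card ∧
      ∃ C : ℝ, 1 ≤ C ∧ ∃ r₀ : ℝ, 0 < r₀ ∧ r₀ < 1 ∧ ∀ r : ℝ, 0 < r → r < r₀ →
        C⁻¹ * (r ^ (-(Q₀ : ℝ)) * Real.log (1/r) ^ d₀) ≤
          (∫ x in Ω, (∑ i : ι, |MvPolynomial.eval x (p i)| * r ^ d i)⁻¹) ∧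
        (∫ x in Ω, (∑ i : ι, |MvPolynomial.eval x (p i)| * r ^ d i)⁻¹) ≤
          C * (r ^ (-(Q₀ : ℝ)) * Real.log (1/r) ^ d₀) := by
  obtain ⟨i₀, c, c0, hc⟩ := hconst
  obtain ⟨Q₀, k, hk, hu, hl⟩ := Semialg.lintegral_cube_invWeight_isTheta (d := d) hc c0
  obtain ⟨K, hK, hcmp⟩ := Semialg.setLIntegral_invWeight_comparable_cube hc c0 hα hhom hΩo hΩb hΩ0
  refine ⟨Q₀, k, hk, ?_⟩
  have h_int : ∀ r, 0 < r → ∫ x in Ω, (∑ i : ι, |MvPolynomial.eval x (p i)| * r ^ d i)⁻¹ =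
      (∫⁻ x in Ω, Semialg.invWeight p d r x).toReal := by
    intro r hr
    simp only [Semialg.invWeight_of_pos hr]
    exact integral_eq_lintegral_of_nonneg_ae
      (Filter.Eventually.of_forall fun x =>
        inv_nonneg.2 (Finset.sum_nonneg fun i _ => by positivity))
      (Semialg.measurable_weight (p := p) (d := d) r).inv.aestronglyMeasurable
  have hfin : ∀ r, ∀ s : Set (Fin n → ℝ), volume s ≠ ⊤ →
      ∫⁻ x in s, Semialg.invWeight p d r x ≠ ⊤ := fun r s hs =>
    (Semialg.setLIntegral_invWeight_lt_top hc c0 r hs).ne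
  obtain ⟨C, hC0, hC⟩ := hu.exists_pos
  obtain ⟨D, hD0, hD⟩ := hl.exists_pos
  obtain ⟨r₀, hr₀, hr⟩ := mem_nhdsGT_iff_exists_Ioo_subset.1
    (hC.bound.and hD.bound)
  refine ⟨max 1 (max (K * C) (D * K)), le_max_left _ _, min r₀ (1 / 2),
    lt_min hr₀ one_half_pos, (min_le_right _ _).trans_lt one_half_lt_one, fun r h0 h1 => ?_⟩
  obtain ⟨h2, h3⟩ := hr ⟨h0, h1.trans_le (min_le_left _ _)⟩
  have h4 : r < 1 := h1.trans ((min_le_right _ _).trans_lt one_half_lt_one)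
  have hg : 0 ≤ r ^ (-(Q₀ : ℝ)) * Real.log (1 / r) ^ k :=
    mul_nonneg (Real.rpow_nonneg h0.le _)
      (pow_nonneg (Real.log_nonneg (one_le_one_div h0 h4.le)) _)
  rw [h_int r h0]
  set g := r ^ (-(Q₀ : ℝ)) * Real.log (1 / r) ^ k
  set I := (∫⁻ x in Ω, Semialg.invWeight p d r x).toReal
  set J := (∫⁻ x in Semialg.cube n, Semialg.invWeight p d r x).toReal
  have hI : I ≤ K * J := by
    have := ENNReal.toReal_mono (ENNReal.mul_ne_top ENNReal.ofReal_ne_top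
      (hfin r _ (Semialg.volume_cube_lt_top n).ne)) (hcmp r h0).1
    rwa [ENNReal.toReal_mul, ENNReal.toReal_ofReal hK.le] at this
  have hJ : J ≤ K * I := by
    have := ENNReal.toReal_mono (ENNReal.mul_ne_top ENNReal.ofReal_ne_top
      (hfin r _ hΩb.measure_lt_top.ne)) (hcmp r h0).2
    rwa [ENNReal.toReal_mul, ENNReal.toReal_ofReal hK.le] at this
  have hI0 : 0 ≤ I := ENNReal.toReal_nonneg
  have hJ0 : 0 ≤ J := ENNReal.toReal_nonneg
  rw [Real.norm_of_nonneg hg, Real.norm_of_nonneg hJ0] at h2 h3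
  constructor
  · rw [inv_mul_le_iff₀ (by positivity)]
    calc g ≤ D * (K * I) := h3.trans (by gcongr)
      _ = D * K * I := (mul_assoc _ _ _).symm
      _ ≤ _ := by
        gcongr
        exact (le_max_right _ _).trans (le_max_right _ _)
  · calc I ≤ K * (C * g) := hI.trans (by gcongr)
      _ = K * C * g := (mul_assoc _ _ _).symm
      _ ≤ _ := by
        gcongr
        exact (le_max_left _ _).trans (le_max_right _ _)
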